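/- Let ε > 0, let x ≥ 2, let d ≥ 1 be an integer with d ≤ x, let x^{1/2} ≤ Y ≤ x satisfy x²d³/Y³ ≥ x^{1/100}, and let w be a smooth cutoff adapted to (Y, x) as specified. Then Σ′_{h=1}^{d} |Δ̃(h/d)|² ≪_ε x^{ε} · ( (xd/Y)² · d + x·d ). -/

import Mathlib

open scoped BigOperators

/-- `e(t) = exp(2πit)` -/
noncomputable def e (t : ℝ) : ℂ := Complex.exp (2 * Real.pi * Complex.I * t)

/-- the 3-fold divisor function `d₃(n) = Σ_{abc=n} 1` -/
def d3 (n : ℕ) : ℕ :=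
  ((Finset.Icc 1 n ×ˢ Finset.Icc 1 n ×ˢ Finset.Icc 1 n).filter
    (fun p : ℕ × ℕ × ℕ => p.1 * p.2.1 * p.2.2 = n)).card

section

open Complex Filter Topology MeasureTheory

lemma exists_norm_mellin_le_of_strip {f : ℝ → ℂ} {a b : ℝ}
    (ha : MellinConvergent f a) (hb : MellinConvergent f b) :
    ∃ M : ℝ, ∀ s : ℂ, a ≤ s.re → s.re ≤ b → ‖mellin f s‖ ≤ M := by
  refine ⟨(∫ t in Set.Ioi (0 : ℝ), ‖(t : ℂ) ^ ((a : ℂ) - 1) • f t‖) +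
    ∫ t in Set.Ioi (0 : ℝ), ‖(t : ℂ) ^ ((b : ℂ) - 1) • f t‖, fun s hs hs' => ?_⟩
  rw [← integral_add ha.norm hb.norm, mellin]
  refine norm_integral_le_of_norm_le (ha.norm.add hb.norm) ?_
  filter_upwards [ae_restrict_mem measurableSet_Ioi] with t ht
  have ht0 : 0 < t := ht
  simp only [norm_smul]
  rw [norm_cpow_eq_rpow_re_of_pos ht0, norm_cpow_eq_rpow_re_of_pos ht0,
    norm_cpow_eq_rpow_re_of_pos ht0, ← add_mul]
  refine mul_le_mul_of_nonneg_right ?_ (norm_nonneg _)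
  simp only [sub_re, ofReal_re, one_re]
  rcases le_total t 1 with h1 | h1
  · have := Real.rpow_le_rpow_of_exponent_ge ht0 h1 (sub_le_sub_right hs 1)
    have h2 := Real.rpow_nonneg ht0.le (b - 1)
    linarith
  · have := Real.rpow_le_rpow_of_exponent_le h1 (sub_le_sub_right hs' 1)
    have h2 := Real.rpow_nonneg ht0.le (a - 1)
    linarith

/-- Phragmén–Lindelöf in strips of width at most `3`. -/
lemma norm_le_of_norm_le_on_edges {f : ℂ → ℂ} {a b C B : ℝ} (hab : a < b) (hab3 : b - a ≤ 3)
    (hd : ∀ z : ℂ, a ≤ z.re → z.re ≤ b → DifferentiableAt ℂ f z)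
    (hB : ∀ z : ℂ, a ≤ z.re → z.re ≤ b → 1 ≤ |z.im| → ‖f z‖ ≤ Real.exp (B * Real.exp |z.im|))
    (ha : ∀ z : ℂ, z.re = a → ‖f z‖ ≤ C) (hb : ∀ z : ℂ, z.re = b → ‖f z‖ ≤ C)
    (z : ℂ) (hz : a ≤ z.re) (hz' : z.re ≤ b) : ‖f z‖ ≤ C := by
  refine PhragmenLindelof.vertical_strip (a := a) (b := b) ?_ ⟨1, ?_, B, ?_⟩ ha hb hz hz'
  · refine DifferentiableOn.diffContOnCl fun w hw => ?_
    have : closure (re ⁻¹' Set.Ioo a b) ⊆ re ⁻¹' Set.Icc a b :=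
      closure_minimal (Set.preimage_mono Set.Ioo_subset_Icc_self)
        (isClosed_Icc.preimage continuous_re)
    have hw' := this hw
    exact (hd w hw'.1 hw'.2).differentiableWithinAt
  · rw [lt_div_iff₀ (by linarith)]
    linarith [Real.pi_gt_three]
  · refine Asymptotics.IsBigO.of_bound 1 ?_
    rw [eventually_inf_principal]
    have : ∀ᶠ z : ℂ in comap (_root_.abs ∘ im) atTop, 1 ≤ |z.im| :=
      tendsto_comap.eventually (eventually_ge_atTop 1)
    filter_upwards [this] with w hw hw'
    have := hB w hw'.1.le hw'.2.le hw
    rw [one_mul, one_mul, Real.norm_eq_abs, abs_of_pos (Real.exp_pos _)]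
    exact this

lemma exists_norm_Gamma_le_of_strip {a b : ℝ} (ha : 0 < a) (hb : 0 < b) :
    ∃ M : ℝ, 0 < M ∧ ∀ s : ℂ, a ≤ s.re → s.re ≤ b → ‖Gamma s‖ ≤ M := by
  have hc : ∀ a : ℝ, 0 < a → MellinConvergent (fun x => (Real.exp (-x) : ℂ)) a := by
    intro a ha
    have := GammaIntegral_convergent (s := a) (by simpa using ha)
    refine this.congr_fun (fun x _ => ?_) measurableSet_Ioi
    simp [mul_comm]
  obtain ⟨M, hM⟩ := exists_norm_mellin_le_of_strip (hc a ha) (hc b hb)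
  refine ⟨max M 1, by positivity, fun s hs hs' => ?_⟩
  rw [Gamma_eq_integral (by linarith), GammaIntegral_eq_mellin]
  exact (hM s hs hs').trans (le_max_left _ _)

lemma norm_Gamma_half_sq_mul_exp_le (t : ℝ) :
    ‖Gamma (1 / 2 + t * I)‖ ^ 2 * Real.exp (Real.pi * |t|) ≤ 2 * Real.pi := by
  have h1 := Gamma_mul_Gamma_one_sub (1 / 2 + t * I)
  have h2 : (1 : ℂ) - (1 / 2 + t * I) = (starRingEnd ℂ) (1 / 2 + t * I) := by
    simp only [map_add, map_mul, conj_ofReal, conj_I, map_div₀, map_one]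
    rw [show (starRingEnd ℂ) 2 = 2 from conj_ofReal 2]; ring
  have h3 : sin (Real.pi * (1 / 2 + t * I)) = (Real.cosh (Real.pi * t) : ℂ) := by
    rw [show (Real.pi * (1 / 2 + t * I) : ℂ) = (Real.pi * t : ℂ) * I + Real.pi / 2 by ring,
      sin_add_pi_div_two, cos_mul_I]
    push_cast; rfl
  rw [h2, Gamma_conj, h3, mul_conj, normSq_eq_norm_sq] at h1
  have h4 : ‖Gamma (1 / 2 + t * I)‖ ^ 2 = Real.pi / Real.cosh (Real.pi * t) := by
    exact_mod_cast h1
  rw [h4]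
  have h5 : Real.exp (Real.pi * |t|) ≤ 2 * Real.cosh (Real.pi * t) := by
    rw [Real.cosh_eq]
    rcases abs_cases t with ⟨h, _⟩ | ⟨h, _⟩ <;> rw [h]
    · have := Real.exp_pos (-(Real.pi * t)); linarith
    · have := Real.exp_pos (Real.pi * t)
      rw [show Real.pi * -t = -(Real.pi * t) by ring]; linarith
  have h6 := Real.cosh_pos (Real.pi * t)
  rw [div_mul_eq_mul_div, div_le_iff₀ h6]
  nlinarith [Real.pi_pos]

lemma norm_Gamma_half_mul_exp_le (t : ℝ) :
    ‖Gamma (1 / 2 + t * I)‖ * Real.exp (Real.pi / 2 * |t|) ≤ 3 := by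
  have h := norm_Gamma_half_sq_mul_exp_le t
  refine abs_le_of_sq_le_sq' ?_ (by norm_num) |>.2
  rw [mul_pow, ← Real.exp_nat_mul]
  have : ((2 : ℕ) : ℝ) * (Real.pi / 2 * |t|) = Real.pi * |t| := by push_cast; ring
  rw [this]
  linarith [Real.pi_lt_four]

lemma norm_Gamma_three_half_mul_exp_le (t : ℝ) :
    ‖Gamma (3 / 2 + t * I)‖ * Real.exp (Real.pi / 2 * |t|) ≤ 3 * (1 + |t|) := by
  have h0 : (1 / 2 + t * I : ℂ) ≠ 0 := fun h => by simpa using congrArg re h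
  have h1 : Gamma (3 / 2 + t * I) = (1 / 2 + t * I) * Gamma (1 / 2 + t * I) := by
    rw [← Gamma_add_one _ h0]; congr 1; ring
  have h2 : ‖(1 / 2 + t * I : ℂ)‖ ≤ 1 + |t| := by
    refine (norm_add_le _ _).trans ?_
    simp; norm_num
  rw [h1, norm_mul, mul_assoc, mul_comm 3]
  exact mul_le_mul h2 (norm_Gamma_half_mul_exp_le t) (by positivity) (by positivity)

lemma exists_norm_Gamma_mul_exp_le_of_nonneg :
    ∃ K : ℝ, 0 < K ∧ ∀ c : ℝ, 1 / 2 ≤ c → c ≤ 3 / 2 → ∀ τ : ℝ, 0 ≤ τ →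
      ‖Gamma (c + τ * I)‖ * Real.exp (Real.pi / 2 * τ) ≤ K * (1 + τ) ^ (c - 1 / 2) := by
  refine ⟨6 * Real.exp (9 / 4), by positivity, fun c hc hc' τ hτ => ?_⟩
  obtain ⟨M, hM0, hM⟩ := exists_norm_Gamma_le_of_strip (a := 1 / 2) (b := 3 / 2) (by norm_num)
    (by norm_num)
  set F : ℂ → ℂ := fun s => Gamma s * exp (-(Real.pi / 2) * I * s) * exp ((s - τ * I) ^ 2) *
    exp (-(Real.log (1 + τ)) * (s - 1 / 2)) with hF
  have hnorm : ∀ s : ℂ, ‖F s‖ = ‖Gamma s‖ * Real.exp (Real.pi / 2 * s.im) *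
      Real.exp (s.re ^ 2 - (s.im - τ) ^ 2) *
      Real.exp (-(Real.log (1 + τ)) * (s.re - 1 / 2)) := by
    intro s
    simp only [hF, norm_mul, norm_exp]
    congr 3
    · congr 2; simp
    · simp [pow_two]
    · simp
  have hlog : 0 ≤ Real.log (1 + τ) := Real.log_nonneg (by linarith)
  have hle : ‖F (c + τ * I)‖ ≤ 6 * Real.exp (9 / 4) := by
    refine norm_le_of_norm_le_on_edges (a := 1 / 2) (b := 3 / 2)
      (B := M + 2 + 9 / 4) (by norm_num) (by norm_num) ?_ ?_ ?_ ?_ _ (by simpa using hc)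
      (by simpa using hc')
    · intro z hz _
      have hG : DifferentiableAt ℂ Gamma z := by
        refine differentiableAt_Gamma z fun m hm => ?_
        rw [hm] at hz; simp at hz
        have : (0 : ℝ) ≤ m := m.cast_nonneg
        linarith
      have h2 : DifferentiableAt ℂ (fun s : ℂ => exp (-(Real.pi / 2) * I * s)) z := by fun_prop
      have h3 : DifferentiableAt ℂ (fun s : ℂ => exp ((s - τ * I) ^ 2)) z := by fun_prop
      have h4 : DifferentiableAt ℂ (fun s : ℂ => exp (-(Real.log (1 + τ)) * (s - 1 / 2))) z := by
        fun_prop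
      exact ((hG.mul h2).mul h3).mul h4
    · intro z hz hz' him
      rw [hnorm]
      have e1 : |z.im| + 1 ≤ Real.exp |z.im| := Real.add_one_le_exp _
      have h1 : ‖Gamma z‖ ≤ Real.exp M := (hM z hz hz').trans (by linarith [Real.add_one_le_exp M])
      have h2 : Real.exp (-(Real.log (1 + τ)) * (z.re - 1 / 2)) ≤ 1 := by
        rw [Real.exp_le_one_iff]
        have := mul_nonneg hlog (by linarith : 0 ≤ z.re - 1 / 2)
        linarith
      have h3 : Real.exp (Real.pi / 2 * z.im) ≤ Real.exp (2 * |z.im|) := by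
        apply Real.exp_le_exp.mpr
        have := le_abs_self z.im
        nlinarith [Real.pi_lt_four, Real.pi_pos, abs_nonneg z.im]
      have h4 : Real.exp (z.re ^ 2 - (z.im - τ) ^ 2) ≤ Real.exp (9 / 4) := by
        apply Real.exp_le_exp.mpr
        nlinarith [sq_nonneg (z.im - τ)]
      calc _ ≤ Real.exp M * Real.exp (2 * |z.im|) * Real.exp (9 / 4) * 1 := by gcongr
        _ = Real.exp (M + 2 * |z.im| + 9 / 4) := by rw [mul_one, Real.exp_add, Real.exp_add]
        _ ≤ _ := by
          apply Real.exp_le_exp.mpr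
          have := abs_nonneg z.im
          nlinarith
    · intro z hz
      have hz2 : z = 1 / 2 + z.im * I := by apply Complex.ext <;> simp [hz]
      rw [hnorm, hz]
      have h1 := norm_Gamma_half_mul_exp_le z.im
      rw [← hz2] at h1
      have h2 : Real.exp (Real.pi / 2 * z.im) ≤ Real.exp (Real.pi / 2 * |z.im|) := by
        gcongr; exact le_abs_self _
      have h3 : Real.exp ((1 / 2) ^ 2 - (z.im - τ) ^ 2) ≤ Real.exp (9 / 4) := by
        apply Real.exp_le_exp.mpr; nlinarith [sq_nonneg (z.im - τ)]
      rw [sub_self, mul_zero, Real.exp_zero, mul_one]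
      calc _ ≤ (‖Gamma z‖ * Real.exp (Real.pi / 2 * |z.im|)) * Real.exp (9 / 4) := by gcongr
        _ ≤ 3 * Real.exp (9 / 4) := by gcongr
        _ ≤ _ := by have := Real.exp_pos (9 / 4); linarith
    · intro z hz
      have hz2 : z = 3 / 2 + z.im * I := by apply Complex.ext <;> simp [hz]
      rw [hnorm, hz]
      have h1 := norm_Gamma_three_half_mul_exp_le z.im
      rw [← hz2] at h1
      have h2 : Real.exp (Real.pi / 2 * z.im) ≤ Real.exp (Real.pi / 2 * |z.im|) := by
        gcongr; exact le_abs_self _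
      have h4 : Real.exp (-(Real.log (1 + τ)) * (3 / 2 - 1 / 2)) = (1 + τ)⁻¹ := by
        rw [show (3 / 2 - 1 / 2 : ℝ) = 1 by norm_num, mul_one, Real.exp_neg,
          Real.exp_log (by linarith)]
      have h5 : Real.exp ((3 / 2) ^ 2 - (z.im - τ) ^ 2) =
          Real.exp (9 / 4) * Real.exp (-(z.im - τ) ^ 2) := by
        rw [← Real.exp_add]; congr 1; ring
      have h6 : (1 + |z.im|) * Real.exp (-(z.im - τ) ^ 2) ≤ 2 * (1 + τ) := by
        have a1 : |z.im| ≤ |z.im - τ| + τ := by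
          have := abs_add_le (z.im - τ) τ
          rw [sub_add_cancel, abs_of_nonneg hτ] at this; exact this
        have a2 : (z.im - τ) ^ 2 + 1 ≤ Real.exp ((z.im - τ) ^ 2) := Real.add_one_le_exp _
        have a3 : 0 < Real.exp ((z.im - τ) ^ 2) := Real.exp_pos _
        rw [Real.exp_neg, ← div_eq_mul_inv, div_le_iff₀ a3]
        have a4 : |z.im - τ| ≤ (z.im - τ) ^ 2 + 1 := by
          rw [← sq_abs]; nlinarith [sq_nonneg (|z.im - τ| - 1), abs_nonneg (z.im - τ)]
        nlinarith
      rw [h4, h5]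
      calc _ ≤ ‖Gamma z‖ * Real.exp (Real.pi / 2 * |z.im|) *
              (Real.exp (9 / 4) * Real.exp (-(z.im - τ) ^ 2)) * (1 + τ)⁻¹ := by gcongr
        _ ≤ 3 * (1 + |z.im|) * (Real.exp (9 / 4) * Real.exp (-(z.im - τ) ^ 2)) * (1 + τ)⁻¹ := by
            gcongr
        _ = 3 * Real.exp (9 / 4) * ((1 + |z.im|) * Real.exp (-(z.im - τ) ^ 2)) * (1 + τ)⁻¹ := by
            ring
        _ ≤ 3 * Real.exp (9 / 4) * (2 * (1 + τ)) * (1 + τ)⁻¹ := by gcongr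
        _ = _ := by field_simp; ring
  rw [hnorm] at hle
  simp only [add_re, ofReal_re, mul_re, I_re, mul_zero, ofReal_im, I_im, mul_one, sub_self,
    add_zero, add_im, mul_im, zero_add, ne_eq, OfNat.ofNat_ne_zero, not_false_eq_true, zero_pow,
    sub_zero] at hle
  have h1 : Real.exp (-Real.log (1 + τ) * (c - 1 / 2)) = ((1 + τ) ^ (c - 1 / 2))⁻¹ := by
    rw [Real.rpow_def_of_pos (by linarith), ← Real.exp_neg]; congr 1; ring
  rw [h1, ← div_eq_mul_inv, div_le_iff₀ (by positivity)] at hle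
  refine le_trans ?_ hle
  refine le_mul_of_one_le_right (by positivity) ?_
  exact Real.one_le_exp (sq_nonneg _)

lemma norm_Gamma_conj_im (c τ : ℝ) : ‖Gamma (c + τ * I)‖ = ‖Gamma (c + |τ| * I)‖ := by
  rcases abs_cases τ with ⟨h, _⟩ | ⟨h, _⟩ <;> rw [h]
  rw [← norm_conj, ← Gamma_conj]
  congr 2
  simp

/-- Stirling-type upper bound for the Gamma function on a vertical line. -/
lemma exists_norm_Gamma_mul_exp_le {c : ℝ} (hc : 0 < c) (hc' : c ≤ 3 / 2) :
    ∃ K : ℝ, 0 < K ∧ ∀ τ : ℝ,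
      ‖Gamma (c + τ * I)‖ * Real.exp (Real.pi / 2 * |τ|) ≤ K * (1 + |τ|) ^ (c - 1 / 2) := by
  obtain ⟨K, hK0, hK⟩ := exists_norm_Gamma_mul_exp_le_of_nonneg
  rcases le_or_gt (1 / 2) c with h | h
  · refine ⟨K, hK0, fun τ => ?_⟩
    rw [norm_Gamma_conj_im]
    exact hK c h hc' _ (abs_nonneg τ)
  · refine ⟨K * (2 / c), by positivity, fun τ => ?_⟩
    have h0 : (c + τ * I : ℂ) ≠ 0 := fun h0 => hc.ne' (by simpa using congrArg re h0)
    have h1 := Gamma_add_one _ h0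
    have h2 := hK (c + 1) (by linarith) (by linarith) _ (abs_nonneg τ)
    have h3 : ‖Gamma (c + τ * I + 1)‖ = ‖Gamma ((c + 1 : ℝ) + |τ| * I)‖ := by
      rw [← norm_Gamma_conj_im]; congr 2; push_cast; ring
    rw [← h3, h1, norm_mul] at h2
    have h4 : c / 2 * (1 + |τ|) ≤ ‖(c + τ * I : ℂ)‖ := by
      have a := abs_re_le_norm (c + τ * I : ℂ)
      have b := abs_im_le_norm (c + τ * I : ℂ)
      simp only [add_re, ofReal_re, mul_re, I_re, mul_zero, ofReal_im, I_im, mul_one, sub_self,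
        add_zero, add_im, mul_im, zero_add] at a b
      rw [abs_of_pos hc] at a
      nlinarith [abs_nonneg τ]
    have h5 : (1 + |τ|) ^ (c + 1 - 1 / 2) = (1 + |τ|) ^ (c - 1 / 2) * (1 + |τ|) := by
      rw [← Real.rpow_add_one (by positivity)]; congr 1; ring
    rw [h5] at h2
    set G := ‖Gamma (c + τ * I)‖ * Real.exp (Real.pi / 2 * |τ|) with hG
    have hG0 : 0 ≤ G := by positivity
    have h6 : c / 2 * (1 + |τ|) * G ≤ K * ((1 + |τ|) ^ (c - 1 / 2) * (1 + |τ|)) := by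
      refine le_trans ?_ h2
      rw [mul_assoc ‖_‖, ← hG]; gcongr
    have h7 : 0 < 1 + |τ| := by positivity
    have h8 : c / 2 * G ≤ K * (1 + |τ|) ^ (c - 1 / 2) := by
      by_contra hcon; push Not at hcon
      have := mul_lt_mul_of_pos_right hcon h7
      nlinarith
    rw [show K * (2 / c) * (1 + |τ|) ^ (c - 1 / 2) = (K * (1 + |τ|) ^ (c - 1 / 2)) / (c / 2) by
      field_simp, le_div_iff₀ (by positivity)]
    linarith

end

section

/-- A smooth cutoff adapted to `(Y, x)` with derivative constants `Cd`. -/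
structure IsCutoff (Cd : ℕ → ℝ) (x Y : ℝ) (w : ℝ → ℝ) : Prop where
  one_le : 1 ≤ Y
  le : Y ≤ x
  contDiff : ContDiff ℝ (⊤ : ℕ∞) w
  left : ∀ t : ℝ, 0 ≤ t → t ≤ Y → w t = 0
  mid : ∀ t : ℝ, 2 * Y ≤ t → t ≤ x - Y → w t = 1
  right : ∀ t : ℝ, x ≤ t → w t = 0
  bound : ∀ i : ℕ, ∀ t : ℝ, 0 ≤ t → |iteratedDeriv i w t| ≤ Cd i / Y ^ i

namespace IsCutoff

variable {Cd : ℕ → ℝ} {x Y : ℝ} {w : ℝ → ℝ}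

lemma const_nonneg (h : IsCutoff Cd x Y w) (i : ℕ) : 0 ≤ Cd i := by
  have h1 := (abs_nonneg _).trans (h.bound i 0 le_rfl)
  have : 0 < Y ^ i := pow_pos (by linarith [h.one_le]) _
  by_contra hc
  push Not at hc
  have := div_neg_of_neg_of_pos hc this
  linarith

lemma continuous_iteratedDeriv (h : IsCutoff Cd x Y w) (i : ℕ) :
    Continuous (iteratedDeriv i w) :=
  h.contDiff.continuous_iteratedDeriv i (by exact_mod_cast le_top)

lemma hasDerivAt_iteratedDeriv (h : IsCutoff Cd x Y w) (i : ℕ) (t : ℝ) :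
    HasDerivAt (iteratedDeriv i w) (iteratedDeriv (i + 1) w t) t := by
  rw [iteratedDeriv_succ]
  exact ((h.contDiff.differentiable_iteratedDeriv i (by exact_mod_cast ENat.natCast_lt_top i)) t).hasDerivAt

lemma iteratedDeriv_eq_zero_of_eqOn {f : ℝ → ℝ} {c : ℝ} {s : Set ℝ} (hs : IsOpen s)
    (hf : ∀ t ∈ s, f t = c) {i : ℕ} (hi : i ≠ 0 ∨ c = 0) {t : ℝ} (ht : t ∈ s) :
    iteratedDeriv i f t = 0 := by
  have : f =ᶠ[nhds t] fun _ => c := by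
    filter_upwards [hs.mem_nhds ht] with u hu using hf u hu
  rw [this.iteratedDeriv_eq, iteratedDeriv_const]
  rcases hi with hi | hi <;> simp [hi]

lemma iteratedDeriv_left (h : IsCutoff Cd x Y w) (i : ℕ) {t : ℝ} (ht : 0 < t) (ht' : t < Y) :
    iteratedDeriv i w t = 0 :=
  iteratedDeriv_eq_zero_of_eqOn isOpen_Ioo (fun u hu => h.left u hu.1.le hu.2.le) (Or.inr rfl)
    (s := Set.Ioo 0 Y) ⟨ht, ht'⟩

lemma iteratedDeriv_right (h : IsCutoff Cd x Y w) (i : ℕ) {t : ℝ} (ht : x < t) :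
    iteratedDeriv i w t = 0 :=
  iteratedDeriv_eq_zero_of_eqOn isOpen_Ioi (fun u hu => h.right u (Set.mem_Ioi.mp hu).le)
    (Or.inr rfl) (s := Set.Ioi x) ht

lemma iteratedDeriv_mid (h : IsCutoff Cd x Y w) {i : ℕ} (hi : i ≠ 0) {t : ℝ} (ht : 2 * Y < t)
    (ht' : t < x - Y) : iteratedDeriv i w t = 0 :=
  iteratedDeriv_eq_zero_of_eqOn isOpen_Ioo (fun u hu => h.mid u hu.1.le hu.2.le) (Or.inl hi)
    (s := Set.Ioo (2 * Y) (x - Y)) ⟨ht, ht'⟩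

/-- The Mellin transform of the `i`-th derivative of a cutoff. -/
noncomputable def mellinDeriv (w : ℝ → ℝ) (i : ℕ) (s : ℂ) : ℂ :=
  mellin (fun t => ((iteratedDeriv i w t : ℝ) : ℂ)) s

open Complex MeasureTheory

lemma continuousOn_cpow_mul (h : IsCutoff Cd x Y w) (i : ℕ) (s : ℂ) :
    ContinuousOn (fun t : ℝ => (t : ℂ) ^ (s - 1) * ((iteratedDeriv i w t : ℝ) : ℂ)) (Set.Ioi 0) := by
  refine ContinuousOn.mul (fun t ht => ?_)
    (continuous_ofReal.comp (h.continuous_iteratedDeriv i)).continuousOn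
  exact (continuousAt_ofReal_cpow_const _ _ (Or.inr (ne_of_gt ht))).continuousWithinAt

lemma mellinConvergent (h : IsCutoff Cd x Y w) (i : ℕ) (s : ℂ) :
    MellinConvergent (fun t => ((iteratedDeriv i w t : ℝ) : ℂ)) s := by
  have hY : 0 < Y := by linarith [h.one_le]
  have h1 : IntegrableOn (fun t : ℝ => (t : ℂ) ^ (s - 1) * ((iteratedDeriv i w t : ℝ) : ℂ))
      (Set.Icc (Y / 2) (x + 1)) :=
    ((h.continuousOn_cpow_mul i s).mono fun t ht => lt_of_lt_of_le (by positivity) ht.1).integrableOn_Icc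
  refine h1.of_forall_sdiff_eq_zero measurableSet_Ioi fun t ht => ?_
  rcases lt_or_ge t (Y / 2) with h2 | h2
  · simp [h.iteratedDeriv_left i ht.1 (by linarith)]
  · have : x < t := by
      by_contra hc
      exact ht.2 ⟨h2, by linarith⟩
    simp [h.iteratedDeriv_right i this]

lemma mellinDeriv_eq_intervalIntegral (h : IsCutoff Cd x Y w) (i : ℕ) (s : ℂ) :
    mellinDeriv w i s = ∫ t in (Y / 2)..(x + 1), (t : ℂ) ^ (s - 1) * ((iteratedDeriv i w t : ℝ) : ℂ) := by
  have hY : 0 < Y := by linarith [h.one_le]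
  rw [intervalIntegral.integral_of_le (by linarith [h.le]), mellinDeriv, mellin]
  refine (setIntegral_eq_of_subset_of_forall_sdiff_eq_zero measurableSet_Ioi
    (fun t ht => lt_trans (by positivity) ht.1) fun t ht => ?_)
  rcases le_or_gt t (Y / 2) with h2 | h2
  · simp [h.iteratedDeriv_left i ht.1 (by linarith)]
  · have : x < t := by
      by_contra hc
      exact ht.2 ⟨h2, by linarith⟩
    simp [h.iteratedDeriv_right i this]

lemma mul_mellinDeriv (h : IsCutoff Cd x Y w) (i : ℕ) (s : ℂ) :
    s * mellinDeriv w i s = -mellinDeriv w (i + 1) (s + 1) := by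
  have hY : 0 < Y := by linarith [h.one_le]
  have hx := h.le
  rw [h.mellinDeriv_eq_intervalIntegral, h.mellinDeriv_eq_intervalIntegral]
  rcases eq_or_ne s 0 with rfl | hs
  · have := intervalIntegral.integral_eq_sub_of_hasDerivAt (a := Y / 2) (b := x + 1)
      (fun t _ => (h.hasDerivAt_iteratedDeriv i t).ofReal_comp)
      ((continuous_ofReal.comp (h.continuous_iteratedDeriv (i + 1))).intervalIntegrable _ _)
    simp [this, h.iteratedDeriv_left i (by positivity : 0 < Y / 2) (by linarith),
      h.iteratedDeriv_right i (by linarith : x < x + 1)]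
  have hsub : ∀ t ∈ Set.uIcc (Y / 2) (x + 1), 0 < t := fun t ht => by
    rw [Set.uIcc_of_le (by linarith)] at ht; exact lt_of_lt_of_le (by positivity) ht.1
  have := intervalIntegral.integral_deriv_mul_eq_sub (a := Y / 2) (b := x + 1)
    (u := fun t : ℝ => (t : ℂ) ^ s) (u' := fun t : ℝ => s * (t : ℂ) ^ (s - 1))
    (v := fun t => ((iteratedDeriv i w t : ℝ) : ℂ)) (v' := fun t => ((iteratedDeriv (i + 1) w t : ℝ) : ℂ))
    (fun t ht => by
      exact hasDerivAt_ofReal_cpow_const (hsub t ht).ne' hs)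
    (fun t _ => (h.hasDerivAt_iteratedDeriv i t).ofReal_comp) (by
      refine ContinuousOn.intervalIntegrable fun t ht => ?_
      exact (continuousAt_const.mul (continuousAt_ofReal_cpow_const _ _
        (Or.inr (hsub t ht).ne'))).continuousWithinAt)
    ((continuous_ofReal.comp (h.continuous_iteratedDeriv (i + 1))).intervalIntegrable _ _)
  rw [h.iteratedDeriv_left i (by positivity : 0 < Y / 2) (by linarith),
      h.iteratedDeriv_right i (by linarith : x < x + 1), intervalIntegral.integral_add] at this
  · rw [← intervalIntegral.integral_const_mul]
    simp only [ofReal_zero, mul_zero, sub_zero] at this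
    rw [add_sub_cancel_right, ← eq_neg_iff_add_eq_zero.mpr this]
    refine intervalIntegral.integral_congr fun t _ => ?_
    ring
  · refine ContinuousOn.intervalIntegrable fun t ht => ?_
    exact ((continuousAt_const.mul (continuousAt_ofReal_cpow_const _ _
        (Or.inr (hsub t ht).ne'))).mul (continuous_ofReal.comp
        (h.continuous_iteratedDeriv i)).continuousAt).continuousWithinAt
  · refine ContinuousOn.intervalIntegrable fun t ht => ?_
    exact ((continuousAt_ofReal_cpow_const _ _
        (Or.inr (hsub t ht).ne')).mul (continuous_ofReal.comp
        (h.continuous_iteratedDeriv (i + 1))).continuousAt).continuousWithinAt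

lemma norm_mellinDeriv_mul_prod (h : IsCutoff Cd x Y w) (j : ℕ) (s : ℂ) :
    ‖mellinDeriv w 0 s‖ * ∏ i ∈ Finset.range j, ‖s + i‖ = ‖mellinDeriv w j (s + j)‖ := by
  induction j with
  | zero => simp
  | succ j ih =>
    rw [Finset.prod_range_succ, ← mul_assoc, ih, mul_comm, ← norm_mul, h.mul_mellinDeriv, norm_neg]
    congr 2; push_cast; ring

/-- Rapid decay of the Mellin transform of a cutoff in vertical strips. -/
lemma exists_norm_mellinDeriv_le (h : IsCutoff Cd x Y w) (a b : ℝ) (j : ℕ) :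
    ∃ M : ℝ, 0 ≤ M ∧ ∀ s : ℂ, a ≤ s.re → s.re ≤ b →
      ‖mellinDeriv w 0 s‖ * (1 + |s.im|) ^ j ≤ M := by
  obtain ⟨M0, hM0⟩ := exists_norm_mellin_le_of_strip (a := a) (b := b)
    (h.mellinConvergent 0 a) (h.mellinConvergent 0 b)
  obtain ⟨M1, hM1⟩ := exists_norm_mellin_le_of_strip (a := a + j) (b := b + j)
    (h.mellinConvergent j _) (h.mellinConvergent j _)
  refine ⟨2 ^ j * (|M0| + |M1|), by positivity, fun s hs hs' => ?_⟩
  have h0 : ‖mellinDeriv w 0 s‖ ≤ |M0| := (hM0 s hs hs').trans (le_abs_self _)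
  have h1 : ‖mellinDeriv w 0 s‖ * |s.im| ^ j ≤ |M1| := by
    have h2 : ‖mellinDeriv w j (s + j)‖ ≤ |M1| :=
      (hM1 (s + j) (by simpa using hs) (by simpa using hs')).trans (le_abs_self _)
    rw [← h.norm_mellinDeriv_mul_prod] at h2
    refine le_trans (mul_le_mul_of_nonneg_left ?_ (norm_nonneg _)) h2
    rw [← Finset.card_range j, ← Finset.prod_const, Finset.card_range]
    refine Finset.prod_le_prod (fun _ _ => abs_nonneg _) fun i _ => ?_
    simpa using abs_im_le_norm (s + i)
  have h2 : (1 + |s.im|) ^ j ≤ 2 ^ j * (1 + |s.im| ^ j) := by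
    rcases le_total |s.im| 1 with h3 | h3
    · calc (1 + |s.im|) ^ j ≤ 2 ^ j := by gcongr; linarith
        _ ≤ _ := le_mul_of_one_le_right (by positivity) (by
          have := pow_nonneg (abs_nonneg s.im) j; linarith)
    · calc (1 + |s.im|) ^ j ≤ (2 * |s.im|) ^ j := by gcongr; linarith
        _ = 2 ^ j * |s.im| ^ j := mul_pow _ _ _
        _ ≤ _ := by gcongr; linarith
  calc _ ≤ ‖mellinDeriv w 0 s‖ * (2 ^ j * (1 + |s.im| ^ j)) := by gcongr
    _ = 2 ^ j * (‖mellinDeriv w 0 s‖ + ‖mellinDeriv w 0 s‖ * |s.im| ^ j) := by ring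
    _ ≤ _ := by gcongr

lemma differentiable_mellinDeriv (h : IsCutoff Cd x Y w) (i : ℕ) :
    Differentiable ℂ (mellinDeriv w i) := by
  intro s
  have hY : 0 < Y := by linarith [h.one_le]
  refine mellin_differentiableAt_of_isBigO_rpow (a := s.re + 1) (b := s.re - 1) ?_ ?_ (by linarith) ?_
    (by linarith)
  · exact ((continuous_ofReal.comp (h.continuous_iteratedDeriv i)).continuousOn).locallyIntegrableOn
      measurableSet_Ioi
  · refine (Filter.EventuallyEq.trans_isBigO ?_ (Asymptotics.isBigO_zero _ _))
    filter_upwards [Filter.eventually_gt_atTop x] with t ht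
    simp [h.iteratedDeriv_right i ht]
  · refine (Filter.EventuallyEq.trans_isBigO ?_ (Asymptotics.isBigO_zero _ _))
    filter_upwards [Ioo_mem_nhdsGT hY] with t ht
    simp [h.iteratedDeriv_left i ht.1 ht.2]

lemma norm_mellinDeriv_le (h : IsCutoff Cd x Y w) {j : ℕ} (hj : j ≠ 0) (s : ℂ) :
    ‖mellinDeriv w j (s + j)‖ ≤ 2 * Cd j * x ^ (max s.re 0) * (x / Y) ^ (j - 1) := by
  have hY : 0 < Y := by linarith [h.one_le]
  have hx : 0 < x := hY.trans_le h.le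
  have hC := h.const_nonneg j
  set S : Set ℝ := Set.Icc Y (2 * Y) ∪ Set.Icc (x - Y) x with hS
  set T : Set ℝ := S ∩ Set.Icc Y x with hT
  set B : ℝ := x ^ (max s.re 0) * x ^ (j - 1) * (Cd j / Y ^ j) with hB
  have hTm : MeasurableSet T := (measurableSet_Icc.union measurableSet_Icc).inter measurableSet_Icc
  have hTfin : volume T ≤ ENNReal.ofReal (2 * Y) := by
    refine (measure_mono Set.inter_subset_left).trans ((measure_union_le _ _).trans ?_)
    rw [Real.volume_Icc, Real.volume_Icc, ← ENNReal.ofReal_add (by linarith) (by linarith)]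
    apply ENNReal.ofReal_le_ofReal; linarith
  have h1 : mellinDeriv w j (s + j) =
      ∫ t in T, (t : ℂ) ^ (s + j - 1) * ((iteratedDeriv j w t : ℝ) : ℂ) := by
    refine setIntegral_eq_of_subset_of_ae_sdiff_eq_zero measurableSet_Ioi.nullMeasurableSet
      (fun t ht => hY.trans_le ht.2.1) ?_
    have hne : ∀ u : ℝ, ∀ᵐ t : ℝ, t ≠ u := fun u => by
      simp [ae_iff]
    filter_upwards [hne Y, hne (2 * Y), hne (x - Y), hne x] with t h1 h2 h3 h4 ht
    have : iteratedDeriv j w t = 0 := by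
      by_contra hc
      have a1 : Y ≤ t := by
        by_contra h5; exact hc (h.iteratedDeriv_left j ht.1 (not_le.mp h5))
      have a2 : t ≤ x := by
        by_contra h5; exact hc (h.iteratedDeriv_right j (not_le.mp h5))
      refine ht.2 ⟨?_, a1, a2⟩
      by_contra h5
      simp only [hS, Set.mem_union, Set.mem_Icc, not_or, not_and, not_le] at h5
      have a3 := h5.1 a1
      refine hc (h.iteratedDeriv_mid hj a3 ?_)
      by_contra h6
      have := h5.2 (not_lt.mp h6)
      linarith
    simp [this]
  have h2 : ∀ t ∈ T, ‖(t : ℂ) ^ (s + j - 1) * ((iteratedDeriv j w t : ℝ) : ℂ)‖ ≤ B := by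
    intro t ht
    have ht1 : 1 ≤ t := h.one_le.trans ht.2.1
    have ht0 : 0 < t := by linarith
    have htx : t ≤ x := ht.2.2
    rw [norm_mul, norm_cpow_eq_rpow_re_of_pos ht0, norm_real, Real.norm_eq_abs]
    have e1 : (s + j - 1).re = s.re + ((j - 1 : ℕ) : ℝ) := by
      rw [Nat.cast_sub (by omega)]; simp; ring
    rw [e1, Real.rpow_add ht0, Real.rpow_natCast]
    refine mul_le_mul ?_ (h.bound j t ht0.le) (abs_nonneg _) (by positivity)
    refine mul_le_mul ?_ (by gcongr) (by positivity) (by positivity)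
    exact (Real.rpow_le_rpow_of_exponent_le ht1 (le_max_left _ 0)).trans
      (Real.rpow_le_rpow ht0.le htx (le_max_right _ _))
  have h3 : volume T < ⊤ := hTfin.trans_lt ENNReal.ofReal_lt_top
  have h4 := norm_setIntegral_le_of_norm_le_const (C := B) h3 h2
  rw [h1]
  refine h4.trans ?_
  have h5 : volume.real T ≤ 2 * Y := by
    rw [Measure.real]
    exact ENNReal.toReal_le_of_le_ofReal (by linarith) hTfin
  calc B * volume.real T ≤ B * (2 * Y) := by
        refine mul_le_mul_of_nonneg_left h5 ?_; positivity
    _ = _ := by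
      obtain ⟨k, rfl⟩ := Nat.exists_eq_succ_of_ne_zero hj
      rw [hB, Nat.succ_sub_one, Nat.succ_eq_add_one, div_pow, pow_succ Y k]
      field_simp

/-- Quantitative decay of the Mellin transform of a cutoff. -/
lemma norm_mellinDeriv_zero_le (h : IsCutoff Cd x Y w) {σ : ℝ} (hσ : -(1 / 2) ≤ σ) (hσ0 : σ ≠ 0)
    (hσ1 : σ ≤ 1) (τ : ℝ) :
    ‖mellinDeriv w 0 (σ + τ * I)‖ ≤ (256 * (Cd 1 + Cd 4) / |σ|) * x ^ (max σ 0) *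
      (1 + |τ|)⁻¹ * min 1 ((x / Y / (1 + |τ|)) ^ 3) := by
  have hY : 0 < Y := by linarith [h.one_le]
  have hx : 0 < x := hY.trans_le h.le
  have hC1 := h.const_nonneg 1
  have hC4 := h.const_nonneg 4
  have hσp : 0 < |σ| := abs_pos.mpr hσ0
  set u := 1 + |τ| with hu
  have hu1 : 0 < u := by positivity
  have hτ := abs_nonneg τ
  have hlow : ∀ r : ℝ, (|r| + |τ|) / 2 ≤ ‖(r + τ * I : ℂ)‖ := by
    intro r
    have a := abs_re_le_norm (r + τ * I : ℂ)
    have b := abs_im_le_norm (r + τ * I : ℂ)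
    simp at a b; linarith
  have hσ1' : |σ| ≤ 1 := abs_le.mpr ⟨by linarith, hσ1⟩
  have hs : |σ| / 2 * u ≤ ‖(σ + τ * I : ℂ)‖ := by
    refine le_trans ?_ (hlow σ); rw [hu]; nlinarith
  have hs' : ∀ i : ℕ, i ≠ 0 → u / 4 ≤ ‖(σ + τ * I + i : ℂ)‖ := by
    intro i hi
    have := hlow (σ + i)
    have hi1 : (1 : ℝ) ≤ i := by exact_mod_cast Nat.one_le_iff_ne_zero.mpr hi
    rw [abs_of_nonneg (by linarith)] at this
    have e : ((σ + i : ℝ) + τ * I : ℂ) = σ + τ * I + i := by push_cast; ring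
    rw [e] at this
    linarith
  have h1 := h.norm_mellinDeriv_le one_ne_zero (σ + τ * I)
  have h4 := h.norm_mellinDeriv_le four_ne_zero (σ + τ * I)
  rw [← h.norm_mellinDeriv_mul_prod] at h1 h4
  set W := ‖mellinDeriv w 0 (σ + τ * I)‖ with hW
  have hW0 : 0 ≤ W := norm_nonneg _
  simp only [Finset.prod_range_succ, Finset.prod_range_zero, one_mul, Nat.cast_zero, add_zero,
    add_re, ofReal_re, mul_re, I_re, mul_zero, ofReal_im, I_im, mul_one, sub_self,
    Nat.add_one_sub_one] at h1 h4
  set P := x ^ (max σ 0) with hP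
  have hP0 : 0 ≤ P := by positivity
  set X := x / Y with hX
  have hX0 : 0 < X := by positivity
  have b1 : W * (|σ| / 2 * u) ≤ 2 * Cd 1 * P :=
    (mul_le_mul_of_nonneg_left hs hW0).trans (by simpa using h1)
  have b4 : W * ((|σ| / 2 * u) * (u / 4) * (u / 4) * (u / 4)) ≤ 2 * Cd 4 * P * X ^ 3 := by
    refine le_trans (mul_le_mul_of_nonneg_left ?_ hW0) h4
    have e1 := hs' 1 (by norm_num)
    have e2 := hs' 2 (by norm_num)
    have e3 := hs' 3 (by norm_num)
    gcongr
  have c1 : W ≤ 256 * (Cd 1 + Cd 4) / |σ| * P * u⁻¹ := by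
    rw [show 256 * (Cd 1 + Cd 4) / |σ| * P * u⁻¹ = (128 * (Cd 1 + Cd 4) * P) / (|σ| / 2 * u) by
      field_simp; ring, le_div_iff₀ (by positivity)]
    have := mul_nonneg hC4 hP0
    have := mul_nonneg hC1 hP0
    nlinarith
  have c4 : W ≤ 256 * (Cd 1 + Cd 4) / |σ| * P * u⁻¹ * (X / u) ^ 3 := by
    rw [show 256 * (Cd 1 + Cd 4) / |σ| * P * u⁻¹ * (X / u) ^ 3 =
      (2 * (Cd 1 + Cd 4) * P * X ^ 3) / ((|σ| / 2 * u) * (u / 4) * (u / 4) * (u / 4)) by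
      field_simp; ring, le_div_iff₀ (by positivity)]
    refine b4.trans ?_
    gcongr; linarith
  rcases min_choice (1 : ℝ) ((X / u) ^ 3) with hm | hm <;> rw [hm]
  · simpa using c1
  · exact c4

end IsCutoff

open MeasureTheory in
lemma integrable_comp_abs_of_integrableOn {f : ℝ → ℝ} (hf : IntegrableOn f (Set.Ioi 0)) :
    Integrable (fun t => f |t|) := by
  have h1 : IntegrableOn (fun t => f |t|) (Set.Ioi 0) := by
    refine hf.congr_fun (fun t ht => ?_) measurableSet_Ioi
    rw [abs_of_pos ht]
  have h2 : IntegrableOn (fun t => f |t|) (Set.Iic 0) := by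
    have m : MeasurableEmbedding (Neg.neg : ℝ → ℝ) := (Homeomorph.neg ℝ).measurableEmbedding
    rw [← Measure.map_neg_eq_self (volume : Measure ℝ), m.integrableOn_map_iff]
    simpa [Function.comp_def, integrableOn_Ici_iff_integrableOn_Ioi] using h1
  rw [← integrableOn_univ, ← Set.Iic_union_Ioi (a := (0 : ℝ))]
  exact h2.union h1

open MeasureTheory in
lemma exists_integral_rpow_mul_min_le {p : ℝ} (hp : -1 < p) (hp' : p < 5) :
    ∃ K : ℝ, 0 < K ∧ ∀ X : ℝ, 1 ≤ X →
      Integrable (fun τ : ℝ => (1 + |τ|) ^ p * min 1 ((X / (1 + |τ|)) ^ 3) ^ 2) ∧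
      ∫ τ : ℝ, (1 + |τ|) ^ p * min 1 ((X / (1 + |τ|)) ^ 3) ^ 2 ≤ K * X ^ (p + 1) := by
  have hK1 : 0 < 1 / (p + 1) := one_div_pos.mpr (by linarith)
  have hK2 : 0 < 1 / (5 - p) := one_div_pos.mpr (by linarith)
  refine ⟨2 * (1 / (p + 1) + 1 / (5 - p)), by positivity, fun X hX => ?_⟩
  have hX0 : 0 < X := by linarith
  set f : ℝ → ℝ := fun v => v ^ p * min 1 ((X / v) ^ 3) ^ 2 with hf
  have hfnn : ∀ v, 0 < v → 0 ≤ f v := fun v hv => by positivity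
  have hfc : ContinuousOn f (Set.Ioi 0) := by
    intro v hv
    have hv' : v ≠ 0 := ne_of_gt hv
    have : ContinuousAt f v := by
      refine (Real.continuousAt_rpow_const v p (Or.inl hv')).mul ?_
      refine ContinuousAt.pow (ContinuousAt.inf continuousAt_const ?_) 2
      exact (continuousAt_const.div continuousAt_id hv').pow 3
    exact this.continuousWithinAt
  have h1le : ∀ v, 0 < v → f v ≤ v ^ p := fun v hv => by
    have : min 1 ((X / v) ^ 3) ^ 2 ≤ 1 := pow_le_one₀ (by positivity) (min_le_left _ _)
    exact mul_le_of_le_one_right (by positivity) this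
  have h2le : ∀ v, 0 < v → f v ≤ X ^ 6 * v ^ (p - 6) := fun v hv => by
    have : min 1 ((X / v) ^ 3) ^ 2 ≤ ((X / v) ^ 3) ^ 2 := by
      gcongr; exact min_le_right _ _
    calc f v ≤ v ^ p * ((X / v) ^ 3) ^ 2 := by simp only [hf]; gcongr
      _ = _ := by
        rw [show p - 6 = p - (6 : ℕ) by norm_num, Real.rpow_sub_natCast hv.ne']; field_simp
  have hi1 : IntegrableOn (fun v : ℝ => v ^ p) (Set.Ioc 0 X) := by
    have := intervalIntegral.intervalIntegrable_rpow' (a := 0) (b := X) hp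
    rwa [intervalIntegrable_iff_integrableOn_Ioc_of_le hX0.le] at this
  have hi2 : IntegrableOn (fun v : ℝ => X ^ 6 * v ^ (p - 6)) (Set.Ioi X) :=
    (integrableOn_Ioi_rpow_of_lt (by linarith) hX0).const_mul _
  have hf1 : IntegrableOn f (Set.Ioc 0 X) := by
    refine Integrable.mono' hi1 ((hfc.mono fun v hv => hv.1).aestronglyMeasurable
      measurableSet_Ioc) ?_
    filter_upwards [ae_restrict_mem measurableSet_Ioc] with v hv
    rw [Real.norm_eq_abs, abs_of_nonneg (hfnn v hv.1)]; exact h1le v hv.1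
  have hf2 : IntegrableOn f (Set.Ioi X) := by
    refine Integrable.mono' hi2 ((hfc.mono fun v hv => hX0.trans hv).aestronglyMeasurable
      measurableSet_Ioi) ?_
    filter_upwards [ae_restrict_mem measurableSet_Ioi] with v hv
    have hv0 : 0 < v := hX0.trans hv
    rw [Real.norm_eq_abs, abs_of_nonneg (hfnn v hv0)]; exact h2le v hv0
  have hf0 : IntegrableOn f (Set.Ioi 0) := by
    rw [← Set.Ioc_union_Ioi_eq_Ioi hX0.le]; exact hf1.union hf2
  have hb : ∫ v in Set.Ioi 0, f v ≤ (1 / (p + 1) + 1 / (5 - p)) * X ^ (p + 1) := by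
    rw [← Set.Ioc_union_Ioi_eq_Ioi hX0.le, setIntegral_union (Set.Ioc_disjoint_Ioi le_rfl)
      measurableSet_Ioi hf1 hf2, add_mul]
    refine add_le_add ?_ ?_
    · refine (setIntegral_mono_on hf1 hi1 measurableSet_Ioc fun v hv => h1le v hv.1).trans ?_
      rw [← intervalIntegral.integral_of_le hX0.le, integral_rpow (Or.inl hp),
        Real.zero_rpow (by linarith)]
      apply le_of_eq; ring
    · refine (setIntegral_mono_on hf2 hi2 measurableSet_Ioi fun v hv => h2le v (hX0.trans hv)).trans ?_
      rw [integral_const_mul, integral_Ioi_rpow_of_lt (by linarith) hX0]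
      have e : X ^ 6 * X ^ (p - 6 + 1) = X ^ (p + 1) := by
        rw [← Real.rpow_natCast, ← Real.rpow_add hX0]; congr 1; push_cast; ring
      apply le_of_eq
      rw [← e]
      have h5 : p - 6 + 1 ≠ 0 := by linarith
      have h6 : 5 - p ≠ 0 := by linarith
      field_simp
      ring
  have hshift : IntegrableOn (fun t => f (1 + t)) (Set.Ioi 0) := by
    have : IntegrableOn f (Set.Ioi 1) := hf0.mono_set (Set.Ioi_subset_Ioi zero_le_one)
    have h2 := (measurePreserving_add_left volume (1 : ℝ)).integrableOn_comp_preimage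
      (measurableEmbedding_addLeft (1 : ℝ)) (f := f) (s := Set.Ioi 1)
    have h3 := h2.mpr this
    simpa [Function.comp_def] using h3
  have hsi : ∫ t in Set.Ioi 0, f (1 + t) = ∫ t in Set.Ioi 1, f t := by
    have h2 := (measurePreserving_add_left volume (1 : ℝ)).setIntegral_preimage_emb
      (measurableEmbedding_addLeft (1 : ℝ)) f (Set.Ioi 1)
    simpa using h2
  refine ⟨?_, ?_⟩
  · exact integrable_comp_abs_of_integrableOn hshift
  · change ∫ τ : ℝ, (fun t => f (1 + t)) |τ| ≤ _
    rw [integral_comp_abs (f := fun t => f (1 + t)), hsi, mul_assoc]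
    refine mul_le_mul_of_nonneg_left (le_trans ?_ hb) (by norm_num)
    refine setIntegral_mono_set hf0 ?_ (Set.Ioi_subset_Ioi zero_le_one).eventuallyLE
    filter_upwards [ae_restrict_mem measurableSet_Ioi] with v hv using hfnn v hv

end

section

open Complex Filter Topology MeasureTheory

lemma tendsto_verticalIntegral_sub_zero {q : ℂ → ℂ} {a b K : ℝ} (hab : a ≤ b)
    (hq : ∀ z : ℂ, a ≤ z.re → z.re ≤ b → DifferentiableAt ℂ q z)
    (hK : ∀ z : ℂ, a ≤ z.re → z.re ≤ b → 1 ≤ |z.im| → ‖q z‖ ≤ K / |z.im|) :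
    Tendsto (fun T : ℝ => (∫ t in (-T)..T, q (b + t * I)) - ∫ t in (-T)..T, q (a + t * I))
      atTop (𝓝 0) := by
  have hlim : Tendsto (fun T : ℝ => 2 * (K * (b - a)) * T⁻¹) atTop (𝓝 0) := by
    simpa using tendsto_inv_atTop_zero.const_mul (2 * (K * (b - a)))
  refine squeeze_zero_norm' ?_ hlim
  filter_upwards [eventually_ge_atTop 1] with T hT
  have hrect := integral_boundary_rect_eq_zero_of_differentiableOn q (a + (-T : ℝ) * I)
    (b + T * I) (by
      intro z hz
      rw [Complex.mem_reProdIm] at hz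
      simp only [add_re, ofReal_re, mul_re, I_re, mul_zero, ofReal_im, I_im, mul_one, sub_self,
        add_zero, Set.uIcc_of_le hab, Set.mem_Icc] at hz
      exact (hq z hz.1.1 hz.1.2).differentiableWithinAt)
  simp only [add_re, ofReal_re, mul_re, I_re, mul_zero, ofReal_im, I_im, mul_one, sub_self,
    add_zero, add_im, mul_im, zero_add, smul_eq_mul] at hrect
  have hH : ∀ u : ℝ, |u| = T → ‖∫ x : ℝ in a..b, q (x + u * I)‖ ≤ K / T * |b - a| := by
    intro u hu
    refine intervalIntegral.norm_integral_le_of_norm_le_const fun x hx => ?_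
    rw [Set.uIoc_of_le hab] at hx
    have := hK (x + u * I) (by simpa using hx.1.le) (by simpa using hx.2) (by simpa [hu] using hT)
    simpa [hu] using this
  have h1 := hH (-T) (by rw [abs_neg, abs_of_pos (by linarith)])
  have h2 := hH T (abs_of_pos (by linarith))
  set V := (∫ t in (-T)..T, q (b + t * I)) - ∫ t in (-T)..T, q (a + t * I) with hV
  have hVI : I * V = (∫ x : ℝ in a..b, q (x + T * I)) - ∫ x : ℝ in a..b, q (x + (-T : ℝ) * I) := by
    rw [hV, mul_sub]; linear_combination hrect
  have : ‖V‖ = ‖I * V‖ := by simp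
  rw [this, hVI]
  refine (norm_sub_le _ _).trans ((add_le_add h2 h1).trans (le_of_eq ?_))
  rw [abs_of_nonneg (by linarith)]
  field_simp; ring

lemma tendsto_integral_inv_vertical_pow {r : ℝ} (hr : r ≠ 0) (k : ℕ) :
    Tendsto (fun T : ℝ => ∫ t in (-T)..T, ((r + t * I : ℂ) ^ (k + 2))⁻¹) atTop (𝓝 0) := by
  have hne : ∀ t : ℝ, (r + t * I : ℂ) ≠ 0 := fun t h => hr (by simpa using congrArg re h)
  have hder : ∀ t : ℝ, HasDerivAt (fun t : ℝ => (I / (k + 1)) * ((r + t * I : ℂ) ^ (k + 1))⁻¹)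
      (((r + t * I : ℂ) ^ (k + 2))⁻¹) t := by
    intro t
    have h1 : HasDerivAt (fun t : ℝ => (r + t * I : ℂ)) I t := by
      simpa using ((ofRealCLM.hasDerivAt (x := t)).mul_const I).const_add (r : ℂ)
    have h2 := ((h1.pow (k + 1)).inv (pow_ne_zero _ (hne t))).const_mul (I / (k + 1 : ℂ))
    refine h2.congr_deriv ?_
    have hk : (k + 1 : ℂ) ≠ 0 := by exact_mod_cast Nat.succ_ne_zero k
    have := hne t
    push_cast
    simp only [Pi.pow_apply]
    generalize (r + t * I : ℂ) = u at this
    rw [show I / (k + 1 : ℂ) * (-((k + 1) * u ^ k * I) / (u ^ (k + 1)) ^ 2) =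
      (-(I * I)) * (u ^ k / (u ^ (k + 1)) ^ 2) by field_simp, I_mul_I, neg_neg, one_mul]
    field_simp
    ring
  have hT : ∀ T : ℝ, ∫ t in (-T)..T, ((r + t * I : ℂ) ^ (k + 2))⁻¹ =
      (I / (k + 1)) * ((r + T * I : ℂ) ^ (k + 1))⁻¹ -
      (I / (k + 1)) * ((r + (-T : ℝ) * I : ℂ) ^ (k + 1))⁻¹ := by
    intro T
    refine intervalIntegral.integral_eq_sub_of_hasDerivAt (fun t _ => hder t) ?_
    refine Continuous.intervalIntegrable ?_ _ _
    exact Continuous.inv₀ (by fun_prop) (fun t => pow_ne_zero _ (hne t))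
  simp_rw [hT]
  have hz : ∀ s : ℝ, |s| = 1 → Tendsto (fun T : ℝ => ((r + (s * T : ℝ) * I : ℂ) ^ (k + 1))⁻¹)
      atTop (𝓝 0) := by
    intro s hs
    refine squeeze_zero_norm' (a := fun T : ℝ => T⁻¹) ?_ tendsto_inv_atTop_zero
    filter_upwards [eventually_ge_atTop 1] with T hT1
    rw [norm_inv, norm_pow]
    have h1 : T ≤ ‖(r + (s * T : ℝ) * I : ℂ)‖ := by
      refine le_trans ?_ (abs_im_le_norm _)
      simp [abs_mul, hs, le_abs_self]
    refine inv_anti₀ (by linarith) (h1.trans ?_)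
    exact le_self_pow₀ (hT1.trans h1) (by omega)
  have ha := (hz 1 (by simp)).const_mul (I / (k + 1))
  have hb := (hz (-1) (by simp)).const_mul (I / (k + 1))
  simpa using ha.sub hb

lemma tendsto_integral_inv_vertical_sub {a : ℝ} (ha : 0 < a) :
    Tendsto (fun T : ℝ => (∫ t in (-T)..T, (a + t * I : ℂ)⁻¹) -
      ∫ t in (-T)..T, ((-a : ℝ) + t * I : ℂ)⁻¹) atTop (𝓝 (2 * Real.pi)) := by
  have hne : ∀ r : ℝ, r ≠ 0 → ∀ t : ℝ, (r + t * I : ℂ) ≠ 0 :=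
    fun r hr t h => hr (by simpa using congrArg re h)
  have hT : ∀ T : ℝ, (∫ t in (-T)..T, (a + t * I : ℂ)⁻¹) -
      ∫ t in (-T)..T, ((-a : ℝ) + t * I : ℂ)⁻¹ =
      ((2 * (Real.arctan (a⁻¹ * T) - Real.arctan (a⁻¹ * (-T))) : ℝ) : ℂ) := by
    intro T
    rw [← intervalIntegral.integral_sub]
    rotate_left
    · exact Continuous.intervalIntegrable (Continuous.inv₀ (by fun_prop) (hne a ha.ne')) _ _
    · exact Continuous.intervalIntegrable (Continuous.inv₀ (by fun_prop)
        (hne (-a) (by linarith))) _ _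
    have h : ∀ t : ℝ, (a + t * I : ℂ)⁻¹ - ((-a : ℝ) + t * I : ℂ)⁻¹ =
        ((2 * (a⁻¹ * (1 + (a⁻¹ * t) ^ 2)⁻¹) : ℝ) : ℂ) := by
      intro t
      have h1 := hne a ha.ne' t
      have h2 := hne (-a) (by linarith) t
      have h3 : (a ^ 2 + t ^ 2 : ℂ) ≠ 0 := by
        have : a ^ 2 + t ^ 2 ≠ 0 := by positivity
        exact_mod_cast this
      have ha' : (a : ℂ) ≠ 0 := by exact_mod_cast ha.ne'
      have h4 : (1 + (a : ℂ)⁻¹ ^ 2 * t ^ 2) ≠ 0 := by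
        have : 1 + a⁻¹ ^ 2 * t ^ 2 ≠ 0 := by positivity
        exact_mod_cast this
      push_cast at h2 ⊢
      rw [inv_sub_inv h1 h2, mul_pow]
      have h5 : ((a:ℂ) + t * I) * (-a + t * I) = -(a ^ 2 + t ^ 2) := by
        linear_combination (t:ℂ) ^ 2 * I_sq
      rw [h5]
      have h6 : (1 + (a : ℂ)⁻¹ ^ 2 * t ^ 2) = (a ^ 2 + t ^ 2) / a ^ 2 := by field_simp
      rw [h6]
      field_simp; ring
    simp_rw [h]
    rw [intervalIntegral.integral_ofReal]
    congr 1
    rw [intervalIntegral.integral_const_mul, intervalIntegral.integral_const_mul,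
      intervalIntegral.mul_integral_comp_mul_left (f := fun x => (1 + x ^ 2)⁻¹),
      integral_inv_one_add_sq]
  simp_rw [hT]
  have hc : ((2 * (Real.pi / 2 - -(Real.pi / 2)) : ℝ) : ℂ) = 2 * Real.pi := by
    push_cast; ring
  rw [← hc]
  refine (continuous_ofReal.tendsto _).comp (Tendsto.const_mul 2 (Tendsto.sub ?_ ?_))
  · exact (Real.tendsto_arctan_atTop.mono_right nhdsWithin_le_nhds).comp
      (tendsto_id.const_mul_atTop (inv_pos.mpr ha))
  · exact (Real.tendsto_arctan_atBot.mono_right nhdsWithin_le_nhds).comp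
      (tendsto_neg_atTop_atBot.const_mul_atBot (inv_pos.mpr ha))

lemma analyticAt_dslope {g : ℂ → ℂ} {m z : ℂ} (hm : AnalyticAt ℂ g m)
    (hz : AnalyticAt ℂ g z) : AnalyticAt ℂ (dslope g m) z := by
  rcases eq_or_ne z m with rfl | hne
  · obtain ⟨p, hp⟩ := hm
    exact ⟨_, hp.has_fpower_series_dslope_fslope⟩
  · have h1 : AnalyticAt ℂ (fun w => (w - m)⁻¹ * (g w - g m)) z :=
      ((analyticAt_id.sub analyticAt_const).inv (sub_ne_zero.mpr hne)).mul
        (hz.sub analyticAt_const)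
    refine h1.congr ?_
    filter_upwards [dslope_eventuallyEq_slope_of_ne g hne] with w hw
    rw [hw, slope_def_field]; ring

lemma dslope_dslope_same {g : ℂ → ℂ} {m : ℂ} (hm : AnalyticAt ℂ g m) :
    dslope (dslope g m) m m = iteratedDeriv 2 g m / 2 := by
  set g1 := dslope g m with hg1
  set g2 := dslope g1 m with hg2
  have h1 : AnalyticAt ℂ g1 m := analyticAt_dslope hm hm
  have h2 : AnalyticAt ℂ g2 m := analyticAt_dslope h1 h1
  have e1 : g = fun z => g m + (z - m) * g1 z := by
    ext z; have := sub_smul_dslope g m z; rw [smul_eq_mul] at this; rw [hg1]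
    linear_combination -this
  have hd : deriv g =ᶠ[𝓝 m] fun z => g1 z + (z - m) * deriv g1 z := by
    filter_upwards [h1.eventually_analyticAt] with z hz
    have hz' := hz.differentiableAt.hasDerivAt
    have : HasDerivAt (fun z => g m + (z - m) * g1 z) (1 * g1 z + (z - m) * deriv g1 z) z :=
      (((hasDerivAt_id z).sub_const m).mul hz').const_add (g m)
    rw [e1, this.deriv, one_mul]
  rw [iteratedDeriv_succ, iteratedDeriv_one, hd.deriv_eq]
  have h3 : HasDerivAt (fun z => g1 z + (z - m) * deriv g1 z)
      (deriv g1 m + (1 * deriv g1 m + (m - m) * deriv (deriv g1) m)) m :=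
    h1.differentiableAt.hasDerivAt.add
      (((hasDerivAt_id m).sub_const m).mul h1.deriv.differentiableAt.hasDerivAt)
  rw [h3.deriv, hg2, dslope_same]; ring

lemma integrable_div_vertical_pow_three {g : ℂ → ℂ} {m r M : ℝ} (hr : r ≠ 0)
    (hd : ∀ t : ℝ, ContinuousAt g ((m + r : ℝ) + t * I))
    (hb : ∀ t : ℝ, ‖g ((m + r : ℝ) + t * I)‖ ≤ M) :
    Integrable (fun t : ℝ => g ((m + r : ℝ) + t * I) / (r + t * I : ℂ) ^ 3) := by
  have hne : ∀ t : ℝ, (r + t * I : ℂ) ≠ 0 := fun t h => hr (by simpa using congrArg re h)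
  have h0 : Integrable (fun t : ℝ => (r ^ 2)⁻¹ * (1 + (t / r) ^ 2)⁻¹ * (|r|⁻¹ * M)) :=
    ((integrable_inv_one_add_sq.comp_div hr).const_mul _).mul_const _
  have hcont : Continuous (fun t : ℝ => g ((m + r : ℝ) + t * I)) := by
    rw [continuous_iff_continuousAt]; intro t
    exact ContinuousAt.comp (f := fun t : ℝ => ((m + r : ℝ) + t * I : ℂ)) (hd t) (by fun_prop)
  refine h0.mono' (Continuous.aestronglyMeasurable
    (hcont.div (by fun_prop) fun t => pow_ne_zero _ (hne t))) (Eventually.of_forall fun t => ?_)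
  have hM : 0 ≤ M := (norm_nonneg _).trans (hb t)
  have hsq : ‖(r + t * I : ℂ)‖ ^ 2 = r ^ 2 + t ^ 2 := by
    rw [← normSq_eq_norm_sq, normSq_add_mul_I]
  have hge : |r| ≤ ‖(r + t * I : ℂ)‖ := by
    simpa using abs_re_le_norm (r + t * I : ℂ)
  have hr' : 0 < |r| := abs_pos.mpr hr
  rw [norm_div, norm_pow, show ‖(r + t * I : ℂ)‖ ^ 3 = ‖(r + t * I : ℂ)‖ ^ 2 * ‖(r + t * I : ℂ)‖ by
    ring, hsq, show (r ^ 2)⁻¹ * (1 + (t / r) ^ 2)⁻¹ * (|r|⁻¹ * M) = M / ((r ^ 2 + t ^ 2) * |r|) by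
    rw [div_pow]; field_simp]
  gcongr
  exact hb t

/-- Residue theorem on a vertical strip for a triple pole. -/
lemma integral_vertical_sub_eq_of_bounded {g : ℂ → ℂ} {m a M : ℝ} (ha : 0 < a)
    (hd : ∀ z : ℂ, m - a ≤ z.re → z.re ≤ m + a → AnalyticAt ℂ g z)
    (hb : ∀ z : ℂ, m - a ≤ z.re → z.re ≤ m + a → ‖g z‖ ≤ M) :
    (∫ t : ℝ, g ((m + a : ℝ) + t * I) / (a + t * I : ℂ) ^ 3) -
      ∫ t : ℝ, g ((m + -a : ℝ) + t * I) / ((-a : ℝ) + t * I : ℂ) ^ 3 =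
    Real.pi * iteratedDeriv 2 g m := by
  have hM : 0 ≤ M := (norm_nonneg _).trans (hb m (by simp; linarith) (by simp; linarith))
  have hgm : AnalyticAt ℂ g m := hd m (by simp; linarith) (by simp; linarith)
  set g1 := dslope g m with hg1
  set g2 := dslope g1 m with hg2
  set q := dslope g2 m with hq
  have h1m := analyticAt_dslope hgm hgm
  have h2m := analyticAt_dslope h1m h1m
  have hqd : ∀ z : ℂ, m - a ≤ z.re → z.re ≤ m + a → AnalyticAt ℂ q z := fun z hz hz' =>
    analyticAt_dslope h2m (analyticAt_dslope h1m
      (analyticAt_dslope hgm (hd z hz hz')))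
  have e0 : ∀ z, g z = g m + (z - m) * g1 z := fun z => by
    have := sub_smul_dslope g (m:ℂ) z; rw [smul_eq_mul] at this; linear_combination -this
  have e1 : ∀ z, g1 z = g1 m + (z - m) * g2 z := fun z => by
    have := sub_smul_dslope g1 (m:ℂ) z; rw [smul_eq_mul] at this; linear_combination -this
  have e2 : ∀ z, g2 z = g2 m + (z - m) * q z := fun z => by
    have := sub_smul_dslope g2 (m:ℂ) z; rw [smul_eq_mul] at this; linear_combination -this
  have eg : ∀ z, g z = g m + (z - m) * g1 m + (z - m) ^ 2 * g2 m + (z - m) ^ 3 * q z := fun z => by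
    rw [e0 z, e1 z, e2 z]; ring
  have eq : ∀ z : ℂ, z - m ≠ 0 → g z / (z - m) ^ 3 =
      q z + g2 m * (z - m)⁻¹ + g1 m * ((z - m) ^ (0 + 2))⁻¹ + g m * ((z - m) ^ (1 + 2))⁻¹ := by
    intro z hz
    rw [eg z]; field_simp; ring
  have hqb : ∀ z : ℂ, m - a ≤ z.re → z.re ≤ m + a → 1 ≤ |z.im| →
      ‖q z‖ ≤ (M + ‖g2 m‖ + ‖g1 m‖ + ‖g m‖) / |z.im| := by
    intro z hz hz' him
    have hle : |z.im| ≤ ‖z - m‖ := by simpa using abs_im_le_norm (z - m)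
    have hz0 : z - m ≠ 0 := norm_pos_iff.mp (by linarith)
    have hq' : q z = g z / (z - m) ^ 3 - g2 m * (z - m)⁻¹ - g1 m * ((z - m) ^ (0 + 2))⁻¹
      - g m * ((z - m) ^ (1 + 2))⁻¹ := by rw [eq z hz0]; ring
    have hp : ∀ k : ℕ, |z.im| ≤ ‖z - m‖ ^ (k + 1) := fun k =>
      hle.trans (le_self_pow₀ (him.trans hle) (by omega))
    rw [hq']
    refine (norm_sub_le _ _).trans ((add_le_add_left ((norm_sub_le _ _).trans
      (add_le_add_left (norm_sub_le _ _) _)) _).trans ?_)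
    rw [norm_div, norm_mul, norm_mul, norm_mul, norm_inv, norm_inv, norm_inv, norm_pow, norm_pow,
      div_eq_mul_inv, div_eq_mul_inv, add_mul, add_mul, add_mul]
    gcongr
    · exact hb z hz hz'
    · exact hp 2
    · exact hp 1
    · exact hp 2
  have hT := tendsto_verticalIntegral_sub_zero (q := q) (a := m - a) (b := m + a) (by linarith)
    (fun z hz hz' => (hqd z hz hz').differentiableAt) hqb
  have hne : ∀ r : ℝ, r ≠ 0 → ∀ t : ℝ, (r + t * I : ℂ) ≠ 0 :=
    fun r hr t h => hr (by simpa using congrArg re h)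
  have hII : ∀ r : ℝ, r ≠ 0 → ∀ (k : ℕ) (T : ℝ), IntervalIntegrable
      (fun t : ℝ => ((r + t * I : ℂ) ^ k)⁻¹) volume (-T) T := fun r hr k T =>
    Continuous.intervalIntegrable
      (Continuous.inv₀ (by fun_prop) (fun t => pow_ne_zero _ (hne r hr t))) _ _
  have hqI : ∀ r : ℝ, m - a ≤ m + r → m + r ≤ m + a → ∀ T : ℝ, IntervalIntegrable
      (fun t : ℝ => q ((m + r : ℝ) + t * I)) volume (-T) T := by
    intro r h1 h2 T
    refine Continuous.intervalIntegrable (continuous_iff_continuousAt.mpr fun t => ?_) _ _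
    exact ContinuousAt.comp (f := fun t : ℝ => ((m + r : ℝ) + t * I : ℂ))
      (hqd _ (by simpa using h1) (by simpa using h2)).continuousAt (by fun_prop)
  have hint : ∀ r : ℝ, r ≠ 0 → m - a ≤ m + r → m + r ≤ m + a → ∀ T : ℝ,
      ∫ t in (-T)..T, g ((m + r : ℝ) + t * I) / (r + t * I : ℂ) ^ 3 =
      (∫ t in (-T)..T, q ((m + r : ℝ) + t * I)) + g2 m * (∫ t in (-T)..T, (r + t * I : ℂ)⁻¹)
      + g1 m * (∫ t in (-T)..T, ((r + t * I : ℂ) ^ (0 + 2))⁻¹)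
      + g m * (∫ t in (-T)..T, ((r + t * I : ℂ) ^ (1 + 2))⁻¹) := by
    intro r hr h1 h2 T
    rw [← intervalIntegral.integral_const_mul, ← intervalIntegral.integral_const_mul,
      ← intervalIntegral.integral_const_mul]
    have i1 : IntervalIntegrable (fun t : ℝ => g2 m * (r + t * I : ℂ)⁻¹) volume (-T) T := by
      simpa using (hII r hr 1 T).const_mul (g2 m)
    rw [← intervalIntegral.integral_add (hqI r h1 h2 T) i1,
      ← intervalIntegral.integral_add ((hqI r h1 h2 T).add i1) ((hII r hr _ T).const_mul _),
      ← intervalIntegral.integral_add (((hqI r h1 h2 T).add i1).add ((hII r hr _ T).const_mul _))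
        ((hII r hr _ T).const_mul _)]
    refine intervalIntegral.integral_congr fun t _ => ?_
    have h3 := eq ((m + r : ℝ) + t * I) (by
      have := hne r hr t
      convert this using 1; push_cast; ring)
    have h4 : ((m + r : ℝ) + t * I : ℂ) - m = r + t * I := by push_cast; ring
    rw [h4] at h3
    exact h3
  have hInt : ∀ r : ℝ, r ≠ 0 → m - a ≤ m + r → m + r ≤ m + a →
      Tendsto (fun T : ℝ => ∫ t in (-T)..T, g ((m + r : ℝ) + t * I) / (r + t * I : ℂ) ^ 3) atTop
        (𝓝 (∫ t : ℝ, g ((m + r : ℝ) + t * I) / (r + t * I : ℂ) ^ 3)) := by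
    intro r hr h1 h2
    refine intervalIntegral_tendsto_integral (integrable_div_vertical_pow_three (M := M) hr
      (fun t => (hd _ (by simpa using h1) (by simpa using h2)).continuousAt)
      (fun t => hb _ (by simpa using h1) (by simpa using h2))) tendsto_neg_atTop_atBot tendsto_id
  have hL := (hInt a ha.ne' (by linarith) le_rfl).sub
    (hInt (-a) (by linarith) (by linarith) (by linarith))
  have hR : Tendsto (fun T : ℝ => (∫ t in (-T)..T, g ((m + a : ℝ) + t * I) / (a + t * I : ℂ) ^ 3) -
      ∫ t in (-T)..T, g ((m + -a : ℝ) + t * I) / ((-a : ℝ) + t * I : ℂ) ^ 3) atTop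
      (𝓝 (0 + g2 m * (2 * Real.pi) + (g1 m * 0 - g1 m * 0) + (g m * 0 - g m * 0))) := by
    have p2 : ∀ k, ∀ r : ℝ, r ≠ 0 → Tendsto (fun T : ℝ => ∫ t in (-T)..T,
      ((r + t * I : ℂ) ^ (k + 2))⁻¹) atTop (𝓝 0) := fun k r hr =>
        tendsto_integral_inv_vertical_pow hr k
    have := ((hT.add ((tendsto_integral_inv_vertical_sub ha).const_mul (g2 m))).add
      (((p2 0 a ha.ne').const_mul (g1 m)).sub ((p2 0 (-a) (by linarith)).const_mul (g1 m)))).add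
      (((p2 1 a ha.ne').const_mul (g m)).sub ((p2 1 (-a) (by linarith)).const_mul (g m)))
    refine this.congr fun T => ?_
    rw [hint a ha.ne' (by linarith) le_rfl, hint (-a) (by linarith) (by linarith) (by linarith)]
    rw [← sub_eq_add_neg m a]
    ring
  rw [tendsto_nhds_unique hL hR, hg2, hg1, dslope_dslope_same hgm]
  ring

end

section

open Complex HurwitzZeta

lemma norm_sin_le_exp (z : ℂ) : ‖sin z‖ ≤ Real.exp |z.im| := by
  have h1 : ‖cexp (-z * I)‖ ≤ Real.exp |z.im| := by
    rw [norm_exp]; refine Real.exp_le_exp.2 ?_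
    simpa using le_abs_self z.im
  have h2 : ‖cexp (z * I)‖ ≤ Real.exp |z.im| := by
    rw [norm_exp]; refine Real.exp_le_exp.2 ?_
    simpa using neg_le_abs z.im
  have := norm_sub_le (cexp (-z * I)) (cexp (z * I))
  rw [sin, norm_div, norm_mul, norm_I, mul_one]
  simp only [norm_ofNat]
  linarith

lemma exists_norm_inv_Gamma_le :
    ∃ M : ℝ, 0 < M ∧ ∀ z : ℂ, -1 ≤ z.re → z.re ≤ 2 → 1 / 2 ≤ |z.im| →
      ‖(Gamma z)⁻¹‖ ≤ M * Real.exp (Real.pi * |z.im|) := by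
  obtain ⟨M, hM0, hM⟩ := exists_norm_Gamma_le_of_strip (a := 1) (b := 4) (by norm_num) (by norm_num)
  refine ⟨4 * M / Real.pi, by positivity, fun z hz hz' hi => ?_⟩
  have him : z.im ≠ 0 := by
    rintro h; rw [h] at hi; norm_num at hi
  have hne : ∀ r : ℂ, r.im = 0 → 1 / 2 ≤ ‖r - z‖ := fun r hr => by
    refine hi.trans ?_
    have := abs_im_le_norm (r - z)
    simpa [hr] using this
  have h1 := hne 1 rfl
  have h2 := hne 2 rfl
  have e1 : (1 : ℂ) - z ≠ 0 := by intro h; rw [h] at h1; norm_num at h1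
  have e2 : (2 : ℂ) - z ≠ 0 := by intro h; rw [h] at h2; norm_num at h2
  have hG : Gamma (3 - z) = (2 - z) * ((1 - z) * Gamma (1 - z)) := by
    rw [← Gamma_add_one _ e1, show (1 : ℂ) - z + 1 = 2 - z by ring, ← Gamma_add_one _ e2]
    congr 1; ring
  have hGn : ‖Gamma (1 - z)‖ ≤ 4 * M := by
    have h3 := hM (3 - z) (by simp; linarith) (by simp; linarith)
    rw [hG, norm_mul, norm_mul, ← mul_assoc] at h3
    have : (1 / 2 * (1 / 2) : ℝ) ≤ ‖2 - z‖ * ‖1 - z‖ := by gcongr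
    nlinarith [norm_nonneg (Gamma (1 - z))]
  have hs : sin (Real.pi * z) ≠ 0 := by
    rw [Ne, sin_eq_zero_iff]
    rintro ⟨k, hk⟩
    have := congrArg im hk
    simp at this
    exact him this
  have key := Gamma_mul_Gamma_one_sub z
  have hΓ : Gamma z ≠ 0 := by
    intro h
    rw [h, zero_mul] at key
    have : (Real.pi : ℂ) / sin (Real.pi * z) ≠ 0 :=
      div_ne_zero (by exact_mod_cast Real.pi_ne_zero) hs
    exact this key.symm
  have : (Gamma z)⁻¹ = sin (Real.pi * z) * Gamma (1 - z) / Real.pi := by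
    have hp : (Real.pi : ℂ) ≠ 0 := by exact_mod_cast Real.pi_ne_zero
    rw [eq_div_iff hs] at key
    field_simp
    linear_combination -key
  rw [this, norm_div, norm_mul]
  have h4 := norm_sin_le_exp (Real.pi * z)
  have h5 : |((Real.pi : ℂ) * z).im| = Real.pi * |z.im| := by
    simp [abs_mul, abs_of_pos Real.pi_pos]
  rw [h5] at h4
  have h6 : ‖(Real.pi : ℂ)‖ = Real.pi := by simp [abs_of_pos Real.pi_pos]
  rw [h6, div_mul_eq_mul_div, mul_comm]
  refine div_le_div_of_nonneg_right ?_ Real.pi_pos.le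
  gcongr

lemma exists_norm_inv_Gammaℝ_le :
    ∃ M : ℝ, 0 < M ∧ ∀ s : ℂ, -(1 / 2) ≤ s.re → s.re ≤ 7 / 2 → 1 ≤ |s.im| →
      ‖(Gammaℝ s)⁻¹‖ ≤ M * Real.exp (2 * |s.im|) := by
  obtain ⟨M, hM0, hM⟩ := exists_norm_inv_Gamma_le
  refine ⟨Real.pi ^ (2 : ℝ) * M, by positivity, fun s h1 h2 h3 => ?_⟩
  have hre : (s / 2).re = s.re / 2 := by simp
  have him : (s / 2).im = s.im / 2 := by simp
  have := hM (s / 2) (by rw [hre]; linarith) (by rw [hre]; linarith)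
    (by rw [him, abs_div]; norm_num; linarith)
  rw [Gammaℝ_def, mul_inv, norm_mul, mul_assoc]
  gcongr
  · rw [← cpow_neg, norm_cpow_eq_rpow_re_of_pos Real.pi_pos]
    refine Real.rpow_le_rpow_of_exponent_le (by linarith [Real.pi_gt_three]) ?_
    simp only [neg_div, neg_neg, hre]
    linarith
  · refine this.trans ?_
    refine mul_le_mul_of_nonneg_left (Real.exp_le_exp.2 ?_) hM0.le
    rw [him, abs_div]
    norm_num
    nlinarith [Real.pi_lt_four, abs_nonneg s.im]

lemma exists_norm_completedHurwitzZetaEven_le (a : UnitAddCircle) :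
    ∃ M : ℝ, 0 < M ∧ ∀ s : ℂ, -(1 / 2) ≤ s.re → s.re ≤ 5 / 2 → 1 ≤ |s.im| →
      ‖completedHurwitzZetaEven a s‖ ≤ M := by
  set P := hurwitzEvenFEPair a
  have hc : ∀ s : ℂ, MellinConvergent P.f_modif s := fun s =>
    (P.isStrongFEPair_toStrongFEPair.hasMellin s).1
  obtain ⟨M, hM⟩ := exists_norm_mellin_le_of_strip (hc ((-1 : ℝ) : ℂ)) (hc ((2 : ℝ) : ℂ))
  have hM0 : 0 ≤ M := (norm_nonneg _).trans (hM 0 (by simp) (by simp))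
  refine ⟨M + 2, by linarith, fun s h1 h2 h3 => ?_⟩
  have hre : (s / 2).re = s.re / 2 := by simp
  have h4 : ‖completedHurwitzZetaEven₀ a s‖ ≤ M := by
    have : completedHurwitzZetaEven₀ a s = mellin P.f_modif (s / 2) / 2 := rfl
    rw [this, norm_div]
    have := hM (s / 2) (by rw [hre]; linarith) (by rw [hre]; linarith)
    simp only [norm_ofNat]
    linarith
  have hs : 1 ≤ ‖s‖ := h3.trans (abs_im_le_norm s)
  have hs' : 1 ≤ ‖1 - s‖ := h3.trans (by simpa using abs_im_le_norm (1 - s))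
  rw [completedHurwitzZetaEven_eq]
  have h5 : ‖(if a = 0 then (1 : ℂ) else 0) / s‖ ≤ 1 := by
    rw [norm_div, div_le_one (by linarith)]
    split_ifs
    · simpa using hs
    · simp
  have h6 : ‖(1 : ℂ) / (1 - s)‖ ≤ 1 := by
    rw [norm_div, div_le_one (by linarith)]; simpa using hs'
  have := norm_sub_le (completedHurwitzZetaEven₀ a s - (if a = 0 then (1 : ℂ) else 0) / s)
    (1 / (1 - s))
  have := norm_sub_le (completedHurwitzZetaEven₀ a s) ((if a = 0 then (1 : ℂ) else 0) / s)
  linarith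

lemma exists_norm_completedHurwitzZetaOdd_le (a : UnitAddCircle) :
    ∃ M : ℝ, 0 < M ∧ ∀ s : ℂ, -(1 / 2) ≤ s.re → s.re ≤ 5 / 2 →
      ‖completedHurwitzZetaOdd a s‖ ≤ M := by
  set P := hurwitzOddFEPair a
  have hP : IsStrongFEPair P := isStrong_hurwitzOddFEPair a
  have hc : ∀ s : ℂ, MellinConvergent P.f s := fun s => (hP.hasMellin s).1
  obtain ⟨M, hM⟩ := exists_norm_mellin_le_of_strip (hc ((-1 : ℝ) : ℂ)) (hc ((2 : ℝ) : ℂ))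
  have hM0 : 0 ≤ M := (norm_nonneg _).trans (hM 0 (by simp) (by simp))
  refine ⟨M + 1, by linarith, fun s h1 h2 => ?_⟩
  have hre : ((s + 1) / 2).re = (s.re + 1) / 2 := by simp
  have : completedHurwitzZetaOdd a s = mellin P.f ((s + 1) / 2) / 2 := by
    rw [completedHurwitzZetaOdd, hP.Λ_eq]
  rw [this, norm_div]
  have := hM ((s + 1) / 2) (by rw [hre]; linarith) (by rw [hre]; linarith)
  simp only [norm_ofNat]
  linarith

lemma exists_norm_hurwitzZeta_le (a : UnitAddCircle) :
    ∃ M : ℝ, 0 < M ∧ ∀ s : ℂ, -(1 / 2) ≤ s.re → s.re ≤ 5 / 2 → 1 ≤ |s.im| →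
      ‖hurwitzZeta a s‖ ≤ M * Real.exp (2 * |s.im|) := by
  obtain ⟨M₁, hM₁, h1⟩ := exists_norm_completedHurwitzZetaEven_le a
  obtain ⟨M₂, hM₂, h2⟩ := exists_norm_completedHurwitzZetaOdd_le a
  obtain ⟨M₃, hM₃, h3⟩ := exists_norm_inv_Gammaℝ_le
  refine ⟨M₁ * M₃ + M₂ * M₃, by positivity, fun s hs hs' hi => ?_⟩
  have hs0 : s ≠ 0 := by rintro rfl; norm_num at hi
  rw [hurwitzZeta, add_mul]
  refine (norm_add_le _ _).trans (add_le_add ?_ ?_)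
  · rw [hurwitzZetaEven_def_of_ne_or_ne (Or.inr hs0), div_eq_mul_inv, norm_mul, mul_assoc]
    gcongr
    · exact h1 s hs hs' hi
    · exact h3 s hs (by linarith) hi
  · rw [hurwitzZetaOdd, div_eq_mul_inv, norm_mul, mul_assoc]
    gcongr
    · exact h2 s hs hs'
    · have := h3 (s + 1) (by simp; linarith) (by simp; linarith) (by simpa using hi)
      simpa using this

lemma exists_norm_LFunction_le {N : ℕ} [NeZero N] (Φ : ZMod N → ℂ) :
    ∃ M : ℝ, 0 < M ∧ ∀ s : ℂ, -(1 / 2) ≤ s.re → s.re ≤ 5 / 2 → 1 ≤ |s.im| →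
      ‖ZMod.LFunction Φ s‖ ≤ M * Real.exp (2 * |s.im|) := by
  choose M hM0 hM using fun j : ZMod N => exists_norm_hurwitzZeta_le (ZMod.toAddCircle j)
  have hN : (1 : ℝ) ≤ N := by exact_mod_cast NeZero.one_le
  refine ⟨(N : ℝ) * ∑ j, ‖Φ j‖ * M j + 1, ?_, fun s hs hs' hi => ?_⟩
  · have : 0 ≤ ∑ j, ‖Φ j‖ * M j := Finset.sum_nonneg fun j _ => mul_nonneg (norm_nonneg _) (hM0 j).le
    positivity
  · have h1 : ‖(N : ℂ) ^ (-s)‖ ≤ N := by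
      rw [show (N : ℂ) = ((N : ℝ) : ℂ) by simp, norm_cpow_eq_rpow_re_of_pos (by linarith)]
      calc (N : ℝ) ^ (-s).re ≤ (N : ℝ) ^ (1 : ℝ) :=
            Real.rpow_le_rpow_of_exponent_le hN (by simp; linarith)
        _ = N := Real.rpow_one _
    have h2 : ‖∑ j, Φ j * HurwitzZeta.hurwitzZeta (ZMod.toAddCircle j) s‖ ≤
        (∑ j, ‖Φ j‖ * M j) * Real.exp (2 * |s.im|) := by
      rw [Finset.sum_mul]
      refine (norm_sum_le _ _).trans (Finset.sum_le_sum fun j _ => ?_)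
      rw [norm_mul, mul_assoc]
      gcongr
      exact hM j s hs hs' hi
    rw [ZMod.LFunction, norm_mul]
    have := mul_le_mul h1 h2 (norm_nonneg _) (by linarith)
    have := Real.exp_pos (2 * |s.im|)
    nlinarith

end

section

lemma mem_d3_filter_iff {n : ℕ} (hn : n ≠ 0) (p : ℕ × ℕ × ℕ) :
    p ∈ (Finset.Icc 1 n ×ˢ Finset.Icc 1 n ×ˢ Finset.Icc 1 n).filter
      (fun p : ℕ × ℕ × ℕ => p.1 * p.2.1 * p.2.2 = n) ↔ p.1 * p.2.1 * p.2.2 = n := by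
  simp only [Finset.mem_filter, Finset.mem_product, Finset.mem_Icc, and_iff_right_iff_imp]
  rintro rfl
  have h1 : p.1 ≠ 0 := fun h => hn (by simp [h])
  have h2 : p.2.1 ≠ 0 := fun h => hn (by simp [h])
  have h3 : p.2.2 ≠ 0 := fun h => hn (by simp [h])
  refine ⟨⟨by omega, ?_⟩, ⟨by omega, ?_⟩, by omega, ?_⟩
  · exact Nat.le_of_dvd (by omega) ⟨p.2.1 * p.2.2, by ring⟩
  · exact Nat.le_of_dvd (by omega) ⟨p.1 * p.2.2, by ring⟩
  · exact Nat.le_of_dvd (by omega) ⟨p.1 * p.2.1, by ring⟩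

lemma hasSum_d3_mul {f : ℕ → ℂ} {A : ℂ} (h0 : f 0 = 0)
    (hf : HasSum (fun p : ℕ × ℕ × ℕ => f (p.1 * p.2.1 * p.2.2)) A) :
    HasSum (fun n => (d3 n : ℂ) * f n) A := by
  have key := hf.tsum_fiberwise (fun p : ℕ × ℕ × ℕ => p.1 * p.2.1 * p.2.2)
  refine key.congr_fun fun n => ?_
  have h1 : ∀ b : (fun p : ℕ × ℕ × ℕ => p.1 * p.2.1 * p.2.2) ⁻¹' {n},
      f (b.1.1 * b.1.2.1 * b.1.2.2) = f n := fun b => congrArg f b.2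
  simp only [h1]
  rcases eq_or_ne n 0 with rfl | hn
  · simp [h0]
  rw [tsum_const, nsmul_eq_mul, d3]
  congr 2
  have : (fun p : ℕ × ℕ × ℕ => p.1 * p.2.1 * p.2.2) ⁻¹' {n} =
      ((Finset.Icc 1 n ×ˢ Finset.Icc 1 n ×ˢ Finset.Icc 1 n).filter
        (fun p : ℕ × ℕ × ℕ => p.1 * p.2.1 * p.2.2 = n) : Finset (ℕ × ℕ × ℕ)) := by
    ext p
    rw [Finset.mem_coe, mem_d3_filter_iff hn]
    rfl
  rw [this, Nat.card_coe_set_eq, Set.ncard_coe_finset]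

open Complex in
lemma hasSum_LFunction {N : ℕ} [NeZero N] (Φ : ZMod N → ℂ) {s : ℂ} (hs : 1 < s.re) :
    HasSum (fun n : ℕ => Φ n * (n : ℂ) ^ (-s)) (ZMod.LFunction Φ s) := by
  have hs0 : s ≠ 0 := by rintro rfl; simp at hs; linarith
  have := (ZMod.LSeriesSummable_of_one_lt_re Φ hs).hasSum
  rw [ZMod.LFunction_eq_LSeries Φ hs, LSeries]
  refine this.congr_fun fun n => ?_
  rw [LSeries.term_def]
  split_ifs with h
  · simp [h, hs0]
  · rw [cpow_neg, div_eq_mul_inv]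

open Complex in
lemma hasSum_mul_LFunction {N : ℕ} [NeZero N] (Φ₁ Φ₂ Φ₃ : ZMod N → ℂ) {s : ℂ} (hs : 1 < s.re) :
    HasSum (fun p : ℕ × ℕ × ℕ => Φ₁ p.1 * Φ₂ p.2.1 * Φ₃ p.2.2 *
        ((p.1 * p.2.1 * p.2.2 : ℕ) : ℂ) ^ (-s))
      (ZMod.LFunction Φ₁ s * ZMod.LFunction Φ₂ s * ZMod.LFunction Φ₃ s) := by
  have h1 := hasSum_LFunction Φ₁ hs
  have h2 := hasSum_LFunction Φ₂ hs
  have h3 := hasSum_LFunction Φ₃ hs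
  have h23 := h2.mul h3 (h2.summable.norm.mul_norm h3.summable.norm).of_norm
  have h := h1.mul h23 (h1.summable.norm.mul_norm h23.summable.norm).of_norm
  rw [mul_assoc]
  refine h.congr_fun fun p => ?_
  rw [Nat.cast_mul, natCast_mul_natCast_cpow, Nat.cast_mul, natCast_mul_natCast_cpow]
  ring

open MeasureTheory Complex in
lemma hasSum_integral_mul_LFunction {N : ℕ} [NeZero N] (Φ₁ Φ₂ Φ₃ : ZMod N → ℂ) {φ : ℝ → ℂ}
    (hφ : Integrable φ) {c : ℝ} (hc : 1 < c) :
    HasSum (fun p : ℕ × ℕ × ℕ => Φ₁ p.1 * Φ₂ p.2.1 * Φ₃ p.2.2 *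
        ∫ τ : ℝ, φ τ * ((p.1 * p.2.1 * p.2.2 : ℕ) : ℂ) ^ (-(c + τ * I : ℂ)))
      (∫ τ : ℝ, φ τ * (ZMod.LFunction Φ₁ (c + τ * I) * ZMod.LFunction Φ₂ (c + τ * I) *
        ZMod.LFunction Φ₃ (c + τ * I))) := by
  have hre : ∀ τ : ℝ, (c + τ * I : ℂ).re = c := fun τ => by simp
  have hne : ∀ τ : ℝ, -(c + τ * I : ℂ) ≠ 0 := fun τ h => by
    have := congrArg re h
    simp at this
    linarith
  have hsum := fun τ : ℝ => hasSum_mul_LFunction Φ₁ Φ₂ Φ₃ (s := c + τ * I) (by rw [hre]; exact hc)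
  have hnorm : ∀ (n : ℕ) (τ : ℝ), ‖(n : ℂ) ^ (-(c + τ * I : ℂ))‖ = ‖(n : ℂ) ^ (-(c : ℂ))‖ := by
    intro n τ
    rcases Nat.eq_zero_or_pos n with rfl | hn
    · have hc0 : -(c : ℂ) ≠ 0 := by simpa using hne 0
      rw [Nat.cast_zero, zero_cpow (hne τ), zero_cpow hc0]
    · rw [norm_natCast_cpow_of_pos hn, norm_natCast_cpow_of_pos hn]
      simp
  set F : ℕ × ℕ × ℕ → ℝ → ℂ := fun p τ => φ τ * (Φ₁ p.1 * Φ₂ p.2.1 * Φ₃ p.2.2 *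
    ((p.1 * p.2.1 * p.2.2 : ℕ) : ℂ) ^ (-(c + τ * I : ℂ))) with hF
  have hcont : ∀ n : ℕ, Continuous fun τ : ℝ => (n : ℂ) ^ (-(c + τ * I : ℂ)) := by
    intro n
    rcases eq_or_ne n 0 with rfl | hn
    · simp only [Nat.cast_zero, zero_cpow (hne _)]
      exact continuous_const
    · exact Continuous.const_cpow (by fun_prop) (Or.inl (by exact_mod_cast hn))
  have hFn : ∀ p τ, ‖F p τ‖ = ‖Φ₁ p.1 * Φ₂ p.2.1 * Φ₃ p.2.2 *
      ((p.1 * p.2.1 * p.2.2 : ℕ) : ℂ) ^ (-(c : ℂ))‖ * ‖φ τ‖ := fun p τ => by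
    simp only [hF, norm_mul, hnorm]
    ring
  have hFi : ∀ p, Integrable (F p) := fun p => by
    refine Integrable.mono' (hφ.norm.const_mul ‖Φ₁ p.1 * Φ₂ p.2.1 * Φ₃ p.2.2 *
      ((p.1 * p.2.1 * p.2.2 : ℕ) : ℂ) ^ (-(c : ℂ))‖)
      (hφ.1.mul ((hcont _).const_mul _).aestronglyMeasurable)
      (Filter.Eventually.of_forall fun τ => (hFn p τ).le)
  have hS : Summable fun p => ∫ τ, ‖F p τ‖ := by
    simp only [hFn, integral_const_mul]
    refine Summable.mul_right _ ?_
    have := (hsum 0).summable.norm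
    simpa using this
  have key := hasSum_integral_of_summable_integral_norm hFi hS
  have h1 : (fun τ => ∑' p, F p τ) = fun τ : ℝ => φ τ * (ZMod.LFunction Φ₁ (c + τ * I) *
      ZMod.LFunction Φ₂ (c + τ * I) * ZMod.LFunction Φ₃ (c + τ * I)) :=
    funext fun τ => ((hsum τ).mul_left (φ τ)).tsum_eq
  rw [h1] at key
  refine key.congr_fun fun p => ?_
  rw [← integral_const_mul]
  congr 1 with τ
  simp only [hF]
  ring

end

section

open Complex ZMod

/-- The entire function `(s - 1) L(Φ, s)`. -/
noncomputable def entireLFunction {N : ℕ} [NeZero N] (Φ : ZMod N → ℂ) : ℂ → ℂ :=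
  Function.update (fun s => (s - 1) * ZMod.LFunction Φ s) 1 (∑ j, Φ j / N)

lemma entireLFunction_of_ne {N : ℕ} [NeZero N] (Φ : ZMod N → ℂ) {s : ℂ} (hs : s ≠ 1) :
    entireLFunction Φ s = (s - 1) * ZMod.LFunction Φ s := by
  rw [entireLFunction, Function.update_of_ne hs]

lemma differentiable_entireLFunction {N : ℕ} [NeZero N] (Φ : ZMod N → ℂ) :
    Differentiable ℂ (entireLFunction Φ) := by
  rw [← differentiableOn_univ]
  refine (differentiableOn_compl_singleton_and_continuousAt_iff
    (c := 1) Filter.univ_mem).1 ⟨?_, ?_⟩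
  · intro s hs
    have hs1 : s ≠ 1 := hs.2
    have h1 : DifferentiableAt ℂ (fun s => (s - 1) * ZMod.LFunction Φ s) s := by
      have := ZMod.differentiableAt_LFunction Φ s (Or.inl hs1)
      fun_prop
    refine (h1.congr_of_eventuallyEq ?_).differentiableWithinAt
    filter_upwards [isOpen_ne.mem_nhds hs1] with z hz
    exact entireLFunction_of_ne Φ hz
  · rw [entireLFunction, continuousAt_update_same]
    have := ZMod.LFunction_residue_one Φ
    simpa [Finset.sum_div] using this

lemma exists_norm_LFunction_le_of_one_lt {N : ℕ} [NeZero N] (Φ : ZMod N → ℂ) {c : ℝ} (hc : 1 < c) :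
    ∃ M : ℝ, 0 < M ∧ ∀ s : ℂ, s.re = c → ‖ZMod.LFunction Φ s‖ ≤ M := by
  have h := (hasSum_LFunction Φ (s := c) (by simpa using hc)).summable.norm
  refine ⟨(∑' n : ℕ, ‖Φ n * (n : ℂ) ^ (-(c : ℂ))‖) + 1, by positivity, fun s hs => ?_⟩
  have h1 := hasSum_LFunction Φ (s := s) (by rw [hs]; exact hc)
  have : ∀ n : ℕ, ‖Φ n * (n : ℂ) ^ (-s)‖ = ‖Φ n * (n : ℂ) ^ (-(c : ℂ))‖ := fun n => by
    rw [norm_mul, norm_mul, norm_natCast_cpow_of_re_ne_zero, norm_natCast_cpow_of_re_ne_zero]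
    · simp [hs]
    · simp; linarith
    · simp [hs]; linarith
  rw [← h1.tsum_eq]
  have h2 := norm_tsum_le_tsum_norm h1.summable.norm
  simp only [this] at h2
  linarith

/-- The functional equation of periodic `L`-functions, as a sum over signs. -/
lemma LFunction_one_sub_eq_sum_units {N : ℕ} [NeZero N] (Φ : ZMod N → ℂ) {z : ℂ} (hz : 1 < z.re) :
    LFunction Φ (1 - z) = (N : ℂ) ^ (z - 1) * ((2 * Real.pi : ℂ) ^ (-z) * Gamma z) *
      ∑ σ : ℤˣ, cexp (((σ : ℤ) : ℂ) * (Real.pi * I * z / 2)) *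
        LFunction (fun j => dft Φ (((σ : ℤ) : ZMod N) * j)) z := by
  rw [LFunction_one_sub Φ (s := z), UnitsInt.univ]
  · rw [Finset.sum_insert (by decide), Finset.sum_singleton]
    have : dft (fun x => Φ (-x)) = fun j => dft Φ (-j) := dft_comp_neg Φ
    simp [this]
    ring_nf
  · intro n h
    rw [h] at hz
    simp at hz
    have : (0 : ℝ) ≤ n := n.cast_nonneg
    linarith
  · right
    rintro rfl
    simp at hz

lemma exists_norm_LFunction_neg_half_le {N : ℕ} [NeZero N] (Φ : ZMod N → ℂ) :
    ∃ M : ℝ, 0 < M ∧ ∀ s : ℂ, s.re = -(1 / 2) → ‖LFunction Φ s‖ ≤ M * (1 + |s.im|) := by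
  choose M hM0 hM using fun σ : ℤˣ => exists_norm_LFunction_le_of_one_lt
    (fun j => dft Φ (((σ : ℤ) : ZMod N) * j)) (c := 3 / 2) (by norm_num)
  obtain ⟨K, hK0, hK⟩ := exists_norm_Gamma_mul_exp_le (c := 3 / 2) (by norm_num) le_rfl
  have hN : (0 : ℝ) < N := by exact_mod_cast NeZero.pos N
  refine ⟨(N : ℝ) ^ (1 / 2 : ℝ) * ((2 * Real.pi) ^ (-(3 / 2) : ℝ) * (K * ∑ σ, M σ)), ?_,
    fun s hs => ?_⟩
  · have : 0 < ∑ σ, M σ := Finset.sum_pos (fun σ _ => hM0 σ) Finset.univ_nonempty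
    have := Real.pi_pos
    positivity
  obtain ⟨z, rfl⟩ : ∃ z : ℂ, s = 1 - z := ⟨1 - s, by ring⟩
  have hzre : z.re = 3 / 2 := by simp at hs; linarith
  rw [LFunction_one_sub_eq_sum_units Φ (by rw [hzre]; norm_num), norm_mul, norm_mul, norm_mul,
    mul_assoc, mul_assoc, mul_assoc]
  have hz : z = ((3 / 2 : ℝ) : ℂ) + z.im * I := by
    apply Complex.ext <;> simp [hzre]
  have h1 : ‖(N : ℂ) ^ (z - 1)‖ = (N : ℝ) ^ (1 / 2 : ℝ) := by
    rw [norm_natCast_cpow_of_pos (NeZero.pos N)]; simp [hzre]; norm_num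
  have h2 : ‖(2 * Real.pi : ℂ) ^ (-z)‖ = (2 * Real.pi) ^ (-(3 / 2) : ℝ) := by
    rw [show (2 * Real.pi : ℂ) = ((2 * Real.pi : ℝ) : ℂ) by simp,
      norm_cpow_eq_rpow_re_of_pos (by positivity)]
    simp [hzre]
  have h3 : ‖∑ σ : ℤˣ, cexp (((σ : ℤ) : ℂ) * (Real.pi * I * z / 2)) *
        LFunction (fun j => dft Φ (((σ : ℤ) : ZMod N) * j)) z‖ ≤
      Real.exp (Real.pi / 2 * |z.im|) * ∑ σ, M σ := by
    rw [Finset.mul_sum]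
    refine (norm_sum_le _ _).trans (Finset.sum_le_sum fun σ _ => ?_)
    rw [norm_mul]
    refine mul_le_mul ?_ (hM σ z hzre) (norm_nonneg _) (Real.exp_pos _).le
    rw [norm_exp]
    refine Real.exp_le_exp.2 ?_
    rcases Int.units_eq_one_or σ with rfl | rfl
    · simp
      nlinarith [neg_abs_le z.im, Real.pi_pos]
    · simp
      nlinarith [le_abs_self z.im, Real.pi_pos]
  have h4 := hK z.im
  rw [← hz] at h4
  rw [show (3 / 2 - 1 / 2 : ℝ) = 1 by norm_num, Real.rpow_one] at h4
  have him : |(1 - z).im| = |z.im| := by simp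
  have hMs : 0 ≤ ∑ σ, M σ := Finset.sum_nonneg fun σ _ => (hM0 σ).le
  rw [h1, h2, him, mul_assoc ((N : ℝ) ^ (1 / 2 : ℝ)), mul_assoc (_ ^ _)]
  refine mul_le_mul_of_nonneg_left (mul_le_mul_of_nonneg_left ?_ (by positivity)) (by positivity)
  calc _ ≤ ‖Gamma z‖ * (Real.exp (Real.pi / 2 * |z.im|) * ∑ σ, M σ) :=
        mul_le_mul_of_nonneg_left (by simpa only [mul_assoc] using h3) (norm_nonneg _)
    _ = ‖Gamma z‖ * Real.exp (Real.pi / 2 * |z.im|) * ∑ σ, M σ := by ring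
    _ ≤ K * (1 + |z.im|) * ∑ σ, M σ := by gcongr
    _ = _ := by ring

/-- The entire function `(s - 1)³ L(Φ₁, s) L(Φ₂, s) L(Φ₃, s) ŵ(s)`. -/
noncomputable def entireProduct {N : ℕ} [NeZero N] (Φ₁ Φ₂ Φ₃ : ZMod N → ℂ) (w : ℝ → ℝ) (s : ℂ) :
    ℂ :=
  entireLFunction Φ₁ s * entireLFunction Φ₂ s * entireLFunction Φ₃ s * IsCutoff.mellinDeriv w 0 s

lemma norm_mul₄_le {a b c f : ℂ} {A B C F : ℝ} (ha : ‖a‖ ≤ A) (hb : ‖b‖ ≤ B) (hc : ‖c‖ ≤ C)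
    (hf : ‖f‖ ≤ F) : ‖a * b * c * f‖ ≤ A * B * C * F := by
  have hA := (norm_nonneg _).trans ha
  have hB := (norm_nonneg _).trans hb
  have hC := (norm_nonneg _).trans hc
  rw [norm_mul, norm_mul, norm_mul]
  gcongr

lemma exists_norm_entireLFunction_le_of_edge {N : ℕ} [NeZero N] (Φ : ZMod N → ℂ) :
    ∃ M : ℝ, 0 < M ∧ ∀ s : ℂ, (s.re = -(1 / 2) ∨ s.re = 5 / 2) →
      ‖entireLFunction Φ s‖ ≤ M * (1 + |s.im|) ^ 2 := by
  obtain ⟨M₁, h1, hM₁⟩ := exists_norm_LFunction_neg_half_le Φ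
  obtain ⟨M₂, h2, hM₂⟩ := exists_norm_LFunction_le_of_one_lt Φ (c := 5 / 2) (by norm_num)
  refine ⟨2 * (M₁ + M₂), by positivity, fun s hs => ?_⟩
  have ht := abs_nonneg s.im
  have hne : s ≠ 1 := by
    rintro rfl
    rcases hs with h | h <;> norm_num at h
  rw [entireLFunction_of_ne Φ hne, norm_mul]
  have hs1 : ‖s - 1‖ ≤ 2 * (1 + |s.im|) := by
    refine (norm_le_abs_re_add_abs_im _).trans ?_
    have : |(s - 1).re| ≤ 3 / 2 := by
      rw [abs_le]
      rcases hs with h | h <;> simp [h] <;> norm_num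
    simp only [sub_im, one_im, sub_zero]
    linarith
  have hL : ‖LFunction Φ s‖ ≤ (M₁ + M₂) * (1 + |s.im|) := by
    rcases hs with h | h
    · refine (hM₁ s h).trans ?_
      gcongr; linarith
    · have := hM₂ s h
      nlinarith [mul_nonneg h2.le ht, mul_nonneg h1.le ht]
  calc _ ≤ 2 * (1 + |s.im|) * ((M₁ + M₂) * (1 + |s.im|)) := by gcongr
    _ = _ := by ring

lemma exists_norm_entireLFunction_le {N : ℕ} [NeZero N] (Φ : ZMod N → ℂ) :
    ∃ M : ℝ, 0 < M ∧ ∀ s : ℂ, -(1 / 2) ≤ s.re → s.re ≤ 5 / 2 → 1 ≤ |s.im| →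
      ‖entireLFunction Φ s‖ ≤ M * Real.exp (4 * |s.im|) := by
  obtain ⟨M, h1, hM⟩ := exists_norm_LFunction_le Φ
  refine ⟨4 * M, by positivity, fun s hs hs' hi => ?_⟩
  have hne : s ≠ 1 := by
    rintro rfl
    norm_num at hi
  rw [entireLFunction_of_ne Φ hne, norm_mul]
  have hs1 : ‖s - 1‖ ≤ 4 * Real.exp (2 * |s.im|) := by
    refine (norm_le_abs_re_add_abs_im _).trans ?_
    have : |(s - 1).re| ≤ 3 / 2 := by
      rw [abs_le]
      constructor <;> simp <;> linarith
    have := Real.add_one_le_exp (2 * |s.im|)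
    simp only [sub_im, one_im, sub_zero]
    linarith
  calc _ ≤ 4 * Real.exp (2 * |s.im|) * (M * Real.exp (2 * |s.im|)) := by
        gcongr
        exact hM s hs hs' hi
    _ = 4 * M * (Real.exp (2 * |s.im|) * Real.exp (2 * |s.im|)) := by ring
    _ = _ := by rw [← Real.exp_add]; ring_nf

namespace IsCutoff
variable {Cd : ℕ → ℝ} {x Y : ℝ} {w : ℝ → ℝ}

lemma differentiable_entireProduct {N : ℕ} [NeZero N] (h : IsCutoff Cd x Y w)
    (Φ₁ Φ₂ Φ₃ : ZMod N → ℂ) : Differentiable ℂ (entireProduct Φ₁ Φ₂ Φ₃ w) :=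
  (((differentiable_entireLFunction Φ₁).mul (differentiable_entireLFunction Φ₂)).mul
    (differentiable_entireLFunction Φ₃)).mul (h.differentiable_mellinDeriv 0)

lemma exists_norm_entireProduct_le {N : ℕ} [NeZero N] (h : IsCutoff Cd x Y w)
    (Φ₁ Φ₂ Φ₃ : ZMod N → ℂ) :
    ∃ M : ℝ, ∀ s : ℂ, -(1 / 2) ≤ s.re → s.re ≤ 5 / 2 → ‖entireProduct Φ₁ Φ₂ Φ₃ w s‖ ≤ M := by
  obtain ⟨A₁, hA₁0, hA₁⟩ := exists_norm_entireLFunction_le_of_edge Φ₁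
  obtain ⟨A₂, hA₂0, hA₂⟩ := exists_norm_entireLFunction_le_of_edge Φ₂
  obtain ⟨A₃, hA₃0, hA₃⟩ := exists_norm_entireLFunction_le_of_edge Φ₃
  obtain ⟨B₁, hB₁0, hB₁⟩ := exists_norm_entireLFunction_le Φ₁
  obtain ⟨B₂, hB₂0, hB₂⟩ := exists_norm_entireLFunction_le Φ₂
  obtain ⟨B₃, hB₃0, hB₃⟩ := exists_norm_entireLFunction_le Φ₃
  obtain ⟨K, hK0, hK⟩ := h.exists_norm_mellinDeriv_le (-(1 / 2)) (5 / 2) 6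
  obtain ⟨K', hK'0, hK'⟩ := h.exists_norm_mellinDeriv_le (-(1 / 2)) (5 / 2) 0
  have hedge : ∀ s : ℂ, (s.re = -(1 / 2) ∨ s.re = 5 / 2) →
      ‖entireProduct Φ₁ Φ₂ Φ₃ w s‖ ≤ A₁ * A₂ * A₃ * K := fun s hs => by
    have h1 := norm_mul₄_le (hA₁ s hs) (hA₂ s hs) (hA₃ s hs) (le_refl ‖mellinDeriv w 0 s‖)
    have h2 := hK s (by rcases hs with h | h <;> linarith)
      (by rcases hs with h | h <;> linarith)
    calc _ ≤ _ := h1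
      _ = A₁ * A₂ * A₃ * (‖mellinDeriv w 0 s‖ * (1 + |s.im|) ^ 6) := by ring
      _ ≤ _ := by gcongr
  refine ⟨A₁ * A₂ * A₃ * K, norm_le_of_norm_le_on_edges (B := B₁ * B₂ * B₃ * K' + 12)
    (by norm_num) (by norm_num) (fun z _ _ => h.differentiable_entireProduct _ _ _ z) ?_
    (fun z hz => hedge z (Or.inl hz)) (fun z hz => hedge z (Or.inr hz))⟩
  intro z h1 h2 h3
  have h4 := norm_mul₄_le (hB₁ z h1 h2 h3) (hB₂ z h1 h2 h3) (hB₃ z h1 h2 h3)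
    (by simpa using hK' z h1 h2)
  have h5 : 0 ≤ B₁ * B₂ * B₃ * K' := by positivity
  refine h4.trans ?_
  have h6 : 1 ≤ Real.exp |z.im| := Real.one_le_exp (abs_nonneg _)
  have h7 : |z.im| ≤ Real.exp |z.im| := by linarith [Real.add_one_le_exp |z.im|]
  calc _ = B₁ * B₂ * B₃ * K' * (Real.exp (4 * |z.im|) * Real.exp (4 * |z.im|) *
        Real.exp (4 * |z.im|)) := by ring
    _ = B₁ * B₂ * B₃ * K' * Real.exp (12 * |z.im|) := by
        rw [← Real.exp_add, ← Real.exp_add]; ring_nf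
    _ ≤ Real.exp (B₁ * B₂ * B₃ * K') * Real.exp (12 * |z.im|) := by
        gcongr; linarith [Real.add_one_le_exp (B₁ * B₂ * B₃ * K')]
    _ ≤ _ := by
        rw [← Real.exp_add]
        refine Real.exp_le_exp.2 ?_
        nlinarith

lemma integral_mul_LFunction_sub_eq {N : ℕ} [NeZero N] (h : IsCutoff Cd x Y w)
    (Φ₁ Φ₂ Φ₃ : ZMod N → ℂ) :
    (∫ τ : ℝ, mellinDeriv w 0 ((5 / 2 : ℝ) + τ * I) *
        (LFunction Φ₁ ((5 / 2 : ℝ) + τ * I) * LFunction Φ₂ ((5 / 2 : ℝ) + τ * I) *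
          LFunction Φ₃ ((5 / 2 : ℝ) + τ * I))) -
      ∫ τ : ℝ, mellinDeriv w 0 ((-(1 / 2) : ℝ) + τ * I) *
        (LFunction Φ₁ ((-(1 / 2) : ℝ) + τ * I) * LFunction Φ₂ ((-(1 / 2) : ℝ) + τ * I) *
          LFunction Φ₃ ((-(1 / 2) : ℝ) + τ * I)) =
      Real.pi * iteratedDeriv 2 (entireProduct Φ₁ Φ₂ Φ₃ w) 1 := by
  obtain ⟨M, hM⟩ := h.exists_norm_entireProduct_le Φ₁ Φ₂ Φ₃
  have key := integral_vertical_sub_eq_of_bounded (g := entireProduct Φ₁ Φ₂ Φ₃ w) (m := 1)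
    (a := 3 / 2) (M := M) (by norm_num)
    (fun z _ _ => (h.differentiable_entireProduct _ _ _).analyticAt z)
    (fun z h1 h2 => hM z (by linarith) (by linarith))
  rw [ofReal_one] at key
  rw [← key]
  have haux : ∀ {c r : ℝ}, c = 1 + r → r ≠ 0 → ∀ τ : ℝ, mellinDeriv w 0 (c + τ * I) *
      (LFunction Φ₁ (c + τ * I) * LFunction Φ₂ (c + τ * I) * LFunction Φ₃ (c + τ * I)) =
      entireProduct Φ₁ Φ₂ Φ₃ w ((1 + r : ℝ) + τ * I) / (r + τ * I : ℂ) ^ 3 := by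
    rintro c r rfl hr τ
    have h0 : (r + τ * I : ℂ) ≠ 0 := fun h0 => hr (by simpa using congrArg re h0)
    have h1 : ((1 + r : ℝ) + τ * I : ℂ) ≠ 1 := fun h1 => hr (by simpa using congrArg re h1)
    rw [entireProduct, entireLFunction_of_ne _ h1, entireLFunction_of_ne _ h1,
      entireLFunction_of_ne _ h1, eq_div_iff (pow_ne_zero _ h0),
      show ((1 + r : ℝ) + τ * I : ℂ) - 1 = r + τ * I by push_cast; ring]
    ring
  congr 1
  · refine MeasureTheory.integral_congr_ae (Filter.Eventually.of_forall fun τ => ?_)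
    exact haux (by norm_num) (by norm_num) τ
  · refine MeasureTheory.integral_congr_ae (Filter.Eventually.of_forall fun τ => ?_)
    exact haux (by norm_num) (by norm_num) τ

end IsCutoff

end

section

open Complex MeasureTheory

lemma integrable_of_norm_mul_sq_le {f : ℝ → ℂ} {M : ℝ} (hf : Continuous f)
    (h : ∀ τ, ‖f τ‖ * (1 + |τ|) ^ 2 ≤ M) : Integrable f := by
  refine Integrable.mono' (integrable_inv_one_add_sq.const_mul M) hf.aestronglyMeasurable
    (Filter.Eventually.of_forall fun τ => ?_)
  have h1 : 0 < 1 + τ ^ 2 := by positivity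
  rw [← div_eq_mul_inv, le_div_iff₀ h1]
  refine le_trans (mul_le_mul_of_nonneg_left ?_ (norm_nonneg _)) (h τ)
  nlinarith [abs_nonneg τ, sq_abs τ]

lemma iteratedDeriv_two_pow_three_mul {F : ℂ → ℂ} {m : ℂ} (hF : AnalyticAt ℂ F m) :
    iteratedDeriv 2 (fun z => (z - m) ^ 3 * F z) m = 0 := by
  rw [iteratedDeriv_succ, iteratedDeriv_one]
  have h1 : deriv (fun z => (z - m) ^ 3 * F z) =ᶠ[nhds m]
      fun z => (z - m) ^ 2 * (3 * F z + (z - m) * deriv F z) := by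
    filter_upwards [hF.eventually_analyticAt] with z hz
    have h2 : HasDerivAt (fun z => (z - m) ^ 3) (3 * (z - m) ^ 2) z := by
      simpa using ((hasDerivAt_id z).sub_const m).fun_pow 3
    rw [(h2.fun_mul hz.differentiableAt.hasDerivAt).deriv]
    ring
  rw [h1.deriv_eq]
  have h3 : HasDerivAt (fun z => (z - m) ^ 2) 0 m := by
    simpa using ((hasDerivAt_id m).sub_const m).fun_pow 2
  have h4 : DifferentiableAt ℂ (fun z => 3 * F z + (z - m) * deriv F z) m := by
    have := hF.differentiableAt
    have := hF.deriv.differentiableAt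
    fun_prop
  rw [(h3.fun_mul h4.hasDerivAt).deriv]
  simp

/-- The archimedean factor of the functional equation of a product of three `L`-functions. -/
noncomputable def dualGamma (κ : ℝ) (z : ℂ) : ℂ :=
  ((2 * Real.pi : ℂ) ^ (-z) * Gamma z) ^ 3 * cexp (κ * (Real.pi * I * z / 2))

/-- The Mellin transform of `voronoiTransform`. -/
noncomputable def voronoiKernel (d : ℕ) (w : ℝ → ℝ) (κ : ℝ) (z : ℂ) : ℂ :=
  IsCutoff.mellinDeriv w 0 (1 - z) * ((d : ℂ) ^ (z - 1)) ^ 3 * dualGamma κ z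

/-- The transform of the cutoff occurring on the dual side of the summation formula. -/
noncomputable def voronoiTransform (d : ℕ) (w : ℝ → ℝ) (κ : ℝ) (y : ℝ) : ℂ :=
  1 / (2 * Real.pi) * ∫ τ : ℝ, voronoiKernel d w κ ((3 / 2 : ℝ) + τ * I) *
    (y : ℂ) ^ (-((3 / 2 : ℝ) + τ * I : ℂ))

lemma norm_two_pi_cpow (z : ℂ) : ‖(2 * Real.pi : ℂ) ^ (-z)‖ = (2 * Real.pi) ^ (-z.re) := by
  rw [show (2 * Real.pi : ℂ) = ((2 * Real.pi : ℝ) : ℂ) by simp,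
    norm_cpow_eq_rpow_re_of_pos (by positivity), neg_re]

lemma norm_cexp_sign_le {κ : ℝ} (hκ : |κ| ≤ 3) (z : ℂ) :
    ‖cexp (κ * (Real.pi * I * z / 2))‖ ≤ Real.exp (Real.pi / 2 * |z.im|) ^ 3 := by
  rw [norm_exp, ← Real.exp_nat_mul]
  refine Real.exp_le_exp.2 ?_
  have h1 : (κ * (Real.pi * I * z / 2) : ℂ).re = Real.pi / 2 * -(κ * z.im) := by
    simp; ring
  have h2 : -(κ * z.im) ≤ 3 * |z.im| := by
    refine (neg_le_abs _).trans ?_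
    rw [abs_mul]; gcongr
  rw [h1]
  push_cast
  nlinarith [Real.pi_pos]

lemma exists_norm_dualGamma_le {c : ℝ} (hc : 0 < c) (hc' : c ≤ 3 / 2) :
    ∃ K : ℝ, 0 < K ∧ ∀ κ : ℝ, |κ| ≤ 3 → ∀ τ : ℝ,
      ‖dualGamma κ (c + τ * I)‖ ≤ K * (1 + |τ|) ^ (3 * c - 3 / 2) := by
  obtain ⟨K, hK0, hK⟩ := exists_norm_Gamma_mul_exp_le hc hc'
  refine ⟨((2 * Real.pi) ^ (-c) * K) ^ 3, by positivity, fun κ hκ τ => ?_⟩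
  have him : (c + τ * I : ℂ).im = τ := by simp
  have hre : (c + τ * I : ℂ).re = c := by simp
  have h1 := norm_cexp_sign_le hκ (c + τ * I)
  rw [him] at h1
  rw [dualGamma, norm_mul, norm_pow, norm_mul, norm_two_pi_cpow, hre]
  calc _ ≤ ((2 * Real.pi) ^ (-c) * ‖Gamma (c + τ * I)‖) ^ 3 *
        Real.exp (Real.pi / 2 * |τ|) ^ 3 := by gcongr
    _ = ((2 * Real.pi) ^ (-c) * (‖Gamma (c + τ * I)‖ * Real.exp (Real.pi / 2 * |τ|))) ^ 3 := by
        ring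
    _ ≤ ((2 * Real.pi) ^ (-c) * (K * (1 + |τ|) ^ (c - 1 / 2))) ^ 3 := by
        exact pow_le_pow_left₀ (by positivity)
          (mul_le_mul_of_nonneg_left (hK τ) (by positivity)) 3
    _ = ((2 * Real.pi) ^ (-c) * K) ^ 3 * ((1 + |τ|) ^ (c - 1 / 2)) ^ 3 := by ring
    _ = _ := by
        rw [← Real.rpow_mul_natCast (by positivity)]
        congr 2
        push_cast; ring

lemma exists_norm_dualGamma_le_exp {a b : ℝ} (ha : 0 < a) (hb : 0 < b) :
    ∃ K : ℝ, 0 < K ∧ ∀ κ : ℝ, |κ| ≤ 3 → ∀ z : ℂ, a ≤ z.re → z.re ≤ b →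
      ‖dualGamma κ z‖ ≤ K * Real.exp (6 * |z.im|) := by
  obtain ⟨M, hM0, hM⟩ := exists_norm_Gamma_le_of_strip ha hb
  refine ⟨M ^ 3, by positivity, fun κ hκ z h1 h2 => ?_⟩
  have h3 := norm_cexp_sign_le hκ z
  have h4 : (2 * Real.pi) ^ (-z.re) ≤ 1 :=
    Real.rpow_le_one_of_one_le_of_nonpos (by linarith [Real.pi_gt_three]) (by linarith)
  have h5 : Real.exp (Real.pi / 2 * |z.im|) ≤ Real.exp (2 * |z.im|) := by
    refine Real.exp_le_exp.2 ?_
    nlinarith [Real.pi_lt_four, abs_nonneg z.im]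
  rw [dualGamma, norm_mul, norm_pow, norm_mul, norm_two_pi_cpow]
  calc _ ≤ (1 * M) ^ 3 * Real.exp (2 * |z.im|) ^ 3 := by
        gcongr
        · exact hM z h1 h2
        · exact h3.trans (by gcongr)
    _ = _ := by rw [← Real.exp_nat_mul]; push_cast; ring_nf

lemma differentiableAt_dualGamma (κ : ℝ) {z : ℂ} (hz : 0 < z.re) :
    DifferentiableAt ℂ (dualGamma κ) z := by
  unfold dualGamma
  have h1 : DifferentiableAt ℂ Gamma z := differentiableAt_Gamma z fun m h => by
    rw [h] at hz
    simp at hz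
    have : (0 : ℝ) ≤ m := m.cast_nonneg
    linarith
  have h2 : DifferentiableAt ℂ (fun z : ℂ => (2 * Real.pi : ℂ) ^ (-z)) z :=
    differentiableAt_id.neg.const_cpow (Or.inl (by simp [Real.pi_ne_zero]))
  fun_prop

namespace IsCutoff
variable {Cd : ℕ → ℝ} {x Y : ℝ} {w : ℝ → ℝ} {d : ℕ} {κ : ℝ}

lemma differentiableAt_voronoiKernel (h : IsCutoff Cd x Y w) (hd : d ≠ 0) (κ : ℝ) {z : ℂ}
    (hz : 0 < z.re) : DifferentiableAt ℂ (voronoiKernel d w κ) z := by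
  unfold voronoiKernel
  have h1 := differentiableAt_dualGamma κ hz
  have h2 : DifferentiableAt ℂ (fun z : ℂ => mellinDeriv w 0 (1 - z)) z :=
    (h.differentiable_mellinDeriv 0 _).comp z (by fun_prop)
  have h3 : DifferentiableAt ℂ (fun z : ℂ => (d : ℂ) ^ (z - 1)) z :=
    DifferentiableAt.const_cpow (by fun_prop) (Or.inl (by exact_mod_cast hd))
  fun_prop

/-- Rapid decay of the kernel on vertical lines. -/
lemma exists_norm_voronoiKernel_le (h : IsCutoff Cd x Y w) (hd : d ≠ 0) {c : ℝ} (hc : 0 < c)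
    (hc' : c ≤ 3 / 2) (j : ℕ) : ∃ M : ℝ, 0 ≤ M ∧ ∀ κ : ℝ, |κ| ≤ 3 → ∀ τ : ℝ,
      ‖voronoiKernel d w κ (c + τ * I)‖ * (1 + |τ|) ^ j ≤ M := by
  obtain ⟨K, hK0, hK⟩ := exists_norm_dualGamma_le hc hc'
  obtain ⟨M, hM0, hM⟩ := h.exists_norm_mellinDeriv_le (1 - c) (1 - c) (j + 3)
  refine ⟨M * ((d : ℝ) ^ (c - 1)) ^ 3 * K, by positivity, fun κ hκ τ => ?_⟩
  have h1 := hM (1 - (c + τ * I)) (by simp) (by simp)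
  have h2 : |(1 - (c + τ * I) : ℂ).im| = |τ| := by simp
  rw [h2] at h1
  have h3 : (1 + |τ|) ^ (3 * c - 3 / 2) ≤ (1 + |τ|) ^ 3 := by
    rw [← Real.rpow_natCast]
    refine Real.rpow_le_rpow_of_exponent_le (by linarith [abs_nonneg τ]) ?_
    push_cast; linarith
  have h4 : ‖(d : ℂ) ^ ((c + τ * I : ℂ) - 1)‖ = (d : ℝ) ^ (c - 1) := by
    rw [norm_natCast_cpow_of_pos (Nat.pos_of_ne_zero hd)]; simp
  rw [voronoiKernel, norm_mul, norm_mul, norm_pow, h4]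
  calc _ ≤ ‖mellinDeriv w 0 (1 - (c + τ * I))‖ * ((d : ℝ) ^ (c - 1)) ^ 3 *
        (K * (1 + |τ|) ^ 3) * (1 + |τ|) ^ j := by
        gcongr; exact (hK κ hκ τ).trans (by gcongr)
    _ = ‖mellinDeriv w 0 (1 - (c + τ * I))‖ * (1 + |τ|) ^ (j + 3) * ((d : ℝ) ^ (c - 1)) ^ 3 *
        K := by ring
    _ ≤ _ := by gcongr

lemma continuous_voronoiKernel (h : IsCutoff Cd x Y w) (hd : d ≠ 0) (κ : ℝ) {c : ℝ} (hc : 0 < c) :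
    Continuous fun τ : ℝ => voronoiKernel d w κ (c + τ * I) := by
  rw [continuous_iff_continuousAt]
  intro τ
  have h1 := (h.differentiableAt_voronoiKernel hd κ (z := c + τ * I) (by simpa using hc)).continuousAt
  exact ContinuousAt.comp (f := fun τ : ℝ => (c + τ * I : ℂ)) h1 (by fun_prop)

lemma integrable_voronoiKernel (h : IsCutoff Cd x Y w) (hd : d ≠ 0) (hκ : |κ| ≤ 3) {c : ℝ}
    (hc : 0 < c) (hc' : c ≤ 3 / 2) :
    Integrable fun τ : ℝ => voronoiKernel d w κ (c + τ * I) := by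
  obtain ⟨M, -, hM⟩ := h.exists_norm_voronoiKernel_le hd hc hc' 2
  exact integrable_of_norm_mul_sq_le (h.continuous_voronoiKernel hd κ hc) (hM κ hκ)

/-- The contour in the definition of `voronoiTransform` may be shifted. -/
lemma voronoiTransform_eq (h : IsCutoff Cd x Y w) (hd : d ≠ 0) (hκ : |κ| ≤ 3) {c : ℝ} (hc : 0 < c)
    (hc' : c ≤ 3 / 2) {y : ℝ} (hy : 0 < y) :
    voronoiTransform d w κ y = 1 / (2 * Real.pi) * ∫ τ : ℝ, voronoiKernel d w κ (c + τ * I) *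
      (y : ℂ) ^ (-(c + τ * I : ℂ)) := by
  rcases hc'.eq_or_lt with rfl | hlt
  · rfl
  rw [voronoiTransform]
  congr 1
  set m : ℝ := (c + 3 / 2) / 2 with hm
  set a : ℝ := (3 / 2 - c) / 2 with ha
  have ha0 : 0 < a := by rw [ha]; linarith
  have hy0 : (y : ℂ) ≠ 0 := by exact_mod_cast hy.ne'
  set g : ℂ → ℂ := fun z => (z - m) ^ 3 * (voronoiKernel d w κ z * (y : ℂ) ^ (-z)) with hg
  have hdg : ∀ z : ℂ, 0 < z.re → DifferentiableAt ℂ g z := fun z hz => by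
    have h1 := h.differentiableAt_voronoiKernel hd κ hz
    have h2 : DifferentiableAt ℂ (fun z : ℂ => (y : ℂ) ^ (-z)) z :=
      differentiableAt_id.neg.const_cpow (Or.inl hy0)
    fun_prop
  have hma : ∀ z : ℂ, m - a ≤ z.re → z.re ≤ m + a → c ≤ z.re ∧ z.re ≤ 3 / 2 := fun z h1 h2 =>
    ⟨by rw [hm, ha] at h1; linarith, by rw [hm, ha] at h2; linarith⟩
  have hyb : ∀ z : ℂ, c ≤ z.re → z.re ≤ 3 / 2 →
      ‖(y : ℂ) ^ (-z)‖ ≤ y ^ (-c) + y ^ (-(3 / 2) : ℝ) := fun z h1 h2 => by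
    rw [norm_cpow_eq_rpow_re_of_pos hy, neg_re]
    have e1 := Real.rpow_nonneg hy.le (-c)
    have e2 := Real.rpow_nonneg hy.le (-(3 / 2))
    rcases le_total y 1 with hy1 | hy1
    · have := Real.rpow_le_rpow_of_exponent_ge hy hy1 (neg_le_neg h2)
      linarith
    · have := Real.rpow_le_rpow_of_exponent_le hy1 (neg_le_neg h1)
      linarith
  have hzm : ∀ z : ℂ, c ≤ z.re → z.re ≤ 3 / 2 → ‖z - m‖ ≤ 2 * (1 + |z.im|) := fun z h1 h2 => by
    refine (norm_le_abs_re_add_abs_im _).trans ?_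
    have : |(z - m).re| ≤ 2 := by
      rw [abs_le, hm]
      constructor <;> simp <;> linarith
    simp only [sub_im, ofReal_im, sub_zero]
    linarith [abs_nonneg z.im]
  obtain ⟨M₁, hM₁0, hM₁⟩ := h.exists_norm_voronoiKernel_le hd hc hc' 3
  obtain ⟨M₂, hM₂0, hM₂⟩ := h.exists_norm_voronoiKernel_le hd (c := 3 / 2) (by norm_num) le_rfl 3
  set B := y ^ (-c) + y ^ (-(3 / 2) : ℝ) with hB
  have hB0 : 0 ≤ B := by positivity
  have hedge : ∀ z : ℂ, (z.re = c ∨ z.re = 3 / 2) → ‖g z‖ ≤ 8 * (M₁ + M₂) * B := fun z hz => by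
    have h1 : c ≤ z.re := by rcases hz with h | h <;> rw [h]; linarith
    have h2 : z.re ≤ 3 / 2 := by rcases hz with h | h <;> rw [h]; linarith
    have h3 : ‖voronoiKernel d w κ z‖ * (1 + |z.im|) ^ 3 ≤ M₁ + M₂ := by
      rcases hz with h | h
      · have := hM₁ κ hκ z.im
        rw [← h, re_add_im] at this
        linarith
      · have := hM₂ κ hκ z.im
        rw [← h, re_add_im] at this
        linarith
    simp only [hg, norm_mul, norm_pow]
    calc _ ≤ (2 * (1 + |z.im|)) ^ 3 * (‖voronoiKernel d w κ z‖ * B) := by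
          gcongr
          · exact hzm z h1 h2
          · exact hyb z h1 h2
      _ = 8 * (‖voronoiKernel d w κ z‖ * (1 + |z.im|) ^ 3) * B := by ring
      _ ≤ _ := by gcongr
  obtain ⟨K, hK0, hK⟩ := exists_norm_dualGamma_le_exp hc (b := 3 / 2) (by norm_num)
  obtain ⟨W, hW0, hW⟩ := h.exists_norm_mellinDeriv_le (-(1 / 2)) 1 3
  have hd1 : (1 : ℝ) ≤ d := by exact_mod_cast Nat.one_le_iff_ne_zero.2 hd
  have hbd : ∀ z : ℂ, m - a ≤ z.re → z.re ≤ m + a → ‖g z‖ ≤ 8 * (M₁ + M₂) * B := by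
    refine norm_le_of_norm_le_on_edges (B := 8 * W * (d : ℝ) ^ 3 * K * B + 6) (by linarith)
      (by rw [ha]; linarith) (fun z h1 h2 => hdg z (hc.trans_le (hma z h1 h2).1)) ?_
      (fun z hz => hedge z (Or.inl (by rw [hz, hm, ha]; ring)))
      (fun z hz => hedge z (Or.inr (by rw [hz, hm, ha]; ring)))
    intro z h1 h2 _
    obtain ⟨h3, h4⟩ := hma z h1 h2
    have h5 : ‖(d : ℂ) ^ (z - 1)‖ ≤ d := by
      rw [norm_natCast_cpow_of_pos (Nat.pos_of_ne_zero hd)]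
      calc (d : ℝ) ^ (z - 1).re ≤ (d : ℝ) ^ (1 : ℝ) :=
            Real.rpow_le_rpow_of_exponent_le hd1 (by simp; linarith)
        _ = d := Real.rpow_one _
    have h6 := hW (1 - z) (by simp; linarith) (by simp; linarith)
    rw [show |(1 - z).im| = |z.im| by simp] at h6
    have h7 := hK κ hκ z h3 h4
    have h8 : 1 ≤ Real.exp |z.im| := Real.one_le_exp (abs_nonneg _)
    have h9 : |z.im| ≤ Real.exp |z.im| := by linarith [Real.add_one_le_exp |z.im|]
    have h10 : 0 ≤ 8 * W * (d : ℝ) ^ 3 * K * B := by positivity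
    simp only [hg, voronoiKernel, norm_mul, norm_pow]
    calc _ ≤ (2 * (1 + |z.im|)) ^ 3 * (‖mellinDeriv w 0 (1 - z)‖ * (d : ℝ) ^ 3 *
          (K * Real.exp (6 * |z.im|)) * B) := by
          gcongr
          · exact hzm z h3 h4
          · exact hyb z h3 h4
      _ = 8 * (‖mellinDeriv w 0 (1 - z)‖ * (1 + |z.im|) ^ 3) * (d : ℝ) ^ 3 *
          (K * Real.exp (6 * |z.im|)) * B := by ring
      _ ≤ 8 * W * (d : ℝ) ^ 3 * (K * Real.exp (6 * |z.im|)) * B := by gcongr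
      _ = 8 * W * (d : ℝ) ^ 3 * K * B * Real.exp (6 * |z.im|) := by ring
      _ ≤ Real.exp (8 * W * (d : ℝ) ^ 3 * K * B) * Real.exp (6 * |z.im|) := by
          gcongr; linarith [Real.add_one_le_exp (8 * W * (d : ℝ) ^ 3 * K * B)]
      _ ≤ _ := by
          rw [← Real.exp_add]
          refine Real.exp_le_exp.2 ?_
          nlinarith
  have key := integral_vertical_sub_eq_of_bounded (g := g) (m := m) (a := a) ha0 (fun z h1 h2 => by
    have hz := hc.trans_le (hma z h1 h2).1
    rw [analyticAt_iff_eventually_differentiableAt]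
    filter_upwards [(isOpen_lt continuous_const continuous_re).mem_nhds hz] with v hv
    exact hdg v hv) hbd
  have hder : iteratedDeriv 2 g m = 0 := by
    refine iteratedDeriv_two_pow_three_mul ?_
    rw [analyticAt_iff_eventually_differentiableAt]
    have hm0 : 0 < (m : ℂ).re := by rw [ofReal_re, hm]; linarith
    filter_upwards [(isOpen_lt continuous_const continuous_re).mem_nhds hm0] with v hv
    exact (h.differentiableAt_voronoiKernel hd κ hv).mul
      (differentiableAt_id.neg.const_cpow (Or.inl hy0))
  rw [hder, mul_zero, sub_eq_zero] at key
  have haux : ∀ {b r : ℝ}, b = m + r → r ≠ 0 → ∀ τ : ℝ,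
      g ((m + r : ℝ) + τ * I) / (r + τ * I : ℂ) ^ 3 =
      voronoiKernel d w κ (b + τ * I) * (y : ℂ) ^ (-(b + τ * I : ℂ)) := by
    rintro b r rfl hr τ
    have h0 : (r + τ * I : ℂ) ≠ 0 := fun h0 => hr (by simpa using congrArg re h0)
    simp only [hg]
    rw [div_eq_iff (pow_ne_zero _ h0),
      show ((m + r : ℝ) + τ * I : ℂ) - m = r + τ * I by push_cast; ring]
    ring
  have e1 : (3 / 2 : ℝ) = m + a := by rw [hm, ha]; ring
  have e2 : c = m + -a := by rw [hm, ha]; ring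
  simp only [haux e1 ha0.ne', haux e2 (neg_ne_zero.2 ha0.ne')] at key
  exact key

end IsCutoff

end

section

open Complex MeasureTheory

lemma integrable_mul_LFunction {N : ℕ} [NeZero N] {φ : ℝ → ℂ} (hφ : Integrable φ)
    (Φ : ZMod N → ℂ) {c : ℝ} (hc : 1 < c) :
    Integrable fun τ : ℝ => φ τ * ZMod.LFunction Φ (c + τ * I) := by
  obtain ⟨M, -, hM⟩ := exists_norm_LFunction_le_of_one_lt Φ hc
  refine hφ.mul_bdd (c := M) (Continuous.aestronglyMeasurable ?_)
    (Filter.Eventually.of_forall fun τ => hM _ (by simp))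
  rw [continuous_iff_continuousAt]
  intro τ
  have h1 : (c + τ * I : ℂ) ≠ 1 := fun h0 => hc.ne' (by simpa using congrArg re h0)
  exact ContinuousAt.comp (f := fun τ : ℝ => (c + τ * I : ℂ))
    (ZMod.differentiableAt_LFunction Φ _ (Or.inl h1)).continuousAt (by fun_prop)

/-- The combined sign of three archimedean factors. -/
noncomputable def signSum (σ : ℤˣ × ℤˣ × ℤˣ) : ℝ :=
  ((σ.1 : ℤ) : ℝ) + ((σ.2.1 : ℤ) : ℝ) + ((σ.2.2 : ℤ) : ℝ)

lemma abs_signSum_le (σ : ℤˣ × ℤˣ × ℤˣ) : |signSum σ| ≤ 3 := by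
  have h : ∀ u : ℤˣ, |((u : ℤ) : ℝ)| ≤ 1 := fun u => by
    rcases Int.units_eq_one_or u with rfl | rfl <;> simp
  rw [signSum]
  refine (abs_add_three _ _ _).trans ?_
  linarith [h σ.1, h σ.2.1, h σ.2.2]

lemma sum_units_mul_three (f g k : ℤˣ → ℂ) :
    (∑ σ, f σ) * (∑ σ, g σ) * (∑ σ, k σ) =
      ∑ σ : ℤˣ × ℤˣ × ℤˣ, f σ.1 * g σ.2.1 * k σ.2.2 := by
  rw [Finset.sum_mul_sum, Finset.sum_mul]
  simp_rw [Fintype.sum_prod_type, Finset.sum_mul, Finset.mul_sum]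

namespace IsCutoff
variable {Cd : ℕ → ℝ} {x Y : ℝ} {w : ℝ → ℝ} {d : ℕ}

/-- Mellin inversion for the cutoff at natural numbers. -/
lemma integral_mellinDeriv_mul_cpow (h : IsCutoff Cd x Y w) (n : ℕ) :
    ∫ τ : ℝ, mellinDeriv w 0 ((5 / 2 : ℝ) + τ * I) * (n : ℂ) ^ (-((5 / 2 : ℝ) + τ * I : ℂ)) =
      2 * Real.pi * (w n : ℂ) := by
  rcases Nat.eq_zero_or_pos n with rfl | hn
  · have h1 : ∀ τ : ℝ, (0 : ℂ) ^ (-((5 / 2 : ℝ) + τ * I : ℂ)) = 0 := fun τ =>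
      zero_cpow fun h0 => by
        have := congrArg re h0
        norm_num at this
    have h2 : w 0 = 0 := h.left 0 le_rfl (by linarith [h.one_le])
    simp only [Nat.cast_zero, h1, h2]
    simp
  have hn0 : (0 : ℝ) < n := by exact_mod_cast hn
  have h1 := mellinInv_mellin_eq (5 / 2) (fun t => (w t : ℂ)) hn0 (by
      have := h.mellinConvergent 0 ((5 / 2 : ℝ) : ℂ)
      simpa [iteratedDeriv_zero] using this)
    (by
      obtain ⟨M, -, hM⟩ := h.exists_norm_mellinDeriv_le (5 / 2) (5 / 2) 2
      have h3 : Continuous fun τ : ℝ => mellinDeriv w 0 ((5 / 2 : ℝ) + τ * I) :=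
        (h.differentiable_mellinDeriv 0).continuous.comp (by fun_prop)
      have := integrable_of_norm_mul_sq_le h3 fun τ => by
        have := hM ((5 / 2 : ℝ) + τ * I) (by simp) (by simp)
        simpa using this
      simpa only [VerticalIntegrable, mellinDeriv, iteratedDeriv_zero] using this)
    (by have := h.contDiff.continuous; fun_prop)
  rw [mellinInv] at h1
  have h2 : ((n : ℝ) : ℂ) = n := by simp
  simp only [mellinDeriv, iteratedDeriv_zero]
  rw [← h1, h2]
  simp only [smul_eq_mul, Complex.real_smul]
  rw [← mul_assoc]
  have : (2 * Real.pi * ((1 / (2 * Real.pi) : ℝ) : ℂ) : ℂ) = 1 := by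
    push_cast
    field_simp [Real.pi_ne_zero]
  rw [this, one_mul]
  congr 1
  ext τ
  ring

/-- The Voronoi summation formula for `d₃` twisted by periodic functions. -/
theorem hasSum_voronoi [NeZero d] (h : IsCutoff Cd x Y w) (Φ₁ Φ₂ Φ₃ : ZMod d → ℂ) {S : ℂ}
    (hS : HasSum (fun p : ℕ × ℕ × ℕ => Φ₁ p.1 * Φ₂ p.2.1 * Φ₃ p.2.2 *
      (w (p.1 * p.2.1 * p.2.2 : ℕ) : ℂ)) S) :
    HasSum (fun p : ℕ × ℕ × ℕ => ∑ σ : ℤˣ × ℤˣ × ℤˣ,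
        ZMod.dft Φ₁ (((σ.1 : ℤ) : ZMod d) * p.1) * ZMod.dft Φ₂ (((σ.2.1 : ℤ) : ZMod d) * p.2.1) *
          ZMod.dft Φ₃ (((σ.2.2 : ℤ) : ZMod d) * p.2.2) *
          voronoiTransform d w (signSum σ) (p.1 * p.2.1 * p.2.2 : ℕ))
      (S - iteratedDeriv 2 (entireProduct Φ₁ Φ₂ Φ₃ w) 1 / 2) := by
  have hd : d ≠ 0 := NeZero.ne d
  have hpi : (Real.pi : ℂ) ≠ 0 := by exact_mod_cast Real.pi_ne_zero
  have hφ : Integrable fun τ : ℝ => mellinDeriv w 0 ((5 / 2 : ℝ) + τ * I) := by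
    obtain ⟨M, -, hM⟩ := h.exists_norm_mellinDeriv_le (5 / 2) (5 / 2) 2
    exact integrable_of_norm_mul_sq_le
      ((h.differentiable_mellinDeriv 0).continuous.comp (by fun_prop)) fun τ => by
        simpa using hM ((5 / 2 : ℝ) + τ * I) (by simp) (by simp)
  have h1 := hasSum_integral_mul_LFunction Φ₁ Φ₂ Φ₃ hφ (c := 5 / 2) (by norm_num)
  simp only [h.integral_mellinDeriv_mul_cpow] at h1
  have h2 := h1.unique ((hS.mul_left (2 * Real.pi : ℂ)).congr_fun fun p => by ring)
  have h3 := h.integral_mul_LFunction_sub_eq Φ₁ Φ₂ Φ₃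
  rw [h2] at h3
  set Ψ : (ZMod d → ℂ) → ℤˣ → ZMod d → ℂ := fun Φ σ j =>
    ZMod.dft Φ (((σ : ℤ) : ZMod d) * j) with hΨ
  have h4 : ∫ τ : ℝ, mellinDeriv w 0 ((-(1 / 2) : ℝ) + τ * I) *
        (ZMod.LFunction Φ₁ ((-(1 / 2) : ℝ) + τ * I) * ZMod.LFunction Φ₂ ((-(1 / 2) : ℝ) + τ * I) *
          ZMod.LFunction Φ₃ ((-(1 / 2) : ℝ) + τ * I)) =
      ∑ σ : ℤˣ × ℤˣ × ℤˣ, ∫ τ : ℝ, voronoiKernel d w (signSum σ) ((3 / 2 : ℝ) + τ * I) *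
        (ZMod.LFunction (Ψ Φ₁ σ.1) ((3 / 2 : ℝ) + τ * I) *
          ZMod.LFunction (Ψ Φ₂ σ.2.1) ((3 / 2 : ℝ) + τ * I) *
          ZMod.LFunction (Ψ Φ₃ σ.2.2) ((3 / 2 : ℝ) + τ * I)) := by
    rw [← integral_neg_eq_self, ← integral_finsetSum]
    · congr 1
      ext τ
      set z : ℂ := (3 / 2 : ℝ) + τ * I with hz
      have hz1 : ((-(1 / 2) : ℝ) : ℂ) + ((-τ : ℝ) : ℂ) * I = 1 - z := by
        rw [hz]; push_cast; ring
      have hz2 : 1 < z.re := by rw [hz]; simp; norm_num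
      rw [hz1, LFunction_one_sub_eq_sum_units Φ₁ hz2, LFunction_one_sub_eq_sum_units Φ₂ hz2,
        LFunction_one_sub_eq_sum_units Φ₃ hz2]
      have e1 : ∀ a b c s₁ s₂ s₃ : ℂ, a * (b * c * s₁ * (b * c * s₂) * (b * c * s₃)) =
          a * b ^ 3 * c ^ 3 * (s₁ * s₂ * s₃) := fun a b c s₁ s₂ s₃ => by ring
      rw [e1, sum_units_mul_three, Finset.mul_sum]
      refine Finset.sum_congr rfl fun σ _ => ?_
      have e2 : cexp (signSum σ * (Real.pi * I * z / 2)) =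
          cexp (((σ.1 : ℤ) : ℂ) * (Real.pi * I * z / 2)) *
          cexp (((σ.2.1 : ℤ) : ℂ) * (Real.pi * I * z / 2)) *
          cexp (((σ.2.2 : ℤ) : ℂ) * (Real.pi * I * z / 2)) := by
        rw [← exp_add, ← exp_add, signSum]
        push_cast
        ring_nf
      rw [voronoiKernel, dualGamma, e2]
      ring
    · intro σ _
      have h5 := h.integrable_voronoiKernel hd (abs_signSum_le σ) (c := 3 / 2) (by norm_num) le_rfl
      have h6 := integrable_mul_LFunction (integrable_mul_LFunction (integrable_mul_LFunction h5
        (Ψ Φ₁ σ.1) (c := 3 / 2) (by norm_num)) (Ψ Φ₂ σ.2.1) (c := 3 / 2) (by norm_num))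
        (Ψ Φ₃ σ.2.2) (c := 3 / 2) (by norm_num)
      simpa only [mul_assoc] using h6
  have h5 := hasSum_sum (s := Finset.univ) fun (σ : ℤˣ × ℤˣ × ℤˣ) _ =>
    hasSum_integral_mul_LFunction (Ψ Φ₁ σ.1) (Ψ Φ₂ σ.2.1) (Ψ Φ₃ σ.2.2)
      (h.integrable_voronoiKernel hd (abs_signSum_le σ) (c := 3 / 2) (by norm_num) le_rfl)
      (c := 3 / 2) (by norm_num)
  rw [← h4] at h5
  have h6 := h5.mul_left (1 / (2 * Real.pi : ℂ))
  have h7 : S - iteratedDeriv 2 (entireProduct Φ₁ Φ₂ Φ₃ w) 1 / 2 = 1 / (2 * Real.pi : ℂ) *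
      ∫ τ : ℝ, mellinDeriv w 0 ((-(1 / 2) : ℝ) + τ * I) *
        (ZMod.LFunction Φ₁ ((-(1 / 2) : ℝ) + τ * I) * ZMod.LFunction Φ₂ ((-(1 / 2) : ℝ) + τ * I) *
          ZMod.LFunction Φ₃ ((-(1 / 2) : ℝ) + τ * I)) := by
    rw [eq_comm, ← sub_eq_iff_eq_add'.2 (sub_eq_iff_eq_add.1 h3)]
    field_simp
  rw [h7]
  refine h6.congr_fun fun p => ?_
  rw [Finset.mul_sum]
  refine Finset.sum_congr rfl fun σ _ => ?_
  simp only [hΨ, voronoiTransform]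
  push_cast
  ring

end IsCutoff

end

section

open Complex MeasureTheory

/-- The complete exponential sum attached to `d₃` twisted by the additive character `η`. -/
noncomputable def tripleSum {d : ℕ} [NeZero d] (η u v t : ZMod d) : ℂ :=
  ∑ τ : ZMod d × ZMod d × ZMod d,
    ZMod.stdAddChar (η * (τ.1 * τ.2.1 * τ.2.2) - τ.1 * u - τ.2.1 * v - τ.2.2 * t)

lemma e_eq_stdAddChar {d : ℕ} [NeZero d] (n h : ℕ) :
    e ((n : ℝ) * h / d) = ZMod.stdAddChar ((h : ZMod d) * (n : ZMod d)) := by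
  have := ZMod.stdAddChar_coe (N := d) ((h * n : ℕ) : ℤ)
  push_cast at this
  rw [this, e]
  push_cast
  ring_nf

lemma dft_single {d : ℕ} [NeZero d] (α k : ZMod d) :
    ZMod.dft (Pi.single α (1 : ℂ)) k = ZMod.stdAddChar (-(α * k)) := by
  rw [ZMod.dft_apply, Finset.sum_eq_single α]
  · simp
  · intro j _ hj; simp [hj]
  · simp

lemma tripleSum_eq {d : ℕ} [NeZero d] (η u v t : ZMod d) :
    tripleSum η u v t = ∑ τ : ZMod d × ZMod d × ZMod d,
      ZMod.stdAddChar (η * (τ.1 * τ.2.1 * τ.2.2)) * (ZMod.dft (Pi.single τ.1 (1 : ℂ)) u *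
        ZMod.dft (Pi.single τ.2.1 (1 : ℂ)) v * ZMod.dft (Pi.single τ.2.2 (1 : ℂ)) t) := by
  simp only [tripleSum, dft_single, ← AddChar.map_add_eq_mul]
  refine Finset.sum_congr rfl fun τ _ => ?_
  ring_nf

lemma sum_stdAddChar_mul_single {d : ℕ} [NeZero d] (η a b c : ZMod d) :
    ∑ τ : ZMod d × ZMod d × ZMod d, ZMod.stdAddChar (η * (τ.1 * τ.2.1 * τ.2.2)) *
        ((Pi.single τ.1 (1 : ℂ) : ZMod d → ℂ) a * (Pi.single τ.2.1 (1 : ℂ) : ZMod d → ℂ) b *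
          (Pi.single τ.2.2 (1 : ℂ) : ZMod d → ℂ) c) =
      ZMod.stdAddChar (η * (a * b * c)) := by
  rw [Finset.sum_eq_single (a, b, c)]
  · simp
  · rintro ⟨α, β, γ⟩ _ hne
    have : ¬ (a = α ∧ b = β ∧ c = γ) := fun ⟨h1, h2, h3⟩ => hne (by rw [h1, h2, h3])
    by_cases h1 : a = α
    · by_cases h2 : b = β
      · have h3 : c ≠ γ := fun h3 => this ⟨h1, h2, h3⟩
        simp [Pi.single_apply, h3]
      · simp [Pi.single_apply, h2]
    · simp [Pi.single_apply, h1]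
  · simp

namespace IsCutoff
variable {Cd : ℕ → ℝ} {x Y : ℝ} {w : ℝ → ℝ} {d : ℕ}

lemma summable_mul_cutoff (h : IsCutoff Cd x Y w) (f : ℕ × ℕ × ℕ → ℂ) :
    Summable fun p : ℕ × ℕ × ℕ => f p * (w (p.1 * p.2.1 * p.2.2 : ℕ) : ℂ) := by
  set N := ⌈x⌉₊
  refine summable_of_ne_finset_zero (s := Finset.range (N + 1) ×ˢ Finset.range (N + 1) ×ˢ
    Finset.range (N + 1)) fun p hp => ?_
  suffices hw : w (p.1 * p.2.1 * p.2.2 : ℕ) = 0 by rw [hw, ofReal_zero, mul_zero]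
  by_cases h0 : p.1 * p.2.1 * p.2.2 = 0
  · rw [h0]
    exact h.left _ (by simp) (by simp; linarith [h.one_le])
  · refine h.right _ ?_
    have hpos := Nat.pos_of_ne_zero h0
    have h1 : N ≤ p.1 * p.2.1 * p.2.2 := by
      by_contra! hlt
      refine hp ?_
      simp only [Finset.mem_product, Finset.mem_range]
      have d1 : p.1 ∣ p.1 * p.2.1 * p.2.2 := ⟨p.2.1 * p.2.2, by ring⟩
      have d2 : p.2.1 ∣ p.1 * p.2.1 * p.2.2 := ⟨p.1 * p.2.2, by ring⟩
      have d3 : p.2.2 ∣ p.1 * p.2.1 * p.2.2 := ⟨p.1 * p.2.1, by ring⟩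
      have := Nat.le_of_dvd hpos d1
      have := Nat.le_of_dvd hpos d2
      have := Nat.le_of_dvd hpos d3
      omega
    exact (Nat.le_ceil x).trans (by exact_mod_cast h1)

lemma mellinDeriv_zero_eq (w : ℝ → ℝ) (s : ℂ) :
    mellinDeriv w 0 s = ∫ t in Set.Ioi (0 : ℝ), (w t : ℂ) * (t : ℂ) ^ (s - 1) := by
  simp only [mellinDeriv, mellin, iteratedDeriv_zero, smul_eq_mul]
  congr 1
  ext t
  ring

/-- The residue of the twisted Dirichlet series in terms of Hurwitz-type `L`-functions. -/
lemma iteratedDeriv_eq_sum_entireProduct [NeZero d] (hw : IsCutoff Cd x Y w) {h : ℕ}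
    {E : ℂ → ℂ} {g : ℂ → ℂ} (hg : AnalyticAt ℂ g 1)
    (hE : ∀ s : ℂ, 1 < s.re →
      HasSum (fun n : ℕ => (d3 n : ℂ) * e ((n : ℝ) * h / d) / (n : ℂ) ^ s) (E s))
    (hgE : ∀ᶠ s in nhdsWithin (1 : ℂ) {(1 : ℂ)}ᶜ, g s = (s - 1) ^ 3 * E s *
      ∫ t in Set.Ioi (0 : ℝ), (w t : ℂ) * (t : ℂ) ^ (s - 1)) :
    iteratedDeriv 2 g 1 = ∑ τ : ZMod d × ZMod d × ZMod d,
      ZMod.stdAddChar ((h : ZMod d) * (τ.1 * τ.2.1 * τ.2.2)) *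
        iteratedDeriv 2 (entireProduct (Pi.single τ.1 (1 : ℂ)) (Pi.single τ.2.1 (1 : ℂ))
          (Pi.single τ.2.2 (1 : ℂ)) w) 1 := by
  set G : ℂ → ℂ := fun s => ∑ τ : ZMod d × ZMod d × ZMod d,
      ZMod.stdAddChar ((h : ZMod d) * (τ.1 * τ.2.1 * τ.2.2)) *
        entireProduct (Pi.single τ.1 (1 : ℂ)) (Pi.single τ.2.1 (1 : ℂ))
          (Pi.single τ.2.2 (1 : ℂ)) w s with hG
  have hGd : Differentiable ℂ G := by
    refine Differentiable.fun_sum fun τ _ => ?_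
    exact (hw.differentiable_entireProduct _ _ _).const_mul _
  have hGE : ∀ s : ℂ, 1 < s.re → G s = (s - 1) ^ 3 * E s * mellinDeriv w 0 s := by
    intro s hs
    have hs1 : s ≠ 1 := by rintro rfl; simp at hs
    have hs0 : s ≠ 0 := by rintro rfl; norm_num at hs
    have h1 := hasSum_sum (s := Finset.univ) fun (τ : ZMod d × ZMod d × ZMod d) _ =>
      (hasSum_mul_LFunction (Pi.single τ.1 (1 : ℂ)) (Pi.single τ.2.1 (1 : ℂ))
        (Pi.single τ.2.2 (1 : ℂ)) hs).mul_left
          (ZMod.stdAddChar ((h : ZMod d) * (τ.1 * τ.2.1 * τ.2.2)))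
    have h2 := hasSum_d3_mul (f := fun n => e ((n : ℝ) * h / d) * (n : ℂ) ^ (-s))
      (by simp [hs0]) (h1.congr_fun fun p => by
        rw [e_eq_stdAddChar, Nat.cast_mul, Nat.cast_mul, ← sum_stdAddChar_mul_single,
          Finset.sum_mul]
        refine Finset.sum_congr rfl fun τ _ => ?_
        push_cast
        ring)
    have h3 := (h2.congr_fun fun n => by rw [cpow_neg, div_eq_mul_inv, mul_assoc]).unique (hE s hs)
    rw [← h3, hG, Finset.mul_sum, Finset.sum_mul]
    refine Finset.sum_congr rfl fun τ _ => ?_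
    simp only [entireProduct, entireLFunction_of_ne _ hs1]
    ring
  have hGan : AnalyticAt ℂ G 1 := hGd.analyticAt 1
  have hfreq : ∃ᶠ s in nhdsWithin (1 : ℂ) {(1 : ℂ)}ᶜ, g s = G s := by
    have h1 : ∃ᶠ s in nhdsWithin (1 : ℂ) {(1 : ℂ)}ᶜ, 1 < s.re := by
      have ht : Filter.Tendsto (fun n : ℕ => (1 + 1 / ((n : ℂ) + 1))) Filter.atTop
          (nhdsWithin (1 : ℂ) {(1 : ℂ)}ᶜ) := by
        refine tendsto_nhdsWithin_iff.2 ⟨?_, Filter.Eventually.of_forall fun n => ?_⟩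
        · simpa using (tendsto_one_div_add_atTop_nhds_zero_nat (𝕜 := ℂ)).const_add 1
        · simp only [Set.mem_compl_iff, Set.mem_singleton_iff, add_eq_left]
          exact one_div_ne_zero (Nat.cast_add_one_ne_zero n)
      refine ht.frequently (Filter.Frequently.of_forall fun n => ?_)
      have : (1 + 1 / ((n : ℂ) + 1)) = ((1 + 1 / ((n : ℝ) + 1) : ℝ) : ℂ) := by push_cast; rfl
      rw [this, ofReal_re]
      have : 0 < 1 / ((n : ℝ) + 1) := by positivity
      linarith
    refine (h1.and_eventually hgE).mono fun s ⟨hs, hgs⟩ => ?_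
    rw [hgs, hGE s hs, mellinDeriv_zero_eq]
  have heq := (hg.frequently_eq_iff_eventually_eq hGan).1 hfreq
  rw [Filter.EventuallyEq.iteratedDeriv_eq 2 heq, hG, ← iteratedDerivWithin_univ,
    iteratedDerivWithin_fun_sum (Set.mem_univ _) uniqueDiffOn_univ]
  · refine Finset.sum_congr rfl fun τ _ => ?_
    rw [iteratedDerivWithin_univ]
    exact iteratedDeriv_const_mul_field _ _
  · intro τ _
    exact ((hw.differentiable_entireProduct _ _ _).const_mul _).contDiff.contDiffAt.contDiffWithinAt

/-- The dual expansion of the error term for the additive character `h/d`. -/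
theorem hasSum_error [NeZero d] (hw : IsCutoff Cd x Y w) {h : ℕ}
    {E : ℂ → ℂ} {g : ℂ → ℂ} (hg : AnalyticAt ℂ g 1)
    (hE : ∀ s : ℂ, 1 < s.re →
      HasSum (fun n : ℕ => (d3 n : ℂ) * e ((n : ℝ) * h / d) / (n : ℂ) ^ s) (E s))
    (hgE : ∀ᶠ s in nhdsWithin (1 : ℂ) {(1 : ℂ)}ᶜ, g s = (s - 1) ^ 3 * E s *
      ∫ t in Set.Ioi (0 : ℝ), (w t : ℂ) * (t : ℂ) ^ (s - 1)) :
    HasSum (fun p : ℕ × ℕ × ℕ => ∑ σ : ℤˣ × ℤˣ × ℤˣ,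
        tripleSum (h : ZMod d) (((σ.1 : ℤ) : ZMod d) * p.1) (((σ.2.1 : ℤ) : ZMod d) * p.2.1)
          (((σ.2.2 : ℤ) : ZMod d) * p.2.2) *
          voronoiTransform d w (signSum σ) (p.1 * p.2.1 * p.2.2 : ℕ))
      ((∑' n : ℕ, (d3 n : ℂ) * e ((n : ℝ) * h / d) * (w n : ℂ)) - iteratedDeriv 2 g 1 / 2) := by
  have hS := fun τ : ZMod d × ZMod d × ZMod d => (hw.summable_mul_cutoff fun p =>
    (Pi.single τ.1 (1 : ℂ) : ZMod d → ℂ) p.1 * (Pi.single τ.2.1 (1 : ℂ) : ZMod d → ℂ) p.2.1 *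
      (Pi.single τ.2.2 (1 : ℂ) : ZMod d → ℂ) p.2.2).hasSum
  have h1 := hasSum_sum (s := Finset.univ) fun (τ : ZMod d × ZMod d × ZMod d) _ =>
    (hS τ).mul_left (ZMod.stdAddChar ((h : ZMod d) * (τ.1 * τ.2.1 * τ.2.2)))
  have hw0 : w 0 = 0 := hw.left 0 le_rfl (by linarith [hw.one_le])
  have h2 := hasSum_d3_mul (f := fun n => e ((n : ℝ) * h / d) * (w n : ℂ))
    (by simp [hw0]) (h1.congr_fun fun p => by
      rw [e_eq_stdAddChar, Nat.cast_mul, Nat.cast_mul, ← sum_stdAddChar_mul_single,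
        Finset.sum_mul]
      refine Finset.sum_congr rfl fun τ _ => ?_
      push_cast
      ring)
  have h3 := hasSum_sum (s := Finset.univ) fun (τ : ZMod d × ZMod d × ZMod d) _ =>
    (hw.hasSum_voronoi _ _ _ (hS τ)).mul_left
      (ZMod.stdAddChar ((h : ZMod d) * (τ.1 * τ.2.1 * τ.2.2)))
  have h4 := (h2.congr_fun (g := fun n : ℕ => (d3 n : ℂ) * e ((n : ℝ) * h / d) * (w n : ℂ))
    fun n => by rw [mul_assoc]).tsum_eq
  rw [hw.iteratedDeriv_eq_sum_entireProduct hg hE hgE]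
  rw [h4, Finset.sum_div, ← Finset.sum_sub_distrib]
  have h6 := h3.congr_fun (g := fun p : ℕ × ℕ × ℕ => ∑ σ : ℤˣ × ℤˣ × ℤˣ,
        tripleSum (h : ZMod d) (((σ.1 : ℤ) : ZMod d) * p.1) (((σ.2.1 : ℤ) : ZMod d) * p.2.1)
          (((σ.2.2 : ℤ) : ZMod d) * p.2.2) *
          voronoiTransform d w (signSum σ) (p.1 * p.2.1 * p.2.2 : ℕ)) fun p => by
    simp only [tripleSum_eq, Finset.sum_mul, Finset.mul_sum]
    rw [Finset.sum_comm]
    refine Finset.sum_congr rfl fun τ _ => Finset.sum_congr rfl fun σ _ => ?_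
    ring
  simp only [mul_sub, ← mul_div_assoc] at h6
  exact h6

end IsCutoff

end

section

open ZMod

lemma norm_sum_sq_le_card_mul {ι : Type*} (s : Finset ι) (a : ι → ℂ) :
    ‖∑ i ∈ s, a i‖ ^ 2 ≤ s.card * ∑ i ∈ s, ‖a i‖ ^ 2 :=
  (pow_le_pow_left₀ (norm_nonneg _) (norm_sum_le _ _) 2).trans sq_sum_le_card_mul_sum_sq

/-- A weighted form of the Cauchy–Schwarz inequality. -/
lemma norm_sum_sq_le_of_weight {ι : Type*} (s : Finset ι) (a : ι → ℂ) {κ : ι → ℝ}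
    (hκ : ∀ i ∈ s, 0 < κ i) {B : ℝ} (hB : ∑ i ∈ s, (κ i)⁻¹ ≤ B) :
    ‖∑ i ∈ s, a i‖ ^ 2 ≤ B * ∑ i ∈ s, κ i * ‖a i‖ ^ 2 := by
  have h0 : 0 ≤ ∑ i ∈ s, κ i * ‖a i‖ ^ 2 :=
    Finset.sum_nonneg fun i hi => mul_nonneg (hκ i hi).le (by positivity)
  refine le_trans ?_ (mul_le_mul_of_nonneg_right hB h0)
  refine (pow_le_pow_left₀ (norm_nonneg _) (norm_sum_le _ _) 2).trans ?_
  refine Finset.sum_sq_le_sum_mul_sum_of_sq_le_mul s (fun i hi => (inv_pos.2 (hκ i hi)).le)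
    (fun i hi => mul_nonneg (hκ i hi).le (by positivity)) fun i hi => ?_
  rw [inv_mul_cancel_left₀ (hκ i hi).ne']

section
variable {d : ℕ} [NeZero d]

/-- Parseval's identity for exponential sums to the modulus `d`. -/
lemma sum_norm_sq_sum_mul_stdAddChar {ι : Type*} (s : Finset ι) (a : ι → ℂ) (f : ι → ZMod d) :
    ∑ θ : ZMod d, ‖∑ i ∈ s, a i * stdAddChar (f i * θ)‖ ^ 2 =
      d * ∑ c : ZMod d, ‖∑ i ∈ s with f i = c, a i‖ ^ 2 := by
  set A : ZMod d → ℂ := fun c => ∑ i ∈ s with f i = c, a i with hA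
  have h1 : ∀ θ : ZMod d, ∑ i ∈ s, a i * stdAddChar (f i * θ) =
      ∑ c, A c * stdAddChar (c * θ) := fun θ => by
    rw [← Finset.sum_fiberwise s f]
    refine Finset.sum_congr rfl fun c _ => ?_
    rw [hA, Finset.sum_mul]
    refine Finset.sum_congr rfl fun i hi => ?_
    rw [(Finset.mem_filter.1 hi).2]
  have h2 : ((∑ θ : ZMod d, ‖∑ i ∈ s, a i * stdAddChar (f i * θ)‖ ^ 2 : ℝ) : ℂ) =
      ((d * ∑ c : ZMod d, ‖A c‖ ^ 2 : ℝ) : ℂ) := by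
    push_cast
    simp_rw [h1, ← Complex.mul_conj', map_sum, map_mul, Finset.sum_mul_sum]
    rw [Finset.sum_comm, Finset.mul_sum]
    refine Finset.sum_congr rfl fun c _ => ?_
    rw [Finset.sum_comm]
    have h3 : ∀ c' : ZMod d, ∑ θ : ZMod d, A c * stdAddChar (c * θ) *
        ((starRingEnd ℂ) (A c') * (starRingEnd ℂ) (stdAddChar (c' * θ))) =
        A c * (starRingEnd ℂ) (A c') * if c - c' = 0 then (d : ℂ) else 0 := fun c' => by
      have h4 := AddChar.sum_mulShift (c - c') (isPrimitive_stdAddChar d)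
      rw [ZMod.card] at h4
      push_cast at h4
      rw [← h4, Finset.mul_sum]
      refine Finset.sum_congr rfl fun θ _ => ?_
      rw [← AddChar.map_neg_eq_conj, show θ * (c - c') = c * θ + -(c' * θ) by ring,
        AddChar.map_add_eq_mul]
      ring
    simp_rw [h3, sub_eq_zero]
    simp [mul_comm]
  exact_mod_cast h2

lemma sum_norm_sq_sum_mul_stdAddChar_le {ι : Type*} (s : Finset ι) (a : ι → ℂ) (f : ι → ZMod d)
    {C : ℕ} (hC : ∀ c, (s.filter fun i => f i = c).card ≤ C) :
    ∑ θ : ZMod d, ‖∑ i ∈ s, a i * stdAddChar (f i * θ)‖ ^ 2 ≤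
      d * C * ∑ i ∈ s, ‖a i‖ ^ 2 := by
  rw [sum_norm_sq_sum_mul_stdAddChar, mul_assoc]
  refine mul_le_mul_of_nonneg_left ?_ (by positivity)
  rw [← Finset.sum_fiberwise s f (fun i => ‖a i‖ ^ 2), Finset.mul_sum]
  refine Finset.sum_le_sum fun c _ => (norm_sum_sq_le_card_mul _ _).trans ?_
  gcongr
  exact hC c

/-- The quadratic exponential sum with a bilinear phase. -/
noncomputable def bilinearSum (δ u v : ZMod d) : ℂ :=
  ∑ α : ZMod d, ∑ β : ZMod d, stdAddChar (δ * α * β - α * u - β * v)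

lemma bilinearSum_swap (δ u v : ZMod d) : bilinearSum δ u v = bilinearSum δ v u := by
  rw [bilinearSum, bilinearSum, Finset.sum_comm]
  refine Finset.sum_congr rfl fun α _ => Finset.sum_congr rfl fun β _ => ?_
  ring_nf

lemma bilinearSum_eq (δ u v : ZMod d) :
    bilinearSum δ u v = d * ∑ α : ZMod d with δ * α = v, stdAddChar (-(α * u)) := by
  rw [bilinearSum, Finset.mul_sum, Finset.sum_filter]
  refine Finset.sum_congr rfl fun α _ => ?_
  have h4 := AddChar.sum_mulShift (δ * α - v) (isPrimitive_stdAddChar d)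
  rw [ZMod.card] at h4
  have : ∀ β : ZMod d, stdAddChar (δ * α * β - α * u - β * v) =
      stdAddChar (-(α * u)) * stdAddChar (β * (δ * α - v)) := fun β => by
    rw [← AddChar.map_add_eq_mul]; ring_nf
  simp_rw [this]
  rw [← Finset.mul_sum, h4]
  simp only [sub_eq_zero]
  split_ifs <;> simp [mul_comm]

lemma dvd_of_bilinearSum_ne_zero {δ u v : ZMod d} (h : bilinearSum δ u v ≠ 0) : δ ∣ u ∧ δ ∣ v := by
  have key : ∀ u v : ZMod d, bilinearSum δ u v ≠ 0 → δ ∣ v := fun u v h => by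
    rw [bilinearSum_eq] at h
    obtain ⟨α, hα, -⟩ := Finset.exists_ne_zero_of_sum_ne_zero (right_ne_zero_of_mul h)
    exact ⟨α, (Finset.mem_filter.1 hα).2.symm⟩
  exact ⟨key v u (by rwa [bilinearSum_swap]), key u v h⟩

lemma bilinearSum_mul_mul (δ u v : ZMod d) :
    bilinearSum δ (δ * u) (δ * v) = stdAddChar (-(δ * u * v)) *
      (d * ((Finset.univ.filter fun α : ZMod d => δ * α = 0).card : ℂ)) := by
  have h0 : bilinearSum δ 0 0 =
      d * ((Finset.univ.filter fun α : ZMod d => δ * α = 0).card : ℂ) := by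
    rw [bilinearSum_eq]; simp
  rw [← h0, bilinearSum, bilinearSum, Finset.mul_sum, ← Equiv.sum_comp (Equiv.addRight v)]
  refine Finset.sum_congr rfl fun α _ => ?_
  rw [Finset.mul_sum, ← Equiv.sum_comp (Equiv.addRight u)]
  refine Finset.sum_congr rfl fun β _ => ?_
  rw [← AddChar.map_add_eq_mul, Equiv.coe_addRight, Equiv.coe_addRight]
  ring_nf

lemma card_mul_eq_zero_le (n : ℕ) :
    (Finset.univ.filter fun α : ZMod d => (n : ZMod d) * α = 0).card ≤ n.gcd d := by
  have h1 : ∀ α : ZMod d, (n : ZMod d) * α = 0 ↔ (n.gcd d) • α = 0 := fun α => by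
    rw [← nsmul_eq_mul]
    constructor
    · intro h
      rw [← addOrderOf_dvd_iff_nsmul_eq_zero] at h ⊢
      refine Nat.dvd_gcd h ?_
      have := addOrderOf_dvd_card (x := α)
      rwa [ZMod.card] at this
    · intro h
      obtain ⟨m, hm⟩ := Nat.gcd_dvd_left n d
      conv_lhs => rw [hm, mul_comm, mul_smul, h, smul_zero]
  simp_rw [h1]
  exact IsAddCyclic.card_nsmul_eq_zero_le (Nat.gcd_pos_of_pos_right _ (NeZero.pos d))

lemma card_mul_eq_le (n : ℕ) (c : ZMod d) :
    (Finset.univ.filter fun α : ZMod d => (n : ZMod d) * α = c).card ≤ n.gcd d := by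
  rcases (Finset.univ.filter fun α : ZMod d => (n : ZMod d) * α = c).eq_empty_or_nonempty with h | h
  · rw [h]; simp
  obtain ⟨α₀, hα₀⟩ := h
  rw [Finset.mem_filter] at hα₀
  refine le_trans ?_ (card_mul_eq_zero_le n)
  refine Finset.card_le_card_of_injOn (fun α => α - α₀) (fun α hα => ?_)
    (fun a _ b _ h => by simpa using h)
  simp only [Finset.coe_filter, Finset.mem_univ, true_and, Set.mem_ofPred_eq] at hα ⊢
  rw [mul_sub, hα, hα₀.2, sub_self]

lemma exists_eq_divisor_mul_unit (γ : ZMod d) :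
    ∃ k : ℕ, k ∈ d.divisors ∧ ∃ u : (ZMod d)ˣ, γ = k * u := by
  obtain ⟨g, hg, u, ⟨u, rfl⟩, h⟩ := γ.eq_unit_mul_divisor
  exact ⟨g, Nat.mem_divisors.2 ⟨hg, NeZero.ne d⟩, u, by rw [h, mul_comm]⟩

/-- Averaging a sum over `ZMod d` over the unit group reduces it to divisors of `d`. -/
lemma exists_totient_mul_sum_eq (d : ℕ) [NeZero d] :
    ∃ m : ℕ → ℕ, (∀ g ∈ d.divisors, m g * g ≤ d) ∧ ∀ F : ZMod d → ℂ,
      (d.totient : ℂ) * ∑ γ, F γ = ∑ g ∈ d.divisors, (m g : ℂ) * ∑ μ : (ZMod d)ˣ, F (g * μ) := by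
  have hd := NeZero.ne d
  choose G hG U hU using exists_eq_divisor_mul_unit (d := d)
  refine ⟨fun g => (Finset.univ.filter fun γ => G γ = g).card, fun g hg => ?_, fun F => ?_⟩
  · have hgd := (Nat.mem_divisors.1 hg).1
    have : (Finset.univ.filter fun γ => G γ = g).card ≤ (Finset.range (d / g)).card := by
      refine Finset.card_le_card_of_surjOn (fun i : ℕ => (g : ZMod d) * i) fun γ hγ => ?_
      simp only [Finset.coe_filter, Finset.mem_univ, true_and, Set.mem_ofPred_eq] at hγ
      refine ⟨(U γ : ZMod d).val % (d / g), ?_, ?_⟩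
      · simp only [Finset.coe_range, Set.mem_Iio]
        exact Nat.mod_lt _ (Nat.div_pos (Nat.le_of_dvd (Nat.pos_of_ne_zero hd) hgd)
          (Nat.pos_of_mem_divisors hg))
      · have hγ' : γ = g * (U γ : ZMod d) := by
          rw [← hγ]; exact hU γ
        refine Eq.trans ?_ hγ'.symm
        conv_rhs => rw [← ZMod.natCast_zmod_val (U γ : ZMod d),
          ← Nat.mod_add_div (U γ : ZMod d).val (d / g)]
        have : (g : ZMod d) * ((d / g : ℕ) : ZMod d) = 0 := by
          rw [← Nat.cast_mul, Nat.mul_div_cancel' hgd, ZMod.natCast_self]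
        push_cast
        rw [mul_add, ← mul_assoc (g : ZMod d), this]
        ring
    rw [Finset.card_range] at this
    exact (Nat.mul_le_mul_right g this).trans (Nat.div_mul_le_self d g)
  · have h1 : ∀ μ : (ZMod d)ˣ, ∑ γ, F γ = ∑ γ, F (γ * μ) := fun μ =>
      (Equiv.sum_comp (Units.mulRight μ) F).symm
    have h2 : (d.totient : ℂ) * ∑ γ, F γ = ∑ μ : (ZMod d)ˣ, ∑ γ, F (γ * μ) := by
      simp_rw [← h1]
      rw [Finset.sum_const, Finset.card_univ, ZMod.card_units_eq_totient, nsmul_eq_mul]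
    rw [h2, Finset.sum_comm, ← Finset.sum_fiberwise_of_maps_to (fun γ _ => hG γ)]
    refine Finset.sum_congr rfl fun g _ => ?_
    rw [← nsmul_eq_mul, ← Finset.sum_const]
    refine Finset.sum_congr rfl fun γ hγ => ?_
    rw [← Equiv.sum_comp (Equiv.mulLeft (U γ)) fun μ : (ZMod d)ˣ => F (g * μ)]
    refine Finset.sum_congr rfl fun μ _ => ?_
    have hg := (Finset.mem_filter.1 hγ).2
    have e1 : γ * (μ : ZMod d) = g * (U γ * μ) := by
      conv_lhs => rw [hU γ, hg]
      ring
    rw [e1, Equiv.coe_mulLeft, Units.val_mul]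

end

end

lemma exists_card_divisors_le {ε : ℝ} (hε : 0 < ε) :
    ∃ C : ℝ, 1 ≤ C ∧ ∀ n : ℕ, n ≠ 0 → (n.divisors.card : ℝ) ≤ C * (n : ℝ) ^ ε := by
  have hlog : 0 < Real.log 2 := Real.log_pos (by norm_num)
  set K : ℝ := 1 + 1 / (ε * Real.log 2) with hK
  have hK1 : 1 ≤ K := by rw [hK]; linarith [show 0 < 1 / (ε * Real.log 2) by positivity]
  set P : ℕ := ⌈(2 : ℝ) ^ (1 / ε)⌉₊ with hP
  refine ⟨K ^ P, one_le_pow₀ hK1, fun n hn => ?_⟩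
  have key : ∀ p ∈ n.primeFactors, ((n.factorization p : ℝ) + 1) ≤
      (if p < P then K else 1) * ((p : ℝ) ^ n.factorization p) ^ ε := fun p hp => by
    have hp2 : (2 : ℝ) ≤ p := by exact_mod_cast (Nat.prime_of_mem_primeFactors hp).two_le
    set a := n.factorization p
    rw [← Real.rpow_natCast, ← Real.rpow_mul (by linarith), mul_comm (a : ℝ),
      Real.rpow_mul (by linarith), Real.rpow_natCast]
    split_ifs with h
    · have h1 : (1 : ℝ) + a * (ε * Real.log 2) ≤ ((p : ℝ) ^ ε) ^ a := by
        refine le_trans ?_ (pow_le_pow_left₀ (by positivity)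
          (Real.rpow_le_rpow (by norm_num) hp2 hε.le) a)
        rw [Real.rpow_def_of_pos (by norm_num), ← Real.exp_nat_mul]
        refine le_trans (le_of_eq ?_) (Real.add_one_le_exp _)
        ring
      have h2 : (a : ℝ) + 1 ≤ K * (1 + a * (ε * Real.log 2)) := by
        have : K * (1 + a * (ε * Real.log 2)) = 1 + a + 1 / (ε * Real.log 2) +
            a * (ε * Real.log 2) := by
          rw [hK]; field_simp; ring
        rw [this]
        have : 0 < 1 / (ε * Real.log 2) := by positivity
        have : 0 ≤ a * (ε * Real.log 2) := by positivity
        linarith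
      exact h2.trans (mul_le_mul_of_nonneg_left h1 (by linarith))
    · have h1 : (2 : ℝ) ≤ (p : ℝ) ^ ε := by
        have h3 : (2 : ℝ) ^ (1 / ε) ≤ p := (Nat.le_ceil _).trans (by exact_mod_cast not_lt.1 h)
        have := Real.rpow_le_rpow (by positivity) h3 hε.le
        rwa [← Real.rpow_mul (by norm_num), one_div_mul_cancel hε.ne', Real.rpow_one] at this
      rw [one_mul]
      refine le_trans ?_ (pow_le_pow_left₀ (by norm_num) h1 a)
      exact_mod_cast Nat.lt_two_pow_self
  have h1 : (n.divisors.card : ℝ) = ∏ p ∈ n.primeFactors, ((n.factorization p : ℝ) + 1) := by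
    rw [Nat.card_divisors hn]; push_cast; rfl
  have h2 : (n : ℝ) = ∏ p ∈ n.primeFactors, (p : ℝ) ^ n.factorization p := by
    conv_lhs => rw [← Nat.prod_factorization_pow_eq_self hn, Finsupp.prod]
    push_cast; rfl
  rw [h1, h2, ← Real.finsetProd_rpow _ _ fun p _ => by positivity]
  refine (Finset.prod_le_prod (fun p _ => by positivity) key).trans ?_
  rw [Finset.prod_mul_distrib]
  refine mul_le_mul_of_nonneg_right ?_ (Finset.prod_nonneg fun p _ => by positivity)
  rw [Finset.prod_ite, Finset.prod_const_one, mul_one, Finset.prod_const]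
  refine pow_le_pow_right₀ hK1 ?_
  calc _ ≤ (Finset.range P).card := Finset.card_le_card fun p hp => by
        simp only [Finset.mem_filter] at hp
        exact Finset.mem_range.2 hp.2
    _ = P := Finset.card_range P

lemma d3_le_card_divisors_sq (n : ℕ) : d3 n ≤ n.divisors.card ^ 2 := by
  rcases eq_or_ne n 0 with rfl | hn
  · simp [d3]
  rw [sq, ← Finset.card_product, d3]
  refine Finset.card_le_card_of_injOn (fun p => (p.1, p.2.1)) (fun p hp => ?_)
    fun p hp q hq h => ?_
  · rw [Finset.mem_coe, mem_d3_filter_iff hn] at hp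
    simp only [Finset.coe_product, Set.mem_prod, Finset.mem_coe, Nat.mem_divisors]
    exact ⟨⟨⟨p.2.1 * p.2.2, by rw [← hp]; ring⟩, hn⟩, ⟨⟨p.1 * p.2.2, by rw [← hp]; ring⟩, hn⟩⟩
  · rw [Finset.mem_coe, mem_d3_filter_iff hn] at hp hq
    simp only [Prod.mk.injEq] at h
    have h0 : p.1 * p.2.1 ≠ 0 := fun h => hn (by rw [← hp, h, zero_mul])
    have : p.2.2 = q.2.2 := by
      rw [← hp, ← h.1, ← h.2] at hq
      exact (mul_left_cancel₀ h0 hq).symm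
    exact Prod.ext h.1 (Prod.ext h.2 this)

lemma exists_d3_sq_le {β : ℝ} (hβ : 0 < β) :
    ∃ C : ℝ, 1 ≤ C ∧ ∀ n : ℕ, n ≠ 0 → (d3 n : ℝ) ^ 2 ≤ C * (n : ℝ) ^ β := by
  obtain ⟨C, hC, h⟩ := exists_card_divisors_le (show 0 < β / 4 by positivity)
  refine ⟨C ^ 4, one_le_pow₀ hC, fun n hn => ?_⟩
  have h1 : (d3 n : ℝ) ≤ (n.divisors.card : ℝ) ^ 2 := by exact_mod_cast d3_le_card_divisors_sq n
  calc (d3 n : ℝ) ^ 2 ≤ ((n.divisors.card : ℝ) ^ 2) ^ 2 := pow_le_pow_left₀ (by positivity) h1 2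
    _ = (n.divisors.card : ℝ) ^ 4 := by ring
    _ ≤ (C * (n : ℝ) ^ (β / 4)) ^ 4 := pow_le_pow_left₀ (by positivity) (h n hn) 4
    _ = C ^ 4 * (n : ℝ) ^ β := by
      rw [mul_pow, ← Real.rpow_natCast ((n : ℝ) ^ (β / 4)), ← Real.rpow_mul (by positivity)]
      congr 2; push_cast; ring

lemma le_card_divisors_mul_totient (d : ℕ) : d ≤ d.divisors.card * d.totient := by
  rcases eq_or_ne d 0 with rfl | hd
  · simp
  conv_lhs => rw [← Nat.sum_totient d]
  refine (Finset.sum_le_card_nsmul _ _ d.totient fun k hk => ?_).trans (by simp)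
  exact Nat.le_of_dvd (Nat.totient_pos.2 (Nat.pos_of_ne_zero hd))
    (Nat.totient_dvd_of_dvd (Nat.mem_divisors.1 hk).1)

lemma d3_pos {n : ℕ} (hn : n ≠ 0) : 0 < d3 n :=
  Finset.card_pos.2 ⟨(1, 1, n), (mem_d3_filter_iff hn _).2 (by simp)⟩

section

open ZMod

section
variable {d : ℕ} [NeZero d]

lemma tripleSum_eq_sum_bilinearSum (η u v t : ZMod d) :
    tripleSum η u v t = ∑ γ, stdAddChar (-(γ * t)) * bilinearSum (η * γ) u v := by
  rw [tripleSum]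
  have : ∀ τ : ZMod d × ZMod d × ZMod d,
      stdAddChar (η * (τ.1 * τ.2.1 * τ.2.2) - τ.1 * u - τ.2.1 * v - τ.2.2 * t) =
      stdAddChar (-(τ.2.2 * t)) * stdAddChar (η * τ.2.2 * τ.1 * τ.2.1 - τ.1 * u - τ.2.1 * v) :=
    fun τ => by rw [← AddChar.map_add_eq_mul]; ring_nf
  simp_rw [this, Fintype.sum_prod_type, bilinearSum, Finset.mul_sum]
  rw [Finset.sum_comm' (t' := Finset.univ) (s' := fun _ => Finset.univ) (by simp)]
  conv_rhs => rw [Finset.sum_comm]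
  rw [Finset.sum_comm]
  refine Finset.sum_congr rfl fun a _ => ?_
  rw [Finset.sum_comm]

/-- The number of solutions of `g * α = 0`. -/
noncomputable def annCard (d g : ℕ) [NeZero d] : ℕ :=
  (Finset.univ.filter fun α : ZMod d => (g : ZMod d) * α = 0).card

lemma bilinearSum_natCast {g : ℕ} (hg : g ∣ d) (ξ : (ZMod d)ˣ) (u v : ℕ) :
    bilinearSum ((g : ZMod d) * (ξ : ZMod d)) (u : ZMod d) (v : ZMod d) =
      if g ∣ u ∧ g ∣ v then
        stdAddChar (-((g : ZMod d) * ((u / g : ℕ) : ZMod d) * ((v / g : ℕ) : ZMod d) * ((ξ⁻¹ : (ZMod d)ˣ) : ZMod d))) *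
          (d * (annCard d g : ℂ)) else 0 := by
  split_ifs with h
  · obtain ⟨⟨a, rfl⟩, ⟨b, rfl⟩⟩ := h
    have hg0 : 0 < g := Nat.pos_of_dvd_of_pos hg (NeZero.pos d)
    have hξ : (ξ : ZMod d) * ((ξ⁻¹ : (ZMod d)ˣ) : ZMod d) = 1 := by simp
    have key := bilinearSum_mul_mul ((g : ZMod d) * (ξ : ZMod d))
      (((ξ⁻¹ : (ZMod d)ˣ) : ZMod d) * a) (((ξ⁻¹ : (ZMod d)ˣ) : ZMod d) * b)
    have e1 : ∀ a : ℕ, ((g : ZMod d) * (ξ : ZMod d)) * (((ξ⁻¹ : (ZMod d)ˣ) : ZMod d) * a) = ((g * a : ℕ) : ZMod d) :=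
      fun a => by push_cast; linear_combination (g * a : ZMod d) * hξ
    rw [e1, e1] at key
    rw [key, Nat.mul_div_cancel_left _ hg0, Nat.mul_div_cancel_left _ hg0, annCard]
    congr 3
    · push_cast; ring
    · congr 2
      ext α
      rw [mul_comm (g : ZMod d), mul_assoc, Units.mul_right_eq_zero]
  · by_contra h0
    refine h ?_
    have hd : ∀ u : ℕ, (g : ZMod d) * (ξ : ZMod d) ∣ (u : ZMod d) → g ∣ u := fun u hu => by
      obtain ⟨c, hc⟩ := (Dvd.intro _ rfl : (g : ZMod d) ∣ (g : ZMod d) * (ξ : ZMod d)).trans hu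
      rw [← ZMod.natCast_zmod_val c, ← Nat.cast_mul, ZMod.natCast_eq_natCast_iff] at hc
      exact (Nat.ModEq.dvd_iff (hc.of_dvd hg) dvd_rfl).2 (Dvd.intro _ rfl)
    have := dvd_of_bilinearSum_ne_zero h0
    exact ⟨hd u this.1, hd v this.2⟩

lemma annCard_le {g : ℕ} (hg : g ∣ d) : annCard d g ≤ g := by
  have := card_mul_eq_zero_le (d := d) g
  rwa [Nat.gcd_eq_left hg] at this


lemma totient_mul_tripleSum_eq {m : ℕ → ℕ} (hm : ∀ F : ZMod d → ℂ,
      (d.totient : ℂ) * ∑ γ, F γ = ∑ g ∈ d.divisors, (m g : ℂ) * ∑ μ : (ZMod d)ˣ, F (g * μ))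
    (η τ : (ZMod d)ˣ) {u v t k : ℕ} (ht : (t : ZMod d) = k * τ) :
    (d.totient : ℂ) * tripleSum (η : ZMod d) u v t =
      ∑ g ∈ d.divisors, if g ∣ u ∧ g ∣ v then ((m g : ℂ) * (d * annCard d g)) *
        ∑ ν : (ZMod d)ˣ, stdAddChar (-((g : ZMod d) * (k : ZMod d) * ((ν⁻¹ : (ZMod d)ˣ) : ZMod d)) * ((η⁻¹ : (ZMod d)ˣ) : ZMod d)) *
          stdAddChar (-((g : ZMod d) * ((u / g : ℕ) : ZMod d) * ((v / g : ℕ) : ZMod d) * (τ : ZMod d)) * (ν : ZMod d)) else 0 := by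
  rw [tripleSum_eq_sum_bilinearSum, hm]
  refine Finset.sum_congr rfl fun g hg => ?_
  have hgd := (Nat.mem_divisors.1 hg).1
  have h1 := fun μ : (ZMod d)ˣ => (congrArg (fun z => bilinearSum z (u : ZMod d) (v : ZMod d))
    (show (η : ZMod d) * ((g : ZMod d) * (μ : ZMod d)) = g * ((η * μ : (ZMod d)ˣ) : ZMod d) by
      push_cast; ring)).trans (bilinearSum_natCast hgd (η * μ) u v)
  simp_rw [h1]
  split_ifs with h
  · rw [mul_assoc (m g : ℂ)]
    congr 1
    rw [Finset.mul_sum]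
    rw [← Equiv.sum_comp ((Equiv.inv (ZMod d)ˣ).trans (Equiv.mulLeft (η⁻¹ * τ⁻¹)))]
    refine Finset.sum_congr rfl fun ν _ => ?_
    have hτ : (τ : ZMod d) * ((τ⁻¹ : (ZMod d)ˣ) : ZMod d) = 1 := by simp
    have e1 : -((g : ZMod d) * ((η⁻¹ * τ⁻¹ * ν⁻¹ : (ZMod d)ˣ) : ZMod d) * t) =
        -((g : ZMod d) * (k : ZMod d) * ((ν⁻¹ : (ZMod d)ˣ) : ZMod d)) * ((η⁻¹ : (ZMod d)ˣ) : ZMod d) := by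
      rw [ht]; push_cast
      linear_combination (-(g * k * ((ν⁻¹ : (ZMod d)ˣ) : ZMod d) * ((η⁻¹ : (ZMod d)ˣ) : ZMod d))) * hτ
    have e2 : (η * (η⁻¹ * τ⁻¹ * ν⁻¹))⁻¹ = τ * ν := by group; exact mul_comm _ _
    simp only [Equiv.trans_apply, Equiv.inv_apply, Equiv.coe_mulLeft]
    rw [e1, e2, Units.val_mul, show -((g : ZMod d) * ((u / g : ℕ) : ZMod d) * ((v / g : ℕ) : ZMod d) * ((τ : ZMod d) * ν)) =
      -((g : ZMod d) * ((u / g : ℕ) : ZMod d) * ((v / g : ℕ) : ZMod d) * τ) * ν by ring]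
    ring
  · simp


lemma sum_units_norm_sq_le (G : ZMod d → ℂ) :
    ∑ η : (ZMod d)ˣ, ‖G η‖ ^ 2 ≤ ∑ θ : ZMod d, ‖G θ‖ ^ 2 := by
  rw [← Finset.sum_image (g := fun η : (ZMod d)ˣ => (η : ZMod d)) (f := fun θ => ‖G θ‖ ^ 2)
    (fun a _ b _ h => Units.ext h)]
  exact Finset.sum_le_sum_of_subset_of_nonneg (Finset.subset_univ _) fun _ _ _ => by positivity

lemma sum_units_norm_sq_inv_le (n : ℕ) (A : (ZMod d)ˣ → ℂ) :
    ∑ η : (ZMod d)ˣ, ‖∑ ν : (ZMod d)ˣ, stdAddChar (-((n : ZMod d) * ((ν⁻¹ : (ZMod d)ˣ) : ZMod d)) *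
        ((η⁻¹ : (ZMod d)ˣ) : ZMod d)) * A ν‖ ^ 2 ≤ d * (n.gcd d : ℕ) * ∑ ν, ‖A ν‖ ^ 2 := by
  rw [← Equiv.sum_comp (Equiv.inv (ZMod d)ˣ)]
  simp only [Equiv.inv_apply, inv_inv]
  refine (sum_units_norm_sq_le fun θ => ∑ ν : (ZMod d)ˣ,
    stdAddChar (-((n : ZMod d) * ((ν⁻¹ : (ZMod d)ˣ) : ZMod d)) * θ) * A ν).trans ?_
  simp_rw [mul_comm _ (A _)]
  refine sum_norm_sq_sum_mul_stdAddChar_le Finset.univ A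
    (fun ν : (ZMod d)ˣ => -((n : ZMod d) * ((ν⁻¹ : (ZMod d)ˣ) : ZMod d))) fun c => ?_
  refine le_trans ?_ (card_mul_eq_le n (-c))
  refine Finset.card_le_card_of_injOn (fun ν => ((ν⁻¹ : (ZMod d)ˣ) : ZMod d)) (fun ν hν => ?_)
    fun a _ b _ h => inv_injective (Units.ext h)
  simp only [Finset.coe_filter, Finset.mem_univ, true_and, Set.mem_ofPred_eq] at hν ⊢
  rw [← hν, neg_neg]

lemma sum_norm_sq_bilinear_le {ι : Type*} (n : ℕ) (S : Finset ι) (V : ι → ℂ) (f : ι → ZMod d) :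
    ∑ η : (ZMod d)ˣ, ‖∑ ν : (ZMod d)ˣ, stdAddChar (-((n : ZMod d) * ((ν⁻¹ : (ZMod d)ˣ) : ZMod d)) *
        ((η⁻¹ : (ZMod d)ˣ) : ZMod d)) * ∑ b ∈ S, V b * stdAddChar (f b * (ν : ZMod d))‖ ^ 2 ≤
      d ^ 2 * (n.gcd d : ℕ) * ∑ c : ZMod d, ‖∑ b ∈ S with f b = c, V b‖ ^ 2 := by
  refine (sum_units_norm_sq_inv_le n _).trans ?_
  have := (sum_units_norm_sq_le fun θ => ∑ b ∈ S, V b * stdAddChar (f b * θ)).trans_eq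
    (sum_norm_sq_sum_mul_stdAddChar S V f)
  refine (mul_le_mul_of_nonneg_left this (by positivity)).trans_eq ?_
  ring

/-- Triples whose first two entries are divisible by `g` and whose last entry is assigned to `k`. -/
def tripleClass (κ : ℕ → ℕ) (s : Finset (ℕ × ℕ × ℕ)) (g k : ℕ) : Finset (ℕ × ℕ × ℕ) :=
  s.filter fun b => κ b.2.2 = k ∧ g ∣ b.1 ∧ g ∣ b.2.1

lemma totient_mul_sum_tripleSum {m : ℕ → ℕ} (hm : ∀ F : ZMod d → ℂ,
      (d.totient : ℂ) * ∑ γ, F γ = ∑ g ∈ d.divisors, (m g : ℂ) * ∑ μ : (ZMod d)ˣ, F (g * μ))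
    {κ : ℕ → ℕ} {T : ℕ → (ZMod d)ˣ} (hκ : ∀ t, κ t ∈ d.divisors)
    (hT : ∀ t : ℕ, (t : ZMod d) = κ t * T t) (s : Finset (ℕ × ℕ × ℕ)) (V : ℕ × ℕ × ℕ → ℂ)
    (η : (ZMod d)ˣ) :
    (d.totient : ℂ) * ∑ b ∈ s, V b * tripleSum (η : ZMod d) b.1 b.2.1 b.2.2 =
      ∑ p ∈ d.divisors ×ˢ d.divisors, ((m p.1 : ℂ) * (d * annCard d p.1)) *
        ∑ ν : (ZMod d)ˣ, stdAddChar (-(((p.1 * p.2 : ℕ) : ZMod d) * ((ν⁻¹ : (ZMod d)ˣ) : ZMod d)) *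
          ((η⁻¹ : (ZMod d)ˣ) : ZMod d)) * ∑ b ∈ tripleClass κ s p.1 p.2, V b *
            stdAddChar (-((p.1 : ZMod d) * (((b.1 / p.1 : ℕ) : ZMod d) *
              ((b.2.1 / p.1 : ℕ) : ZMod d)) * (T b.2.2 : ZMod d)) * (ν : ZMod d)) := by
  rw [Finset.mul_sum, Finset.sum_product]
  simp_rw [mul_left_comm (d.totient : ℂ), totient_mul_tripleSum_eq hm η _ (hT _), Finset.mul_sum]
  rw [Finset.sum_comm]
  refine Finset.sum_congr rfl fun g _ => ?_
  rw [← Finset.sum_fiberwise_of_maps_to (fun b _ => hκ b.2.2)]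
  refine Finset.sum_congr rfl fun k _ => ?_
  rw [tripleClass, Finset.sum_filter]
  simp_rw [Finset.sum_filter, mul_ite, mul_zero]
  rw [Finset.sum_comm]
  refine Finset.sum_congr rfl fun b _ => ?_
  by_cases h1 : κ b.2.2 = k
  · by_cases h2 : g ∣ b.1 ∧ g ∣ b.2.1
    · simp only [h1, h2, and_self, if_true]
      rw [Finset.mul_sum]
      refine Finset.sum_congr rfl fun ν _ => ?_
      push_cast
      simp only [mul_assoc]
      ring
    · simp [h1, h2]
  · simp [h1]

end

end

section

open ZMod

/-- A weighted count over a residue class, with multiplicities at most `m n`. -/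
lemma sum_inv_weight_le {ι : Type*} {β : ℝ} (hβ : 0 < β) {e : ℕ} (he : 0 < e) (s : Finset ι)
    (q : ι → ℕ) (m : ℕ → ℕ) (hm : ∀ b ∈ s, 0 < m (q b))
    (hcard : ∀ n, (s.filter fun b => q b = n).card ≤ m n)
    (hq : ∀ b ∈ s, ∀ b' ∈ s, q b ≡ q b' [MOD e]) :
    ∑ b ∈ s, ((m (q b) : ℝ) * (1 + (q b : ℝ) / e) ^ (1 + β))⁻¹ ≤
      ∑' j : ℕ, (1 + (j : ℝ)) ^ (-(1 + β)) := by
  have hsum : Summable fun j : ℕ => (1 + (j : ℝ)) ^ (-(1 + β)) := by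
    have := (summable_nat_add_iff 1).2 (Real.summable_nat_rpow.2 (show -(1 + β) < -1 by linarith))
    refine this.congr fun j => ?_
    rw [Nat.cast_add, Nat.cast_one, add_comm]
  rw [← Finset.sum_fiberwise_of_maps_to (t := s.image q) fun b hb => Finset.mem_image_of_mem q hb]
  have h1 : ∀ n ∈ s.image q, ∑ b ∈ s with q b = n,
      ((m (q b) : ℝ) * (1 + (q b : ℝ) / e) ^ (1 + β))⁻¹ ≤ (1 + ((n / e : ℕ) : ℝ)) ^ (-(1 + β)) :=
    fun n hn => by
      obtain ⟨b₀, hb₀, rfl⟩ := Finset.mem_image.1 hn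
      have hm0 : (0 : ℝ) < m (q b₀) := by exact_mod_cast hm b₀ hb₀
      have hx : (0 : ℝ) < 1 + (q b₀ : ℝ) / e := by positivity
      rw [Finset.sum_congr rfl (g := fun _ => ((m (q b₀) : ℝ) *
        (1 + (q b₀ : ℝ) / e) ^ (1 + β))⁻¹) fun b hb => by rw [(Finset.mem_filter.1 hb).2],
        Finset.sum_const, nsmul_eq_mul, mul_inv, ← mul_assoc]
      have h2 : ((s.filter fun b => q b = q b₀).card : ℝ) * (m (q b₀) : ℝ)⁻¹ ≤ 1 := by
        rw [mul_inv_le_iff₀ hm0, one_mul]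
        exact_mod_cast hcard (q b₀)
      refine (mul_le_of_le_one_left (by positivity) h2).trans ?_
      rw [← Real.rpow_neg hx.le]
      refine Real.rpow_le_rpow_of_nonpos (by positivity) ?_ (by linarith)
      have := Nat.cast_div_le (α := ℝ) (m := q b₀) (n := e)
      linarith
  refine (Finset.sum_le_sum h1).trans ?_
  rw [← Finset.sum_image (g := fun n : ℕ => n / e) (f := fun j : ℕ => (1 + (j : ℝ)) ^ (-(1 + β)))]
  · exact hsum.sum_le_tsum _ fun j _ => by positivity
  · intro n hn n' hn' h
    obtain ⟨b, hb, rfl⟩ := Finset.mem_image.1 hn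
    obtain ⟨b', hb', rfl⟩ := Finset.mem_image.1 hn'
    have h2 : q b % e = q b' % e := hq b hb b' hb'
    simp only at h
    rw [← Nat.div_add_mod (q b) e, ← Nat.div_add_mod (q b') e, h, h2]

section
variable {d : ℕ} [NeZero d]

lemma sum_norm_sq_tripleClass_le {β : ℝ} (hβ : 0 < β) {κ : ℕ → ℕ} {T : ℕ → (ZMod d)ˣ}
    (hκ : ∀ t, κ t ∈ d.divisors) (hT : ∀ t : ℕ, (t : ZMod d) = κ t * T t)
    {s : Finset (ℕ × ℕ × ℕ)} {N : ℕ} (hs : ∀ b ∈ s, b.1 * b.2.1 * b.2.2 ∈ Finset.Icc 1 N)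
    (W : ℕ → ℂ) (g k : ℕ) (hg : g ≠ 0) (hk : k ≠ 0) :
    ∑ c : ZMod d, ‖∑ b ∈ tripleClass κ s g k with -((g : ZMod d) * (((b.1 / g : ℕ) : ZMod d) *
        ((b.2.1 / g : ℕ) : ZMod d)) * (T b.2.2 : ZMod d)) = c, W (b.1 * b.2.1 * b.2.2)‖ ^ 2 ≤
      (∑' j : ℕ, (1 + (j : ℝ)) ^ (-(1 + β))) * ∑ n ∈ Finset.Icc 1 N, (d3 n : ℝ) ^ 2 *
        (1 + (n : ℝ) / (d / d.gcd (g * k) : ℕ)) ^ (1 + β) * ‖W (g ^ 2 * k * n)‖ ^ 2 := by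
  set S := tripleClass κ s g k with hS
  set f : ℕ × ℕ × ℕ → ZMod d := fun b => -((g : ZMod d) * (((b.1 / g : ℕ) : ZMod d) *
        ((b.2.1 / g : ℕ) : ZMod d)) * (T b.2.2 : ZMod d)) with hf
  set q : ℕ × ℕ × ℕ → ℕ := fun b => (b.1 / g) * (b.2.1 / g) * (b.2.2 / k) with hq
  set e := d / d.gcd (g * k) with he
  have he0 : 0 < e := Nat.div_pos (Nat.le_of_dvd (NeZero.pos d) (Nat.gcd_dvd_left _ _))
    (Nat.gcd_pos_of_pos_left _ (NeZero.pos d))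
  have hmem : ∀ b ∈ S, b ∈ s ∧ κ b.2.2 = k ∧ ∃ u v t, b = (g * u, g * v, k * t) := fun b hb => by
    obtain ⟨h1, h2, ⟨u, hu⟩, ⟨v, hv⟩⟩ := Finset.mem_filter.1 hb
    refine ⟨h1, h2, u, v, ?_⟩
    have h3 : k ∣ b.2.2 := by
      have := hT b.2.2
      rw [h2, ← ZMod.natCast_zmod_val (T b.2.2 : ZMod d), ← Nat.cast_mul,
        ZMod.natCast_eq_natCast_iff] at this
      exact (Nat.ModEq.dvd_iff (this.of_dvd (Nat.mem_divisors.1 (h2 ▸ hκ b.2.2)).1) dvd_rfl).2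
        (Dvd.intro _ rfl)
    obtain ⟨t, ht⟩ := h3
    exact ⟨t, Prod.ext hu (Prod.ext hv ht)⟩
  have hqe : ∀ u v t, q (g * u, g * v, k * t) = u * v * t := fun u v t => by
    simp [hq, Nat.pos_of_ne_zero hg, Nat.pos_of_ne_zero hk]
  have hprod : ∀ b ∈ S, b.1 * b.2.1 * b.2.2 = g ^ 2 * k * q b := fun b hb => by
    obtain ⟨-, -, u, v, t, rfl⟩ := hmem b hb
    rw [hqe]; ring
  have hqN : ∀ b ∈ S, q b ∈ Finset.Icc 1 N := fun b hb => by
    have h1 := Finset.mem_Icc.1 (hs b (hmem b hb).1)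
    rw [hprod b hb] at h1
    rw [Finset.mem_Icc]
    refine ⟨Nat.one_le_iff_ne_zero.2 fun h => by simp [h] at h1, le_trans ?_ h1.2⟩
    exact Nat.le_mul_of_pos_left _ (by positivity)
  have hcard : ∀ n, (S.filter fun b => q b = n).card ≤ d3 n := fun n => by
    rcases eq_or_ne n 0 with rfl | hn
    · refine le_of_eq_of_le (Finset.card_eq_zero.2 (Finset.filter_eq_empty_iff.2 fun b hb h => ?_))
        (Nat.zero_le _)
      have := (Finset.mem_Icc.1 (hqN b hb)).1
      omega
    refine Finset.card_le_card_of_injOn (fun b => (b.1 / g, b.2.1 / g, b.2.2 / k))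
      (fun b hb => ?_) fun b hb b' hb' h => ?_
    · rw [Finset.mem_coe, mem_d3_filter_iff hn]
      exact (Finset.mem_filter.1 hb).2
    · obtain ⟨-, -, u, v, t, rfl⟩ := hmem b (Finset.mem_filter.1 hb).1
      obtain ⟨-, -, u', v', t', rfl⟩ := hmem b' (Finset.mem_filter.1 hb').1
      simpa [hg, hk, Nat.pos_of_ne_zero hg, Nat.pos_of_ne_zero hk] using h
  have hmod : ∀ b ∈ S, ((g * k * q b : ℕ) : ZMod d) = -(k * f b) := fun b hb => by
    obtain ⟨-, h2, u, v, t, rfl⟩ := hmem b hb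
    have h3 := hT (k * t)
    simp only at h2
    rw [h2] at h3
    rw [hqe, hf]
    simp only [Nat.mul_div_cancel_left _ (Nat.pos_of_ne_zero hg)]
    push_cast at h3 ⊢
    linear_combination (g * u * v : ZMod d) * h3
  have hcong : ∀ c, ∀ b ∈ S.filter (fun b => f b = c), ∀ b' ∈ S.filter (fun b => f b = c),
      q b ≡ q b' [MOD e] := fun c b hb b' hb' => by
    obtain ⟨h1, h2⟩ := Finset.mem_filter.1 hb
    obtain ⟨h1', h2'⟩ := Finset.mem_filter.1 hb'
    have h3 : ((g * k * q b : ℕ) : ZMod d) = ((g * k * q b' : ℕ) : ZMod d) := by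
      rw [hmod b h1, hmod b' h1', h2, h2']
    rw [ZMod.natCast_eq_natCast_iff] at h3
    exact Nat.ModEq.cancel_left_div_gcd (NeZero.pos d) h3
  have hpos : ∀ b ∈ S, 0 < d3 (q b) := fun b hb =>
    d3_pos (by have := (Finset.mem_Icc.1 (hqN b hb)).1; omega)
  have hw : ∀ b ∈ S, (0 : ℝ) < (d3 (q b) : ℝ) * (1 + (q b : ℝ) / e) ^ (1 + β) := fun b hb => by
    have : (0 : ℝ) < d3 (q b) := by exact_mod_cast hpos b hb
    positivity
  have hB : 0 ≤ ∑' j : ℕ, (1 + (j : ℝ)) ^ (-(1 + β)) := tsum_nonneg fun j => by positivity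
  calc _ ≤ ∑ c : ZMod d, (∑' j : ℕ, (1 + (j : ℝ)) ^ (-(1 + β))) * ∑ b ∈ S with f b = c,
        ((d3 (q b) : ℝ) * (1 + (q b : ℝ) / e) ^ (1 + β)) * ‖W (b.1 * b.2.1 * b.2.2)‖ ^ 2 := by
        refine Finset.sum_le_sum fun c _ => norm_sum_sq_le_of_weight _ _
          (fun b hb => hw b (Finset.mem_filter.1 hb).1) ?_
        refine sum_inv_weight_le hβ he0 _ q d3 (fun b hb => hpos b (Finset.mem_filter.1 hb).1)
          (fun n => ?_) (hcong c)
        refine le_trans (Finset.card_le_card fun b hb => ?_) (hcard n)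
        simp only [Finset.mem_filter] at hb ⊢
        exact ⟨hb.1.1, hb.2⟩
    _ = (∑' j : ℕ, (1 + (j : ℝ)) ^ (-(1 + β))) * ∑ n ∈ Finset.Icc 1 N, ∑ b ∈ S with q b = n,
        ((d3 (q b) : ℝ) * (1 + (q b : ℝ) / e) ^ (1 + β)) * ‖W (b.1 * b.2.1 * b.2.2)‖ ^ 2 := by
        rw [← Finset.mul_sum, Finset.sum_fiberwise, Finset.sum_fiberwise_of_maps_to hqN]
    _ ≤ _ := by
        refine mul_le_mul_of_nonneg_left (Finset.sum_le_sum fun n _ => ?_) hB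
        rw [Finset.sum_congr rfl (g := fun _ => ((d3 n : ℝ) * (1 + (n : ℝ) / e) ^ (1 + β)) *
          ‖W (g ^ 2 * k * n)‖ ^ 2) fun b hb => by
            obtain ⟨h1, h2⟩ := Finset.mem_filter.1 hb
            rw [hprod b h1, h2], Finset.sum_const, nsmul_eq_mul]
        have h3 : ((S.filter fun b => q b = n).card : ℝ) ≤ d3 n := by exact_mod_cast hcard n
        refine (mul_le_mul_of_nonneg_right h3 (by positivity)).trans_eq ?_
        ring

end

end

section

open ZMod

lemma rpow_mul_one_add_div_rpow_le {β : ℝ} (hβ : 0 < β) {n e : ℕ} (hn : 1 ≤ n) (he : 1 ≤ e) :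
    (n : ℝ) ^ β * (1 + (n : ℝ) / e) ^ (1 + β) ≤
      2 ^ (1 + β) * ((n : ℝ) ^ β + (n : ℝ) ^ (1 + 2 * β) / e) := by
  have hn0 : (0 : ℝ) < n := by exact_mod_cast hn
  have he1 : (1 : ℝ) ≤ e := by exact_mod_cast he
  have he0 : (0 : ℝ) < e := by linarith
  have hx : (0 : ℝ) ≤ (n : ℝ) / e := by positivity
  have h1 : (1 + (n : ℝ) / e) ^ (1 + β) ≤ 2 ^ (1 + β) * (1 + ((n : ℝ) / e) ^ (1 + β)) := by
    rcases le_total ((n : ℝ) / e) 1 with h | h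
    · calc (1 + (n : ℝ) / e) ^ (1 + β) ≤ 2 ^ (1 + β) :=
            Real.rpow_le_rpow (by positivity) (by linarith) (by linarith)
        _ ≤ _ := le_mul_of_one_le_right (by positivity)
            (le_add_of_nonneg_right (by positivity))
    · calc (1 + (n : ℝ) / e) ^ (1 + β) ≤ (2 * ((n : ℝ) / e)) ^ (1 + β) :=
            Real.rpow_le_rpow (by positivity) (by linarith) (by linarith)
        _ = 2 ^ (1 + β) * ((n : ℝ) / e) ^ (1 + β) := Real.mul_rpow (by norm_num) hx
        _ ≤ _ := mul_le_mul_of_nonneg_left (by linarith) (by positivity)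
  have h2 : (n : ℝ) ^ β * ((n : ℝ) / e) ^ (1 + β) ≤ (n : ℝ) ^ (1 + 2 * β) / e := by
    rw [Real.div_rpow hn0.le he0.le, mul_div_assoc', ← Real.rpow_add hn0,
      show β + (1 + β) = 1 + 2 * β by ring]
    refine div_le_div_of_nonneg_left (by positivity) he0 ?_
    exact Real.self_le_rpow_of_one_le he1 (by linarith)
  calc _ ≤ (n : ℝ) ^ β * (2 ^ (1 + β) * (1 + ((n : ℝ) / e) ^ (1 + β))) :=
        mul_le_mul_of_nonneg_left h1 (by positivity)
    _ = 2 ^ (1 + β) * ((n : ℝ) ^ β + (n : ℝ) ^ β * ((n : ℝ) / e) ^ (1 + β)) := by ring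
    _ ≤ _ := mul_le_mul_of_nonneg_left (by linarith) (by positivity)

/-- The weight with which `‖W (g ^ 2 * k * n)‖ ^ 2` occurs in the large sieve inequality, for
`c = gcd d (g * k)`. -/
noncomputable def sieveWeight (β : ℝ) (d c n : ℕ) : ℝ :=
  c * ((n : ℝ) ^ β + (c : ℝ) / d * (n : ℝ) ^ (1 + 2 * β))

lemma sieveWeight_nonneg (β : ℝ) (d c n : ℕ) : 0 ≤ sieveWeight β d c n := by
  unfold sieveWeight; positivity

/-- A large sieve inequality for the exponential sums `tripleSum`. -/
theorem exists_sum_norm_sq_tripleSum_le {β : ℝ} (hβ : 0 < β) :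
    ∃ C : ℝ, 0 < C ∧ ∀ (d : ℕ) [NeZero d] (W : ℕ → ℂ) (N : ℕ) (s : Finset (ℕ × ℕ × ℕ)),
      (∀ b ∈ s, b.1 * b.2.1 * b.2.2 ∈ Finset.Icc 1 N) →
      ∑ η : (ZMod d)ˣ, ‖∑ b ∈ s, W (b.1 * b.2.1 * b.2.2) *
          tripleSum (η : ZMod d) b.1 b.2.1 b.2.2‖ ^ 2 ≤
        C * ((d.divisors.card : ℝ) ^ 4 * d ^ 4) * ∑ p ∈ d.divisors ×ˢ d.divisors,
          ∑ n ∈ Finset.Icc 1 N, sieveWeight β d (d.gcd (p.1 * p.2)) n *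
            ‖W (p.1 ^ 2 * p.2 * n)‖ ^ 2 := by
  obtain ⟨C₁, hC₁, hd3⟩ := exists_d3_sq_le hβ
  set B := ∑' j : ℕ, (1 + (j : ℝ)) ^ (-(1 + β)) with hB
  have hB0 : 0 ≤ B := tsum_nonneg fun j => by positivity
  refine ⟨(B + 1) * (C₁ * 2 ^ (1 + β)), by positivity, fun d _ W N s hs => ?_⟩
  have hd0 : (0 : ℝ) < d := by exact_mod_cast NeZero.pos d
  obtain ⟨m, hmg, hm⟩ := exists_totient_mul_sum_eq d
  choose κ hκ T hT using fun t : ℕ => exists_eq_divisor_mul_unit (t : ZMod d)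
  set Z : ℕ × ℕ → (ZMod d)ˣ → ℂ := fun p η =>
    ∑ ν : (ZMod d)ˣ, stdAddChar (-(((p.1 * p.2 : ℕ) : ZMod d) * ((ν⁻¹ : (ZMod d)ˣ) : ZMod d)) *
          ((η⁻¹ : (ZMod d)ˣ) : ZMod d)) * ∑ b ∈ tripleClass κ s p.1 p.2,
            W (b.1 * b.2.1 * b.2.2) *
            stdAddChar (-((p.1 : ZMod d) * (((b.1 / p.1 : ℕ) : ZMod d) *
              ((b.2.1 / p.1 : ℕ) : ZMod d)) * (T b.2.2 : ZMod d)) * (ν : ZMod d)) with hZ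
  have hZle : ∀ p ∈ d.divisors ×ˢ d.divisors, ∑ η, ‖Z p η‖ ^ 2 ≤
      d ^ 2 * ((B + 1) * (C₁ * 2 ^ (1 + β)) * ∑ n ∈ Finset.Icc 1 N,
        sieveWeight β d (d.gcd (p.1 * p.2)) n * ‖W (p.1 ^ 2 * p.2 * n)‖ ^ 2) := fun p hp => by
    obtain ⟨h1, h2⟩ := Finset.mem_product.1 hp
    set c := d.gcd (p.1 * p.2) with hc
    have hc0 : 0 < c := Nat.gcd_pos_of_pos_left _ (NeZero.pos d)
    have hcd : c ∣ d := Nat.gcd_dvd_left _ _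
    have he1 : 1 ≤ d / c := Nat.div_pos (Nat.le_of_dvd (NeZero.pos d) hcd) hc0
    have hcast : ((d / c : ℕ) : ℝ) = d / c := Nat.cast_div hcd (Nat.cast_ne_zero.2 hc0.ne')
    refine (sum_norm_sq_bilinear_le (p.1 * p.2) (tripleClass κ s p.1 p.2)
      (fun b => W (b.1 * b.2.1 * b.2.2)) _).trans ?_
    rw [Nat.gcd_comm, ← hc, mul_assoc]
    refine mul_le_mul_of_nonneg_left ?_ (by positivity)
    refine (mul_le_mul_of_nonneg_left (sum_norm_sq_tripleClass_le hβ hκ hT hs W p.1 p.2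
      (Nat.pos_of_mem_divisors h1).ne' (Nat.pos_of_mem_divisors h2).ne') (Nat.cast_nonneg _)).trans ?_
    rw [← hB, ← hc, mul_left_comm, mul_assoc (B + 1)]
    refine mul_le_mul (by linarith) ?_ (by positivity) (by positivity)
    rw [Finset.mul_sum, Finset.mul_sum]
    refine Finset.sum_le_sum fun n hn => ?_
    have hn1 := (Finset.mem_Icc.1 hn).1
    refine le_of_eq_of_le (mul_assoc _ _ _).symm (le_of_le_of_eq ?_ (mul_assoc _ _ _))
    refine mul_le_mul_of_nonneg_right ?_ (sq_nonneg _)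
    calc (c : ℝ) * ((d3 n : ℝ) ^ 2 * (1 + (n : ℝ) / (d / c : ℕ)) ^ (1 + β))
        ≤ c * ((C₁ * (n : ℝ) ^ β) * (1 + (n : ℝ) / (d / c : ℕ)) ^ (1 + β)) := by
          refine mul_le_mul_of_nonneg_left (mul_le_mul_of_nonneg_right (hd3 n (by omega)) ?_)
            (by positivity)
          positivity
      _ = c * C₁ * ((n : ℝ) ^ β * (1 + (n : ℝ) / (d / c : ℕ)) ^ (1 + β)) := by ring
      _ ≤ c * C₁ * (2 ^ (1 + β) * ((n : ℝ) ^ β + (n : ℝ) ^ (1 + 2 * β) / (d / c : ℕ))) :=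
          mul_le_mul_of_nonneg_left (rpow_mul_one_add_div_rpow_le hβ hn1 he1) (by positivity)
      _ = _ := by
          rw [hcast, sieveWeight]; field_simp
  have hcoef : ∀ p ∈ d.divisors ×ˢ d.divisors,
      ‖(m p.1 : ℂ) * (d * annCard d p.1)‖ ≤ (d : ℝ) ^ 2 := fun p hp => by
    have h1 := (Finset.mem_product.1 hp).1
    have h2 : m p.1 * annCard d p.1 ≤ d :=
      (Nat.mul_le_mul_left _ (annCard_le (Nat.mem_divisors.1 h1).1)).trans (hmg _ h1)
    have h3 : (m p.1 : ℝ) * annCard d p.1 ≤ d := by exact_mod_cast h2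
    simp only [norm_mul, Complex.norm_natCast]
    nlinarith
  have hη : ∀ η : (ZMod d)ˣ, (d.totient : ℝ) ^ 2 * ‖∑ b ∈ s, W (b.1 * b.2.1 * b.2.2) *
          tripleSum (η : ZMod d) b.1 b.2.1 b.2.2‖ ^ 2 ≤ (d.divisors.card : ℝ) ^ 2 *
        ∑ p ∈ d.divisors ×ˢ d.divisors, (d : ℝ) ^ 4 * ‖Z p η‖ ^ 2 := fun η => by
    have h1 := totient_mul_sum_tripleSum hm hκ hT s (fun b => W (b.1 * b.2.1 * b.2.2)) η
    have h2 := congrArg (fun z => ‖z‖ ^ 2) h1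
    simp only [norm_mul (d.totient : ℂ), Complex.norm_natCast, mul_pow] at h2
    rw [h2]
    refine (norm_sum_sq_le_card_mul _ _).trans ?_
    rw [Finset.card_product, Nat.cast_mul, ← sq]
    refine mul_le_mul_of_nonneg_left (Finset.sum_le_sum fun p hp => ?_) (sq_nonneg _)
    rw [norm_mul, mul_pow, show (d : ℝ) ^ 4 = ((d : ℝ) ^ 2) ^ 2 by ring]
    exact mul_le_mul_of_nonneg_right (pow_le_pow_left₀ (norm_nonneg _) (hcoef p hp) 2)
      (by positivity)
  have hφ : (0 : ℝ) < (d.totient : ℝ) ^ 2 := by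
    have : 0 < d.totient := Nat.totient_pos.2 (NeZero.pos d)
    positivity
  have hdφ : (d : ℝ) ^ 2 ≤ (d.divisors.card : ℝ) ^ 2 * (d.totient : ℝ) ^ 2 := by
    rw [← mul_pow]
    exact pow_le_pow_left₀ hd0.le (by exact_mod_cast le_card_divisors_mul_totient d) 2
  refine le_of_mul_le_mul_left ?_ hφ
  rw [Finset.mul_sum]
  refine (Finset.sum_le_sum fun η _ => hη η).trans ?_
  rw [← Finset.mul_sum, Finset.sum_comm]
  simp_rw [← Finset.mul_sum]
  have h3 := Finset.sum_le_sum hZle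
  rw [← Finset.mul_sum, ← Finset.mul_sum] at h3
  set Q := ∑ p ∈ d.divisors ×ˢ d.divisors, ∑ n ∈ Finset.Icc 1 N,
    sieveWeight β d (d.gcd (p.1 * p.2)) n * ‖W (p.1 ^ 2 * p.2 * n)‖ ^ 2 with hQ
  have hQ0 : 0 ≤ Q := Finset.sum_nonneg fun p _ => Finset.sum_nonneg fun n _ =>
    mul_nonneg (sieveWeight_nonneg _ _ _ _) (by positivity)
  calc _ ≤ (d.divisors.card : ℝ) ^ 2 * ((d : ℝ) ^ 4 *
        (d ^ 2 * ((B + 1) * (C₁ * 2 ^ (1 + β)) * Q))) :=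
        mul_le_mul_of_nonneg_left (mul_le_mul_of_nonneg_left h3 (by positivity)) (sq_nonneg _)
    _ = (d : ℝ) ^ 2 * ((d.divisors.card : ℝ) ^ 2 * (d : ℝ) ^ 4 *
        ((B + 1) * (C₁ * 2 ^ (1 + β)) * Q)) := by ring
    _ ≤ (d.divisors.card : ℝ) ^ 2 * (d.totient : ℝ) ^ 2 * ((d.divisors.card : ℝ) ^ 2 *
        (d : ℝ) ^ 4 * ((B + 1) * (C₁ * 2 ^ (1 + β)) * Q)) :=
        mul_le_mul_of_nonneg_right hdφ (mul_nonneg (mul_nonneg (sq_nonneg _) (by positivity))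
          (by positivity))
    _ = _ := by ring

end

section

open ZMod

lemma tripleSum_units_mul {d : ℕ} [NeZero d] (a b c : (ZMod d)ˣ) (η u v t : ZMod d) :
    tripleSum η (a * u) (b * v) (c * t) =
      tripleSum (η * ((a⁻¹ * b⁻¹ * c⁻¹ : (ZMod d)ˣ) : ZMod d)) u v t := by
  rw [tripleSum, tripleSum, ← Equiv.sum_comp ((Units.mulLeft a⁻¹).prodCongr
    ((Units.mulLeft b⁻¹).prodCongr (Units.mulLeft c⁻¹)))]
  refine Finset.sum_congr rfl fun τ _ => ?_
  simp only [Equiv.prodCongr_apply, Prod.map, Units.mulLeft_apply]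
  have ha : (a : ZMod d) * ((a⁻¹ : (ZMod d)ˣ) : ZMod d) = 1 := by simp
  have hb : (b : ZMod d) * ((b⁻¹ : (ZMod d)ˣ) : ZMod d) = 1 := by simp
  have hc : (c : ZMod d) * ((c⁻¹ : (ZMod d)ˣ) : ZMod d) = 1 := by simp
  congr 1
  push_cast
  linear_combination (-(τ.1 * u)) * ha - (τ.2.1 * v) * hb - (τ.2.2 * t) * hc

/-- Sum over the units of the large sieve inequality, for a family of convergent series with
signs. -/
lemma exists_sum_norm_sq_le_of_hasSum {β : ℝ} (hβ : 0 < β) :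
    ∃ C : ℝ, 0 < C ∧ ∀ (d : ℕ) [NeZero d] (V : ℤˣ × ℤˣ × ℤˣ → ℕ → ℂ) (D : (ZMod d)ˣ → ℂ) (M : ℝ),
      (∀ σ, V σ 0 = 0) →
      (∀ η : (ZMod d)ˣ, HasSum (fun p : ℕ × ℕ × ℕ => ∑ σ : ℤˣ × ℤˣ × ℤˣ,
        tripleSum (η : ZMod d) (((σ.1 : ℤ) : ZMod d) * p.1) (((σ.2.1 : ℤ) : ZMod d) * p.2.1)
          (((σ.2.2 : ℤ) : ZMod d) * p.2.2) * V σ (p.1 * p.2.1 * p.2.2)) (D η)) →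
      (∀ σ, ∀ p ∈ d.divisors ×ˢ d.divisors, ∀ N : ℕ,
        ∑ n ∈ Finset.Icc 1 N, sieveWeight β d (d.gcd (p.1 * p.2)) n *
            ‖V σ (p.1 ^ 2 * p.2 * n)‖ ^ 2 ≤ M) →
      ∑ η : (ZMod d)ˣ, ‖D η‖ ^ 2 ≤ C * ((d.divisors.card : ℝ) ^ 6 * d ^ 4) * M := by
  obtain ⟨C, hC, hmain⟩ := exists_sum_norm_sq_tripleSum_le hβ
  refine ⟨64 * C, by positivity, fun d _ V D M hV0 hD hM => ?_⟩
  have hlim : Filter.Tendsto (fun s : Finset (ℕ × ℕ × ℕ) => ∑ η : (ZMod d)ˣ, ‖∑ p ∈ s,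
      ∑ σ : ℤˣ × ℤˣ × ℤˣ,
        tripleSum (η : ZMod d) (((σ.1 : ℤ) : ZMod d) * p.1) (((σ.2.1 : ℤ) : ZMod d) * p.2.1)
          (((σ.2.2 : ℤ) : ZMod d) * p.2.2) * V σ (p.1 * p.2.1 * p.2.2)‖ ^ 2) Filter.atTop
      (nhds (∑ η : (ZMod d)ˣ, ‖D η‖ ^ 2)) :=
    tendsto_finsetSum _ fun η _ => ((hD η).norm).pow 2
  refine le_of_tendsto' hlim fun s => ?_
  have hσ : ∀ σ : ℤˣ × ℤˣ × ℤˣ, ∑ η : (ZMod d)ˣ, ‖∑ p ∈ s,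
      tripleSum (η : ZMod d) (((σ.1 : ℤ) : ZMod d) * p.1) (((σ.2.1 : ℤ) : ZMod d) * p.2.1)
          (((σ.2.2 : ℤ) : ZMod d) * p.2.2) * V σ (p.1 * p.2.1 * p.2.2)‖ ^ 2 ≤
      C * ((d.divisors.card : ℝ) ^ 4 * d ^ 4) * ((d.divisors.card : ℝ) ^ 2 * M) := fun σ => by
    set ι : ℤˣ →* (ZMod d)ˣ := Units.map (Int.castRingHom (ZMod d)).toMonoidHom with hι
    set μ : (ZMod d)ˣ := (ι σ.1)⁻¹ * (ι σ.2.1)⁻¹ * (ι σ.2.2)⁻¹ with hμ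
    set s' := s.filter fun b => b.1 * b.2.1 * b.2.2 ≠ 0 with hs'
    set N := s.sup fun b => b.1 * b.2.1 * b.2.2 with hN
    have h1 : ∀ η : (ZMod d)ˣ, ∑ p ∈ s,
        tripleSum (η : ZMod d) (((σ.1 : ℤ) : ZMod d) * p.1) (((σ.2.1 : ℤ) : ZMod d) * p.2.1)
          (((σ.2.2 : ℤ) : ZMod d) * p.2.2) * V σ (p.1 * p.2.1 * p.2.2) =
        ∑ p ∈ s', V σ (p.1 * p.2.1 * p.2.2) *
          tripleSum ((η * μ : (ZMod d)ˣ) : ZMod d) p.1 p.2.1 p.2.2 := fun η => by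
      rw [hs', Finset.sum_filter]
      refine Finset.sum_congr rfl fun p _ => ?_
      have h2 : ∀ ρ : ℤˣ, (((ρ : ℤˣ) : ℤ) : ZMod d) = (ι ρ : ZMod d) := fun ρ => rfl
      rw [h2, h2, h2, tripleSum_units_mul]
      split_ifs with h
      · rw [mul_comm, hμ, Units.val_mul η]
      · rw [not_not.1 h, hV0, mul_zero]
    simp_rw [h1]
    refine (Equiv.sum_comp (Equiv.mulRight μ) fun η : (ZMod d)ˣ => ‖∑ p ∈ s',
      V σ (p.1 * p.2.1 * p.2.2) * tripleSum (η : ZMod d) p.1 p.2.1 p.2.2‖ ^ 2).le.trans ?_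
    refine (hmain d (V σ) N s' fun b hb => ?_).trans ?_
    · obtain ⟨h2, h3⟩ := Finset.mem_filter.1 hb
      exact Finset.mem_Icc.2 ⟨Nat.one_le_iff_ne_zero.2 h3,
        Finset.le_sup (f := fun b : ℕ × ℕ × ℕ => b.1 * b.2.1 * b.2.2) h2⟩
    · refine mul_le_mul_of_nonneg_left ((Finset.sum_le_card_nsmul _ _ M
        fun p hp => hM σ p hp N).trans_eq ?_) ?_
      · rw [nsmul_eq_mul, Finset.card_product, Nat.cast_mul, sq]
      · exact mul_nonneg hC.le (mul_nonneg (pow_nonneg (Nat.cast_nonneg _) _) (by positivity))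
  have hcard : (Fintype.card (ℤˣ × ℤˣ × ℤˣ) : ℝ) = 8 := by
    norm_num [Fintype.card_prod, Fintype.card_units_int]
  calc _ ≤ ∑ η : (ZMod d)ˣ, 8 * ∑ σ : ℤˣ × ℤˣ × ℤˣ, ‖∑ p ∈ s,
      tripleSum (η : ZMod d) (((σ.1 : ℤ) : ZMod d) * p.1) (((σ.2.1 : ℤ) : ZMod d) * p.2.1)
          (((σ.2.2 : ℤ) : ZMod d) * p.2.2) * V σ (p.1 * p.2.1 * p.2.2)‖ ^ 2 := by
        refine Finset.sum_le_sum fun η _ => ?_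
        rw [Finset.sum_comm]
        refine (norm_sum_sq_le_card_mul _ _).trans_eq ?_
        rw [Finset.card_univ, hcard]
    _ = 8 * ∑ σ : ℤˣ × ℤˣ × ℤˣ, ∑ η : (ZMod d)ˣ, ‖∑ p ∈ s,
      tripleSum (η : ZMod d) (((σ.1 : ℤ) : ZMod d) * p.1) (((σ.2.1 : ℤ) : ZMod d) * p.2.1)
          (((σ.2.2 : ℤ) : ZMod d) * p.2.2) * V σ (p.1 * p.2.1 * p.2.2)‖ ^ 2 := by
        rw [← Finset.mul_sum, Finset.sum_comm]
    _ ≤ 8 * (8 * (C * ((d.divisors.card : ℝ) ^ 4 * d ^ 4) *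
          ((d.divisors.card : ℝ) ^ 2 * M))) := by
        refine mul_le_mul_of_nonneg_left ((Finset.sum_le_card_nsmul _ _ _
          fun σ _ => hσ σ).trans_eq ?_) (by norm_num)
        rw [nsmul_eq_mul, Finset.card_univ, hcard]
    _ = _ := by ring

end

section

open MeasureTheory

/-- A Sobolev-type inequality bounding a value by means over an interval. -/
lemma norm_sq_le_integral_add {V V' : ℝ → ℂ} {a b : ℝ} (hab : a < b)
    (hV : ∀ y ∈ Set.Icc a b, HasDerivAt V (V' y) y) (hV' : ContinuousOn V' (Set.Icc a b)) :
    ‖V a‖ ^ 2 ≤ ∫ y in a..b, ((b - a)⁻¹ * ‖V y‖ ^ 2 + 2 * (‖V y‖ * ‖V' y‖)) := by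
  have hu : Set.uIcc a b = Set.Icc a b := Set.uIcc_of_le hab.le
  have hVc : ContinuousOn V (Set.Icc a b) := fun y hy => (hV y hy).continuousAt.continuousWithinAt
  set F' : ℝ → ℝ := fun y => 2 * inner ℝ (V y) (V' y) with hF'
  have hF : ∀ y ∈ Set.Icc a b, HasDerivAt (fun y => ‖V y‖ ^ 2) (F' y) y := fun y hy =>
    (hV y hy).norm_sq
  have hF'c : ContinuousOn F' (Set.Icc a b) := continuousOn_const.mul (hVc.inner hV')
  have hVsq : ContinuousOn (fun y => ‖V y‖ ^ 2) (Set.Icc a b) := hVc.norm.pow 2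
  have hVV' : ContinuousOn (fun y => ‖V y‖ * ‖V' y‖) (Set.Icc a b) := hVc.norm.mul hV'.norm
  have hparts : ∫ y in a..b, (‖V y‖ ^ 2 + (y - b) * F' y) = (b - a) * ‖V a‖ ^ 2 := by
    rw [intervalIntegral.integral_eq_sub_of_hasDerivAt (f := fun y => (y - b) * ‖V y‖ ^ 2)]
    · ring
    · intro y hy
      rw [hu] at hy
      have := ((hasDerivAt_id y).sub_const b).mul (hF y hy)
      simpa using! this
    · refine ContinuousOn.intervalIntegrable ?_
      rw [hu]
      exact hVsq.add ((continuousOn_id.sub continuousOn_const).mul hF'c)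
  have hpos : 0 < b - a := sub_pos.2 hab
  refine le_of_mul_le_mul_left ?_ hpos
  rw [← hparts, ← intervalIntegral.integral_const_mul]
  refine intervalIntegral.integral_mono_on hab.le ?_ ?_ fun y hy => ?_
  · refine ContinuousOn.intervalIntegrable ?_
    rw [hu]
    exact hVsq.add ((continuousOn_id.sub continuousOn_const).mul hF'c)
  · refine ContinuousOn.intervalIntegrable ?_
    rw [hu]
    exact continuousOn_const.mul ((continuousOn_const.mul hVsq).add (continuousOn_const.mul hVV'))
  · have h1 : |inner ℝ (V y) (V' y)| ≤ ‖V y‖ * ‖V' y‖ := abs_real_inner_le_norm _ _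
    have h2 : (y - b) * F' y ≤ (b - a) * (2 * (‖V y‖ * ‖V' y‖)) := by
      refine (le_abs_self _).trans ?_
      rw [abs_mul, hF', abs_mul, abs_two]
      refine mul_le_mul ?_ (by linarith) (by positivity) hpos.le
      rw [abs_le]
      constructor <;> linarith [hy.1, hy.2]
    rw [mul_add, mul_inv_cancel_left₀ hpos.ne']
    linarith

/-- The weights in the large sieve inequality are dominated by powers of `y` on the corresponding
intervals. -/
lemma sieveWeight_le {β : ℝ} (hβ : 0 < β) {d c D n : ℕ} (hd : 1 ≤ d) (hcd : c ≤ d) (hcD : c ≤ D)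
    (hD : 1 ≤ D) (hn : 1 ≤ n) {y : ℝ} (hy : (D : ℝ) * n ≤ y) :
    sieveWeight β d c n * (D : ℝ)⁻¹ ≤ y ^ (2 * β) + y ^ (1 + 2 * β) / d ∧
      sieveWeight β d c n ≤ 2 * y ^ (1 + 2 * β) := by
  have hn1 : (1 : ℝ) ≤ n := by exact_mod_cast hn
  have hD1 : (1 : ℝ) ≤ D := by exact_mod_cast hD
  have hd1 : (1 : ℝ) ≤ d := by exact_mod_cast hd
  have hcd' : (c : ℝ) ≤ d := by exact_mod_cast hcd
  have hcD' : (c : ℝ) ≤ D := by exact_mod_cast hcD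
  have hc0 : (0 : ℝ) ≤ c := Nat.cast_nonneg c
  have hny : (n : ℝ) ≤ y := by nlinarith
  have hcny : (c : ℝ) * n ≤ y := by nlinarith
  have hy1 : 1 ≤ y := hn1.trans hny
  have h1 : (n : ℝ) ^ β ≤ y ^ (2 * β) :=
    (Real.rpow_le_rpow (by linarith) hny hβ.le).trans
      (Real.rpow_le_rpow_of_exponent_le hy1 (by linarith))
  have h2 : (c : ℝ) * (n : ℝ) ^ (1 + 2 * β) ≤ y ^ (1 + 2 * β) := by
    rw [Real.rpow_add (by linarith), Real.rpow_one, Real.rpow_add (by linarith), Real.rpow_one,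
      ← mul_assoc]
    exact mul_le_mul hcny (Real.rpow_le_rpow (by linarith) hny (by linarith)) (by positivity)
      (by linarith)
  have h3 : (c : ℝ) * (n : ℝ) ^ β ≤ y ^ (1 + 2 * β) := by
    refine le_trans (mul_le_mul_of_nonneg_left ?_ hc0) h2
    exact Real.rpow_le_rpow_of_exponent_le hn1 (by linarith)
  have hcD1 : (c : ℝ) * (D : ℝ)⁻¹ ≤ 1 := by
    rw [mul_inv_le_iff₀ (by linarith), one_mul]; exact hcD'
  have hcd1 : (c : ℝ) / d ≤ 1 := by
    rw [div_le_one (by linarith)]; exact hcd'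
  rw [sieveWeight]
  constructor
  · calc (c : ℝ) * ((n : ℝ) ^ β + (c : ℝ) / d * (n : ℝ) ^ (1 + 2 * β)) * (D : ℝ)⁻¹
        = ((c : ℝ) * (D : ℝ)⁻¹) * ((n : ℝ) ^ β + (c * (n : ℝ) ^ (1 + 2 * β)) / d) := by ring
      _ ≤ 1 * ((n : ℝ) ^ β + (c * (n : ℝ) ^ (1 + 2 * β)) / d) :=
          mul_le_mul_of_nonneg_right hcD1 (by positivity)
      _ ≤ _ := by
          rw [one_mul]
          exact add_le_add h1 (div_le_div_of_nonneg_right h2 (by linarith))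
  · calc (c : ℝ) * ((n : ℝ) ^ β + (c : ℝ) / d * (n : ℝ) ^ (1 + 2 * β))
        = (c : ℝ) * (n : ℝ) ^ β + (c : ℝ) / d * (c * (n : ℝ) ^ (1 + 2 * β)) := by ring
      _ ≤ y ^ (1 + 2 * β) + 1 * y ^ (1 + 2 * β) :=
          add_le_add h3 (mul_le_mul hcd1 h2 (by positivity) (by norm_num))
      _ = _ := by ring

lemma sum_sieveWeight_mul_le {β : ℝ} (hβ : 0 < β) {d c D : ℕ} (hd : 1 ≤ d) (hcd : c ≤ d)
    (hcD : c ≤ D) (hD : 1 ≤ D) {V V' : ℝ → ℂ} (hV : ∀ y, 0 < y → HasDerivAt V (V' y) y)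
    (hV' : ContinuousOn V' (Set.Ioi 0)) {A : ℝ} (hA : 0 < A)
    (h1 : IntegrableOn (fun y => y ^ (2 * β) * ‖V y‖ ^ 2) (Set.Ioi 0))
    (h2 : IntegrableOn (fun y => y ^ (1 + 2 * β) * ‖V y‖ ^ 2) (Set.Ioi 0))
    (h3 : IntegrableOn (fun y => y ^ (1 / 3 + 2 * β) * ‖V y‖ ^ 2) (Set.Ioi 0))
    (h4 : IntegrableOn (fun y => y ^ (-(1 / 3) + 2 * β) * ‖y * V' y‖ ^ 2) (Set.Ioi 0)) (N : ℕ) :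
    ∑ n ∈ Finset.Icc 1 N, sieveWeight β d c n * ‖V (D * n : ℕ)‖ ^ 2 ≤
      (∫ y in Set.Ioi 0, y ^ (2 * β) * ‖V y‖ ^ 2) +
        (∫ y in Set.Ioi 0, y ^ (1 + 2 * β) * ‖V y‖ ^ 2) / d +
        2 * A * (∫ y in Set.Ioi 0, y ^ (1 / 3 + 2 * β) * ‖V y‖ ^ 2) +
        2 * A⁻¹ * ∫ y in Set.Ioi 0, y ^ (-(1 / 3) + 2 * β) * ‖y * V' y‖ ^ 2 := by
  have hD0 : (0 : ℝ) < D := by exact_mod_cast hD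
  set G : ℝ → ℝ := fun y => y ^ (2 * β) * ‖V y‖ ^ 2 + (y ^ (1 + 2 * β) * ‖V y‖ ^ 2) / d +
    2 * A * (y ^ (1 / 3 + 2 * β) * ‖V y‖ ^ 2) + 2 * A⁻¹ * (y ^ (-(1 / 3) + 2 * β) * ‖y * V' y‖ ^ 2)
    with hG
  have i2 : IntegrableOn (fun y => (y ^ (1 + 2 * β) * ‖V y‖ ^ 2) / (d : ℝ)) (Set.Ioi 0) :=
    h2.div_const _
  have i12 : IntegrableOn (fun y => y ^ (2 * β) * ‖V y‖ ^ 2 +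
      (y ^ (1 + 2 * β) * ‖V y‖ ^ 2) / d) (Set.Ioi 0) := h1.add i2
  have i3 : IntegrableOn (fun y => 2 * A * (y ^ (1 / 3 + 2 * β) * ‖V y‖ ^ 2)) (Set.Ioi 0) :=
    h3.const_mul _
  have i123 : IntegrableOn (fun y => y ^ (2 * β) * ‖V y‖ ^ 2 +
      (y ^ (1 + 2 * β) * ‖V y‖ ^ 2) / d + 2 * A * (y ^ (1 / 3 + 2 * β) * ‖V y‖ ^ 2))
      (Set.Ioi 0) := i12.add i3
  have i4 : IntegrableOn (fun y => 2 * A⁻¹ * (y ^ (-(1 / 3) + 2 * β) * ‖y * V' y‖ ^ 2))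
      (Set.Ioi 0) := h4.const_mul _
  have hGint : IntegrableOn G (Set.Ioi 0) := i123.add i4
  have hGeq : ∫ y in Set.Ioi 0, G y = (∫ y in Set.Ioi 0, y ^ (2 * β) * ‖V y‖ ^ 2) +
        (∫ y in Set.Ioi 0, y ^ (1 + 2 * β) * ‖V y‖ ^ 2) / d +
        2 * A * (∫ y in Set.Ioi 0, y ^ (1 / 3 + 2 * β) * ‖V y‖ ^ 2) +
        2 * A⁻¹ * ∫ y in Set.Ioi 0, y ^ (-(1 / 3) + 2 * β) * ‖y * V' y‖ ^ 2 := by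
    simp only [hG]
    rw [integral_add i123 i4, integral_add i12 i3, integral_add h1 i2, integral_div,
      integral_const_mul, integral_const_mul]
  rw [← hGeq]
  have hVc : ContinuousOn V (Set.Ioi 0) := fun y hy => (hV y hy).continuousAt.continuousWithinAt
  have hpos : ∀ n ∈ Finset.Icc 1 N, (0 : ℝ) < D * n := fun n hn => by
    have : (0 : ℝ) < n := by exact_mod_cast (Finset.mem_Icc.1 hn).1
    positivity
  have hle : ∀ n : ℕ, (D : ℝ) * n ≤ D * (n + 1 : ℕ) := fun n => by push_cast; nlinarith
  have hGi : ∀ n ∈ Finset.Icc 1 N, IntervalIntegrable G volume (D * n) (D * (n + 1 : ℕ)) :=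
    fun n hn => by
      rw [intervalIntegrable_iff_integrableOn_Ioc_of_le (hle n)]
      exact hGint.mono_set fun y hy => (hpos n hn).trans hy.1
  have hterm : ∀ n ∈ Finset.Icc 1 N, sieveWeight β d c n * ‖V (D * n : ℕ)‖ ^ 2 ≤
      ∫ y in (D * n : ℝ)..(D * (n + 1 : ℕ) : ℝ), G y := fun n hn => by
    have hn1 := (Finset.mem_Icc.1 hn).1
    have hlt : (D : ℝ) * n < D * (n + 1 : ℕ) := by push_cast; nlinarith
    have hsub : Set.Icc ((D : ℝ) * n) (D * (n + 1 : ℕ)) ⊆ Set.Ioi 0 := fun y hy =>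
      (hpos n hn).trans_le hy.1
    have hS := norm_sq_le_integral_add hlt (fun y hy => hV y (hsub hy)) (hV'.mono hsub)
    rw [Nat.cast_mul]
    refine (mul_le_mul_of_nonneg_left hS (sieveWeight_nonneg _ _ _ _)).trans ?_
    rw [← intervalIntegral.integral_const_mul]
    refine intervalIntegral.integral_mono_on (hle n) ?_ (hGi n hn) fun y hy => ?_
    · refine ContinuousOn.intervalIntegrable ?_
      rw [Set.uIcc_of_le (hle n)]
      have hVc' := hVc.mono hsub
      exact continuousOn_const.mul ((continuousOn_const.mul (hVc'.norm.pow 2)).add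
        (continuousOn_const.mul (hVc'.norm.mul (hV'.mono hsub).norm)))
    · have hy0 : 0 < y := hsub hy
      obtain ⟨hw1, hw2⟩ := sieveWeight_le hβ hd hcd hcD hD hn1 hy.1
      have e1 : (D * (n + 1 : ℕ) - D * n : ℝ) = D := by push_cast; ring
      rw [e1]
      have e2 : y ^ (1 + 2 * β) = y * y ^ (2 * β) := by
        rw [Real.rpow_add hy0, Real.rpow_one]
      set a := y ^ ((1 : ℝ) / 3) with ha
      have ha0 : 0 < a := Real.rpow_pos_of_pos hy0 _
      have e3 : y ^ (1 / 3 + 2 * β) = a * y ^ (2 * β) := Real.rpow_add hy0 _ _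
      have e4 : y ^ (-(1 / 3) + 2 * β) = a⁻¹ * y ^ (2 * β) := by
        rw [Real.rpow_add hy0, Real.rpow_neg hy0.le]
      have e5 : ‖(y : ℂ) * V' y‖ = y * ‖V' y‖ := by
        rw [norm_mul, Complex.norm_real, Real.norm_of_nonneg hy0.le]
      set v := ‖V y‖
      set v' := ‖V' y‖
      have hv : 0 ≤ v := norm_nonneg _
      have hv' : 0 ≤ v' := norm_nonneg _
      have hp : 0 ≤ y ^ (2 * β) := by positivity
      have hamgm : 4 * (y * v * v') ≤ 2 * A * (a * v ^ 2) + 2 * A⁻¹ * (a⁻¹ * (y * v') ^ 2) := by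
        have h0 : 0 < A * a := by positivity
        have : 2 * A * (a * v ^ 2) + 2 * A⁻¹ * (a⁻¹ * (y * v') ^ 2) - 4 * (y * v * v') =
            2 * (A * a)⁻¹ * (A * a * v - y * v') ^ 2 := by
          field_simp; ring
        have h5 : 0 ≤ 2 * (A * a)⁻¹ * (A * a * v - y * v') ^ 2 := by positivity
        linarith
      calc sieveWeight β d c n * ((D : ℝ)⁻¹ * v ^ 2 + 2 * (v * v'))
          = (sieveWeight β d c n * (D : ℝ)⁻¹) * v ^ 2 + sieveWeight β d c n * (2 * (v * v')) := by
            ring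
        _ ≤ (y ^ (2 * β) + y ^ (1 + 2 * β) / d) * v ^ 2 +
            (2 * y ^ (1 + 2 * β)) * (2 * (v * v')) :=
            add_le_add (mul_le_mul_of_nonneg_right hw1 (by positivity))
              (mul_le_mul_of_nonneg_right hw2 (by positivity))
        _ = y ^ (2 * β) * v ^ 2 + (y ^ (1 + 2 * β) * v ^ 2) / d +
            y ^ (2 * β) * (4 * (y * v * v')) := by rw [e2]; ring
        _ ≤ y ^ (2 * β) * v ^ 2 + (y ^ (1 + 2 * β) * v ^ 2) / d +
            y ^ (2 * β) * (2 * A * (a * v ^ 2) + 2 * A⁻¹ * (a⁻¹ * (y * v') ^ 2)) := by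
            have := mul_le_mul_of_nonneg_left hamgm hp
            linarith
        _ = G y := by simp only [hG, e3, e4, e5]; ring
  have hG0 : ∀ y, 0 < y → 0 ≤ G y := fun y hy => by
    simp only [hG]; positivity
  refine (Finset.sum_le_sum hterm).trans ?_
  have hIco : Finset.Icc 1 N = Finset.Ico 1 (N + 1) := by
    ext n; simp only [Finset.mem_Icc, Finset.mem_Ico]; omega
  rw [hIco, intervalIntegral.sum_integral_adjacent_intervals_Ico
    (a := fun n : ℕ => (D : ℝ) * n) (by omega) fun n hn => hGi n (by
      rw [hIco]; exact Finset.mem_Ico.2 hn)]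
  rw [intervalIntegral.integral_of_le (by push_cast; nlinarith [(Nat.cast_nonneg N : (0 : ℝ) ≤ N)])]
  refine setIntegral_mono_set hGint ?_ ?_
  · exact (ae_restrict_iff' measurableSet_Ioi).2 (Filter.Eventually.of_forall fun y hy => hG0 y hy)
  · refine LE.le.eventuallyLE fun y hy => ?_
    have : (0 : ℝ) < D * (1 : ℕ) := by simpa using hD0
    exact this.trans hy.1

end

section

open MeasureTheory Set
open scoped FourierTransform

theorem integral_norm_sq_fourier_of_integrable {f : ℝ → ℂ} (hc : Continuous f) (hf : Integrable f)
    (hf' : Integrable (𝓕 f)) :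
    Integrable (fun ξ => ‖𝓕 f ξ‖ ^ 2) ∧ ∫ ξ, ‖𝓕 f ξ‖ ^ 2 = ∫ t, ‖f t‖ ^ 2 := by
  have hcont : Continuous (𝓕 f) :=
    VectorFourier.fourierIntegral_continuous Real.continuous_fourierChar
      (L := innerₗ ℝ) continuous_inner hf
  constructor
  · have h1 : ∀ ξ, ‖𝓕 f ξ‖ ≤ ∫ t, ‖f t‖ := fun ξ =>
      VectorFourier.norm_fourierIntegral_le_integral_norm Real.fourierChar volume (innerₗ ℝ) f ξ
    refine Integrable.mono' (hf'.norm.const_mul (∫ t, ‖f t‖)) (by fun_prop)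
      (Filter.Eventually.of_forall fun ξ => ?_)
    rw [Real.norm_of_nonneg (by positivity), pow_two]
    exact mul_le_mul_of_nonneg_right (h1 ξ) (norm_nonneg _)
  · have h2 : ∫ ξ, (innerSL ℂ (𝓕 f ξ)) (𝓕 f ξ) = ∫ t, (innerSL ℂ (f t))
        (VectorFourier.fourierIntegral Real.fourierChar volume (-(innerₗ ℝ).flip) (𝓕 f) t) :=
      VectorFourier.integral_sesq_fourierIntegral_eq_neg_flip (innerSL ℂ)
        (L := innerₗ ℝ) (μ := volume) (ν := volume) Real.continuous_fourierChar continuous_inner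
        hf hf'
    have h3 : VectorFourier.fourierIntegral Real.fourierChar volume (-(innerₗ ℝ).flip) (𝓕 f) = f :=
      by simpa using! hc.fourierInv_fourier_eq hf hf'
    rw [h3] at h2
    have h4 : ∀ z : ℂ, (innerSL ℂ z) z = ((‖z‖ ^ 2 : ℝ) : ℂ) := fun z => by
      rw [innerSL_apply_apply, inner_self_eq_norm_sq_to_K]; push_cast; rfl
    have h5 : ∫ ξ, (((‖𝓕 f ξ‖ ^ 2 : ℝ)) : ℂ) = ∫ t, ((‖f t‖ ^ 2 : ℝ) : ℂ) := by
      simp_rw [h4] at h2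
      exact h2
    rw [integral_complex_ofReal, integral_complex_ofReal] at h5
    exact_mod_cast h5

lemma integrable_exp_neg_mul_abs {δ : ℝ} (hδ : 0 < δ) :
    Integrable fun u : ℝ => Real.exp (-(δ * |u|)) := by
  have h := exp_neg_integrableOn_Ioi 0 hδ
  simp only [neg_mul] at h
  exact integrable_comp_abs_of_integrableOn h

lemma image_exp_univ : Real.exp '' univ = Ioi 0 := by
  rw [image_univ, Real.range_exp]

lemma exp_rpow_sub_one (c u : ℝ) (r : ℝ) :
    Real.exp u * (Real.exp u ^ (2 * c - 1) * r ^ 2) = (Real.exp (c * u) * r) ^ 2 := by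
  rw [← Real.exp_mul, ← mul_assoc, ← Real.exp_add, mul_pow, ← Real.exp_nat_mul]
  congr 2
  push_cast
  ring

theorem integrableOn_rpow_mul_norm_sq_of_mellinInv {F : ℂ → ℂ} {V : ℝ → ℂ} {c δ : ℝ} (hδ : 0 < δ)
    (hF : ∀ c' ∈ Icc (c - δ) (c + δ), Integrable fun τ : ℝ => F (c' + τ * Complex.I))
    (hFc : Continuous fun τ : ℝ => F (c + τ * Complex.I))
    (hV : ∀ c' ∈ Icc (c - δ) (c + δ), ∀ y, 0 < y → V y = mellinInv c' F y) :
    IntegrableOn (fun y => y ^ (2 * c - 1) * ‖V y‖ ^ 2) (Ioi 0) ∧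
    ∫ y in Ioi 0, y ^ (2 * c - 1) * ‖V y‖ ^ 2 =
      1 / (2 * Real.pi) * ∫ τ : ℝ, ‖F (c + τ * Complex.I)‖ ^ 2 := by
  have hpi : (0 : ℝ) < 2 * Real.pi := by positivity
  have hmem : c ∈ Icc (c - δ) (c + δ) := ⟨by linarith, by linarith⟩
  have hnorm : ∀ c' ∈ Icc (c - δ) (c + δ), ∀ u : ℝ, Real.exp (c' * u) * ‖V (Real.exp u)‖ =
      ‖𝓕 (fun t : ℝ => F (c' + 2 * Real.pi * t * Complex.I)) u‖ := by
    intro c' hc' u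
    rw [hV c' hc' _ (Real.exp_pos u), mellinInv_eq_fourierInv _ _ (Real.exp_pos u), Real.log_exp,
      Real.fourierInv_eq_fourier_neg, neg_neg, norm_smul,
      Complex.norm_cpow_eq_rpow_re_of_pos (Real.exp_pos u), ← Real.exp_mul, ← mul_assoc,
      ← Real.exp_add]
    simp [mul_comm]
  have hint : ∀ c' ∈ Icc (c - δ) (c + δ),
      Integrable (fun t : ℝ => F (c' + 2 * Real.pi * t * Complex.I)) := by
    intro c' hc'
    have := (hF c' hc').comp_mul_left' hpi.ne'
    simpa using this
  set ψ := fun t : ℝ => F (c + 2 * Real.pi * t * Complex.I) with hψ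
  have hψc : Continuous ψ := by
    have := hFc.comp (continuous_const_mul (2 * Real.pi))
    simpa [Function.comp_def] using this
  have hcont : Continuous (𝓕 ψ) :=
    VectorFourier.fourierIntegral_continuous Real.continuous_fourierChar
      (L := innerₗ ℝ) continuous_inner (hint c hmem)
  have hbd : ∀ c' ∈ Icc (c - δ) (c + δ), ∃ M, 0 ≤ M ∧ ∀ u,
      Real.exp (c' * u) * ‖V (Real.exp u)‖ ≤ M := fun c' hc' =>
    ⟨∫ t : ℝ, ‖F (c' + 2 * Real.pi * t * Complex.I)‖, by positivity, fun u => by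
      rw [hnorm c' hc']
      exact VectorFourier.norm_fourierIntegral_le_integral_norm Real.fourierChar volume
        (innerₗ ℝ) _ u⟩
  obtain ⟨M₁, hM₁, h1⟩ := hbd (c - δ) ⟨le_rfl, by linarith⟩
  obtain ⟨M₂, hM₂, h2⟩ := hbd (c + δ) ⟨by linarith, le_rfl⟩
  have hFint : Integrable (𝓕 ψ) := by
    refine Integrable.mono' ((integrable_exp_neg_mul_abs hδ).const_mul (M₁ + M₂))
      hcont.aestronglyMeasurable (Filter.Eventually.of_forall fun u => ?_)
    rw [← hnorm c hmem]
    rcases le_total 0 u with hu | hu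
    · have : Real.exp (c * u) = Real.exp ((c + δ) * u) * Real.exp (-(δ * |u|)) := by
        rw [← Real.exp_add, abs_of_nonneg hu]; ring_nf
      rw [this, mul_right_comm]
      exact mul_le_mul_of_nonneg_right ((h2 u).trans (by linarith)) (Real.exp_pos _).le
    · have : Real.exp (c * u) = Real.exp ((c - δ) * u) * Real.exp (-(δ * |u|)) := by
        rw [← Real.exp_add, abs_of_nonpos hu]; ring_nf
      rw [this, mul_right_comm]
      exact mul_le_mul_of_nonneg_right ((h1 u).trans (by linarith)) (Real.exp_pos _).le
  obtain ⟨hI, hE⟩ := integral_norm_sq_fourier_of_integrable hψc (hint c hmem) hFint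
  have hder : ∀ u ∈ (univ : Set ℝ), HasDerivWithinAt Real.exp (Real.exp u) univ u :=
    fun u _ => (Real.hasDerivAt_exp u).hasDerivWithinAt
  have hinj : InjOn Real.exp univ := Real.exp_injective.injOn
  have hfun : ∀ u, |Real.exp u| • (Real.exp u ^ (2 * c - 1) * ‖V (Real.exp u)‖ ^ 2) =
      ‖𝓕 ψ u‖ ^ 2 := by
    intro u
    rw [abs_of_pos (Real.exp_pos u), smul_eq_mul, exp_rpow_sub_one, hnorm c hmem]
  constructor
  · rw [← image_exp_univ, integrableOn_image_iff_integrableOn_abs_deriv_smul MeasurableSet.univ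
      hder hinj, integrableOn_univ]
    simpa only [hfun] using hI
  · rw [← image_exp_univ, integral_image_eq_integral_abs_deriv_smul MeasurableSet.univ hder hinj]
    simp only [hfun, setIntegral_univ]
    rw [hE, hψ]
    have := Measure.integral_comp_mul_left (fun τ : ℝ => ‖F (c + τ * Complex.I)‖ ^ 2) (2 * Real.pi)
    simp only [Complex.ofReal_mul, Complex.ofReal_ofNat] at this
    rw [this, abs_of_pos (by positivity), smul_eq_mul, one_div]

end

section

open MeasureTheory Set

lemma norm_cpow_neg_add_mul_I {y : ℝ} (hy : 0 < y) (c τ : ℝ) :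
    ‖(y : ℂ) ^ (-(c + τ * Complex.I : ℂ))‖ = y ^ (-c) := by
  rw [Complex.norm_cpow_eq_rpow_re_of_pos hy]; simp

theorem hasDerivAt_mellinInv {F : ℂ → ℂ} {c : ℝ} (hc : 0 < c)
    (h0 : Integrable fun τ : ℝ => F (c + τ * Complex.I))
    (h1 : Integrable fun τ : ℝ => -(c + τ * Complex.I) * F (c + τ * Complex.I))
    {y : ℝ} (hy : 0 < y) :
    HasDerivAt (mellinInv c F) ((y : ℂ)⁻¹ * mellinInv c (fun z => -z * F z) y) y := by
  have hcont : ∀ t : ℝ, 0 < t →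
      Continuous fun τ : ℝ => (t : ℂ) ^ (-(c + τ * Complex.I : ℂ)) := fun t ht =>
    Continuous.const_cpow (by fun_prop) (Or.inl (by exact_mod_cast ht.ne'))
  have hpt : ∀ τ t : ℝ, 0 < t → HasDerivAt
      (fun t : ℝ => (t : ℂ) ^ (-(c + τ * Complex.I : ℂ)) • F (c + τ * Complex.I))
      ((t : ℂ)⁻¹ * ((t : ℂ) ^ (-(c + τ * Complex.I : ℂ)) *
        (-(c + τ * Complex.I) * F (c + τ * Complex.I)))) t := by
    intro τ t ht
    have ht' : (t : ℂ) ≠ 0 := by exact_mod_cast ht.ne'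
    have h2 : HasDerivAt (fun u : ℂ => u ^ (-(c + τ * Complex.I : ℂ)))
        (-(c + τ * Complex.I : ℂ) * (t : ℂ) ^ (-(c + τ * Complex.I : ℂ) - 1)) (t : ℂ) := by
      simpa using (hasDerivAt_id (t : ℂ)).cpow_const (c := -(c + τ * Complex.I : ℂ))
        (Or.inl (by simpa using ht))
    have h3 := h2.comp_ofReal.mul_const (F (c + τ * Complex.I))
    refine h3.congr_deriv ?_
    rw [Complex.cpow_sub _ _ ht', Complex.cpow_one]
    field_simp
  have key := hasDerivAt_integral_of_dominated_loc_of_deriv_le (μ := (volume : Measure ℝ))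
    (F := fun (t : ℝ) (τ : ℝ) => (t : ℂ) ^ (-(c + τ * Complex.I : ℂ)) • F (c + τ * Complex.I))
    (F' := fun (t : ℝ) (τ : ℝ) => (t : ℂ)⁻¹ * ((t : ℂ) ^ (-(c + τ * Complex.I : ℂ)) *
        (-(c + τ * Complex.I) * F (c + τ * Complex.I))))
    (x₀ := y) (s := Ioi (y / 2))
    (bound := fun τ : ℝ => ((y / 2)⁻¹ * (y / 2) ^ (-c)) *
      ‖-(c + τ * Complex.I) * F (c + τ * Complex.I)‖)
    (Ioi_mem_nhds (by linarith)) ?_ ?_ ?_ ?_ (h1.norm.const_mul _) ?_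
  · have h4 := key.2.const_smul (1 / (2 * Real.pi))
    unfold mellinInv
    refine h4.congr_deriv ?_
    rw [integral_const_mul, mul_smul_comm]
    simp only [smul_eq_mul]
  · filter_upwards [Ioi_mem_nhds hy] with t ht
    exact (hcont t ht).aestronglyMeasurable.smul h0.aestronglyMeasurable
  · refine Integrable.mono' (h0.norm.const_mul (y ^ (-c)))
      ((hcont y hy).aestronglyMeasurable.smul h0.aestronglyMeasurable)
      (Filter.Eventually.of_forall fun τ => ?_)
    rw [norm_smul, norm_cpow_neg_add_mul_I hy]
  · exact (((hcont y hy).aestronglyMeasurable.mul h1.aestronglyMeasurable).const_mul _)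
  · refine Filter.Eventually.of_forall fun τ t ht => ?_
    have hy2 : 0 < y / 2 := by linarith
    have ht0 : 0 < t := hy2.trans ht
    rw [norm_mul, norm_mul, norm_cpow_neg_add_mul_I ht0, ← mul_assoc, norm_inv,
      Complex.norm_of_nonneg ht0.le]
    refine mul_le_mul_of_nonneg_right ?_ (norm_nonneg _)
    refine mul_le_mul (inv_anti₀ hy2 (le_of_lt ht)) ?_ (by positivity) (by positivity)
    exact Real.rpow_le_rpow_of_nonpos hy2 (le_of_lt ht) (by linarith)
  · exact Filter.Eventually.of_forall fun τ t ht => hpt τ t ((by linarith : 0 < y / 2).trans ht)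

namespace IsCutoff
variable {Cd : ℕ → ℝ} {x Y : ℝ} {w : ℝ → ℝ} {d : ℕ} {κ : ℝ}

lemma voronoiTransform_eq_mellinInv (h : IsCutoff Cd x Y w) (hd : d ≠ 0) (hκ : |κ| ≤ 3) {c : ℝ}
    (hc : 0 < c) (hc' : c ≤ 3 / 2) {y : ℝ} (hy : 0 < y) :
    voronoiTransform d w κ y = mellinInv c (voronoiKernel d w κ) y := by
  rw [h.voronoiTransform_eq hd hκ hc hc' hy, mellinInv, Complex.real_smul]
  simp [mul_comm]

lemma integrable_pow_mul_voronoiKernel (h : IsCutoff Cd x Y w) (hd : d ≠ 0) (hκ : |κ| ≤ 3) {c : ℝ}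
    (hc : 0 < c) (hc' : c ≤ 3 / 2) (j : ℕ) :
    Integrable fun τ : ℝ => (-(c + τ * Complex.I)) ^ j *
      voronoiKernel d w κ (c + τ * Complex.I) := by
  obtain ⟨M, hM0, hM⟩ := h.exists_norm_voronoiKernel_le hd hc hc' (j + 2)
  have hcont := h.continuous_voronoiKernel hd κ hc
  refine integrable_of_norm_mul_sq_le (M := 2 ^ j * M) (by fun_prop) fun τ => ?_
  have h1 : ‖(-(c + τ * Complex.I) : ℂ)‖ ≤ 2 * (1 + |τ|) := by
    rw [norm_neg]
    refine (norm_add_le _ _).trans ?_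
    rw [norm_mul, Complex.norm_real, Complex.norm_real, Complex.norm_I, Real.norm_eq_abs,
      Real.norm_eq_abs, abs_of_pos hc]
    linarith [abs_nonneg τ]
  rw [norm_mul, norm_pow]
  calc _ ≤ (2 * (1 + |τ|)) ^ j * ‖voronoiKernel d w κ (c + τ * Complex.I)‖ * (1 + |τ|) ^ 2 := by
        gcongr
    _ = 2 ^ j * (‖voronoiKernel d w κ (c + τ * Complex.I)‖ * (1 + |τ|) ^ (j + 2)) := by
        rw [mul_pow]; ring
    _ ≤ _ := by gcongr; exact hM κ hκ τ

lemma hasDerivAt_voronoiTransform (h : IsCutoff Cd x Y w) (hd : d ≠ 0) (hκ : |κ| ≤ 3) {c : ℝ}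
    (hc : 0 < c) (hc' : c ≤ 3 / 2) {y : ℝ} (hy : 0 < y) :
    HasDerivAt (voronoiTransform d w κ)
      ((y : ℂ)⁻¹ * mellinInv c (fun z => -z * voronoiKernel d w κ z) y) y := by
  refine (hasDerivAt_mellinInv hc (h.integrable_voronoiKernel hd hκ hc hc')
    (by simpa using h.integrable_pow_mul_voronoiKernel hd hκ hc hc' 1) hy).congr_of_eventuallyEq ?_
  filter_upwards [Ioi_mem_nhds hy] with t ht
  exact h.voronoiTransform_eq_mellinInv hd hκ hc hc' ht

lemma mul_deriv_voronoiTransform (h : IsCutoff Cd x Y w) (hd : d ≠ 0) (hκ : |κ| ≤ 3) {c : ℝ}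
    (hc : 0 < c) (hc' : c ≤ 3 / 2) {y : ℝ} (hy : 0 < y) :
    y * deriv (voronoiTransform d w κ) y = mellinInv c (fun z => -z * voronoiKernel d w κ z) y := by
  have : (y : ℂ) ≠ 0 := by exact_mod_cast hy.ne'
  rw [(h.hasDerivAt_voronoiTransform hd hκ hc hc' hy).deriv, mul_inv_cancel_left₀ this]

lemma continuousOn_deriv_voronoiTransform (h : IsCutoff Cd x Y w) (hd : d ≠ 0) (hκ : |κ| ≤ 3) :
    ContinuousOn (deriv (voronoiTransform d w κ)) (Ioi 0) := by
  have h1 : ContinuousOn (fun y : ℝ => (y : ℂ)⁻¹ *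
      mellinInv 1 (fun z => -z * voronoiKernel d w κ z) y) (Ioi 0) := by
    refine ContinuousOn.mul (ContinuousOn.inv₀ (by fun_prop) fun y hy => ?_) fun y hy => ?_
    · exact_mod_cast (ne_of_gt hy)
    · refine ((hasDerivAt_mellinInv one_pos ?_ ?_ hy).continuousAt).continuousWithinAt
      · simpa using h.integrable_pow_mul_voronoiKernel hd hκ one_pos (by norm_num) 1
      · refine (h.integrable_pow_mul_voronoiKernel hd hκ one_pos (by norm_num) 2).congr
          (Filter.Eventually.of_forall fun τ => ?_)
        simp only
        ring
  exact h1.congr fun y hy => (h.hasDerivAt_voronoiTransform hd hκ one_pos (by norm_num) hy).deriv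

lemma integral_norm_sq_voronoiTransform (h : IsCutoff Cd x Y w) (hd : d ≠ 0) (hκ : |κ| ≤ 3) {c : ℝ}
    (hc : 0 < c) (hc' : c < 3 / 2) :
    IntegrableOn (fun y => y ^ (2 * c - 1) * ‖voronoiTransform d w κ y‖ ^ 2) (Ioi 0) ∧
    ∫ y in Ioi 0, y ^ (2 * c - 1) * ‖voronoiTransform d w κ y‖ ^ 2 =
      1 / (2 * Real.pi) * ∫ τ : ℝ, ‖voronoiKernel d w κ (c + τ * Complex.I)‖ ^ 2 := by
  have hδ : 0 < min (c / 2) (3 / 2 - c) := lt_min (by linarith) (by linarith)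
  have hmem : ∀ c' ∈ Icc (c - min (c / 2) (3 / 2 - c)) (c + min (c / 2) (3 / 2 - c)),
      0 < c' ∧ c' ≤ 3 / 2 := fun c' hc' =>
    ⟨by linarith [hc'.1, min_le_left (c / 2) (3 / 2 - c)],
      by linarith [hc'.2, min_le_right (c / 2) (3 / 2 - c)]⟩
  exact integrableOn_rpow_mul_norm_sq_of_mellinInv hδ
    (fun c' hc' => h.integrable_voronoiKernel hd hκ (hmem c' hc').1 (hmem c' hc').2)
    (h.continuous_voronoiKernel hd κ hc)
    (fun c' hc' y hy => h.voronoiTransform_eq_mellinInv hd hκ (hmem c' hc').1 (hmem c' hc').2 hy)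

lemma integral_norm_sq_deriv_voronoiTransform (h : IsCutoff Cd x Y w) (hd : d ≠ 0) (hκ : |κ| ≤ 3)
    {c : ℝ} (hc : 0 < c) (hc' : c < 3 / 2) :
    IntegrableOn (fun y : ℝ => y ^ (2 * c - 1) * ‖y * deriv (voronoiTransform d w κ) y‖ ^ 2)
      (Ioi 0) ∧
    ∫ y : ℝ in Ioi 0, y ^ (2 * c - 1) * ‖y * deriv (voronoiTransform d w κ) y‖ ^ 2 =
      1 / (2 * Real.pi) * ∫ τ : ℝ, ‖-(c + τ * Complex.I) *
        voronoiKernel d w κ (c + τ * Complex.I)‖ ^ 2 := by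
  have hδ : 0 < min (c / 2) (3 / 2 - c) := lt_min (by linarith) (by linarith)
  have hmem : ∀ c' ∈ Icc (c - min (c / 2) (3 / 2 - c)) (c + min (c / 2) (3 / 2 - c)),
      0 < c' ∧ c' ≤ 3 / 2 := fun c' hc' =>
    ⟨by linarith [hc'.1, min_le_left (c / 2) (3 / 2 - c)],
      by linarith [hc'.2, min_le_right (c / 2) (3 / 2 - c)]⟩
  have hcont := h.continuous_voronoiKernel hd κ hc
  exact integrableOn_rpow_mul_norm_sq_of_mellinInv (F := fun z => -z * voronoiKernel d w κ z)
    (V := fun y : ℝ => y * deriv (voronoiTransform d w κ) y) hδ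
    (fun c' hc' => by
      simpa using h.integrable_pow_mul_voronoiKernel hd hκ (hmem c' hc').1 (hmem c' hc').2 1)
    (by fun_prop)
    (fun c' hc' y hy => h.mul_deriv_voronoiTransform hd hκ (hmem c' hc').1 (hmem c' hc').2 hy)

end IsCutoff

end

section

open MeasureTheory Set

namespace IsCutoff

theorem exists_norm_sq_voronoiKernel_le (Cd : ℕ → ℝ) {c : ℝ} (hc : 0 < c) (hc' : c ≤ 3 / 2)
    (hc1 : c ≠ 1) : ∃ C : ℝ, 0 < C ∧ ∀ {x Y : ℝ} {w : ℝ → ℝ} {d : ℕ} {κ : ℝ},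
      IsCutoff Cd x Y w → d ≠ 0 → |κ| ≤ 3 → ∀ τ : ℝ,
      ‖voronoiKernel d w κ (c + τ * Complex.I)‖ ^ 2 ≤
        C * ((d : ℝ) ^ (6 * c - 6) * x ^ (2 * max (1 - c) 0)) *
          ((1 + |τ|) ^ (6 * c - 5) * min 1 ((x / Y / (1 + |τ|)) ^ 3) ^ 2) := by
  obtain ⟨K, hK0, hK⟩ := exists_norm_dualGamma_le hc hc'
  refine ⟨(256 * (Cd 1 + Cd 4) / |1 - c|) ^ 2 * K ^ 2 + 1, by positivity,
    fun {x Y w d κ} h hd hκ τ => ?_⟩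
  have hY : 0 < Y := by linarith [h.one_le]
  have hx : 0 < x := hY.trans_le h.le
  have hC1 := h.const_nonneg 1
  have hC4 := h.const_nonneg 4
  have hd0 : (0 : ℝ) < d := by exact_mod_cast Nat.pos_of_ne_zero hd
  have ht : 0 < 1 + |τ| := by positivity
  have h1 := h.norm_mellinDeriv_zero_le (σ := 1 - c) (by linarith) (sub_ne_zero.mpr hc1.symm)
    (by linarith) (-τ)
  have h1' : (((1 - c : ℝ) : ℂ) + ((-τ : ℝ) : ℂ) * Complex.I) = 1 - (c + τ * Complex.I) := by
    push_cast; ring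
  rw [h1', abs_neg] at h1
  set B := 256 * (Cd 1 + Cd 4) / |1 - c| with hB
  set m := min 1 ((x / Y / (1 + |τ|)) ^ 3) with hm
  have hm0 : 0 ≤ m := by rw [hm]; positivity
  have h4 : ‖(d : ℂ) ^ ((c + τ * Complex.I : ℂ) - 1)‖ = (d : ℝ) ^ (c - 1) := by
    rw [Complex.norm_natCast_cpow_of_pos (Nat.pos_of_ne_zero hd)]; simp
  have hd6 : (((d : ℝ) ^ (c - 1)) ^ 3) ^ 2 = (d : ℝ) ^ (6 * c - 6) := by
    rw [← pow_mul, ← Real.rpow_mul_natCast hd0.le]; congr 1; push_cast; ring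
  have hx2 : (x ^ max (1 - c) 0) ^ 2 = x ^ (2 * max (1 - c) 0) := by
    rw [← Real.rpow_mul_natCast hx.le]; congr 1; push_cast; ring
  have ht2 : ((1 + |τ|)⁻¹) ^ 2 * ((1 + |τ|) ^ (3 * c - 3 / 2)) ^ 2 = (1 + |τ|) ^ (6 * c - 5) := by
    rw [← Real.rpow_neg_one, ← Real.rpow_mul_natCast ht.le, ← Real.rpow_mul_natCast ht.le,
      ← Real.rpow_add ht]
    congr 1; push_cast; ring
  rw [voronoiKernel, norm_mul, norm_mul, norm_pow, h4, mul_pow, mul_pow, hd6]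
  have h1s := pow_le_pow_left₀ (norm_nonneg _) h1 2
  have h2s := pow_le_pow_left₀ (norm_nonneg _) (hK κ hκ τ) 2
  have hpos : 0 ≤ (d : ℝ) ^ (6 * c - 6) * x ^ (2 * max (1 - c) 0) *
      ((1 + |τ|) ^ (6 * c - 5) * m ^ 2) := by positivity
  calc _ ≤ (B * x ^ max (1 - c) 0 * (1 + |τ|)⁻¹ * m) ^ 2 * (d : ℝ) ^ (6 * c - 6) *
        (K * (1 + |τ|) ^ (3 * c - 3 / 2)) ^ 2 := by gcongr
    _ = B ^ 2 * K ^ 2 * ((d : ℝ) ^ (6 * c - 6) * x ^ (2 * max (1 - c) 0) *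
          ((1 + |τ|) ^ (6 * c - 5) * m ^ 2)) := by
        rw [← hx2, ← ht2]; ring
    _ ≤ (B ^ 2 * K ^ 2 + 1) * ((d : ℝ) ^ (6 * c - 6) * x ^ (2 * max (1 - c) 0) *
          ((1 + |τ|) ^ (6 * c - 5) * m ^ 2)) := by nlinarith
    _ = _ := by ring

lemma exists_integral_le_of_le_rpow_mul_min {q : ℝ} (hq : -1 < q) (hq' : q < 5) :
    ∃ K : ℝ, 0 < K ∧ ∀ X : ℝ, 1 ≤ X → ∀ B : ℝ, 0 ≤ B → ∀ f : ℝ → ℝ, (∀ τ, 0 ≤ f τ) →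
      (∀ τ, f τ ≤ B * ((1 + |τ|) ^ q * min 1 ((X / (1 + |τ|)) ^ 3) ^ 2)) →
      ∫ τ, f τ ≤ K * (B * X ^ (q + 1)) := by
  obtain ⟨K, hK0, hK⟩ := exists_integral_rpow_mul_min_le hq hq'
  refine ⟨K, hK0, fun X hX B hB f hf hfB => ?_⟩
  refine (integral_mono_of_nonneg (Filter.Eventually.of_forall hf) ((hK X hX).1.const_mul B)
    (Filter.Eventually.of_forall hfB)).trans ?_
  rw [integral_const_mul]
  calc _ ≤ B * (K * X ^ (q + 1)) := by gcongr; exact (hK X hX).2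
    _ = _ := by ring

theorem exists_integral_norm_sq_voronoiTransform_le (Cd : ℕ → ℝ) {c q : ℝ} (hc : 0 < c)
    (hc' : c < 3 / 2) (hc1 : c ≠ 1) (hq : -1 < q) (hq' : q < 5) (hcq : 6 * c - 5 ≤ q) :
    ∃ C : ℝ, 0 < C ∧ ∀ {x Y : ℝ} {w : ℝ → ℝ} {d : ℕ} {κ : ℝ},
      IsCutoff Cd x Y w → d ≠ 0 → |κ| ≤ 3 →
      ∫ y in Ioi 0, y ^ (2 * c - 1) * ‖voronoiTransform d w κ y‖ ^ 2 ≤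
        C * ((d : ℝ) ^ (6 * c - 6) * x ^ (2 * max (1 - c) 0) * (x / Y) ^ (q + 1)) := by
  obtain ⟨C, hC0, hC⟩ := exists_norm_sq_voronoiKernel_le Cd hc hc'.le hc1
  obtain ⟨K, hK0, hK⟩ := exists_integral_le_of_le_rpow_mul_min hq hq'
  refine ⟨K * C, by positivity, fun {x Y w d κ} h hd hκ => ?_⟩
  have hY : 0 < Y := by linarith [h.one_le]
  have hx : 0 < x := hY.trans_le h.le
  have hX : 1 ≤ x / Y := (one_le_div hY).mpr h.le
  rw [(h.integral_norm_sq_voronoiTransform hd hκ hc hc').2]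
  have h1 := hK (x / Y) hX (C * ((d : ℝ) ^ (6 * c - 6) * x ^ (2 * max (1 - c) 0)))
    (by positivity) (fun τ => ‖voronoiKernel d w κ (c + τ * Complex.I)‖ ^ 2)
    (fun τ => by positivity) (fun τ => (hC h hd hκ τ).trans (by
      have : (1 : ℝ) ≤ 1 + |τ| := by linarith [abs_nonneg τ]
      gcongr))
  have h2 : 1 / (2 * Real.pi) ≤ 1 := by
    rw [div_le_one (by positivity)]; linarith [Real.pi_gt_three]
  calc _ ≤ 1 * ∫ τ : ℝ, ‖voronoiKernel d w κ (c + τ * Complex.I)‖ ^ 2 :=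
        mul_le_mul_of_nonneg_right h2 (integral_nonneg fun τ => by positivity)
    _ ≤ _ := (one_mul _).trans_le h1
    _ = _ := by ring

theorem exists_integral_norm_sq_deriv_voronoiTransform_le (Cd : ℕ → ℝ) {c q : ℝ} (hc : 0 < c)
    (hc' : c < 3 / 2) (hc1 : c ≠ 1) (hq : -1 < q) (hq' : q < 5) (hcq : 6 * c - 3 ≤ q) :
    ∃ C : ℝ, 0 < C ∧ ∀ {x Y : ℝ} {w : ℝ → ℝ} {d : ℕ} {κ : ℝ},
      IsCutoff Cd x Y w → d ≠ 0 → |κ| ≤ 3 →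
      ∫ y : ℝ in Ioi 0, y ^ (2 * c - 1) * ‖y * deriv (voronoiTransform d w κ) y‖ ^ 2 ≤
        C * ((d : ℝ) ^ (6 * c - 6) * x ^ (2 * max (1 - c) 0) * (x / Y) ^ (q + 1)) := by
  obtain ⟨C, hC0, hC⟩ := exists_norm_sq_voronoiKernel_le Cd hc hc'.le hc1
  obtain ⟨K, hK0, hK⟩ := exists_integral_le_of_le_rpow_mul_min hq hq'
  refine ⟨K * (4 * C), by positivity, fun {x Y w d κ} h hd hκ => ?_⟩
  have hY : 0 < Y := by linarith [h.one_le]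
  have hx : 0 < x := hY.trans_le h.le
  have hX : 1 ≤ x / Y := (one_le_div hY).mpr h.le
  rw [(h.integral_norm_sq_deriv_voronoiTransform hd hκ hc hc').2]
  have h1 := hK (x / Y) hX (4 * C * ((d : ℝ) ^ (6 * c - 6) * x ^ (2 * max (1 - c) 0)))
    (by positivity)
    (fun τ => ‖-(c + τ * Complex.I) * voronoiKernel d w κ (c + τ * Complex.I)‖ ^ 2)
    (fun τ => by positivity) (fun τ => by
      have ht : (1 : ℝ) ≤ 1 + |τ| := by linarith [abs_nonneg τ]
      have ht2 : (1 + |τ|) ^ 2 * (1 + |τ|) ^ (6 * c - 5) ≤ (1 + |τ|) ^ q := by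
        rw [← Real.rpow_natCast, ← Real.rpow_add (by linarith)]
        exact Real.rpow_le_rpow_of_exponent_le ht (by push_cast; linarith)
      have hz : ‖(-(c + τ * Complex.I) : ℂ)‖ ^ 2 ≤ 4 * (1 + |τ|) ^ 2 := by
        rw [norm_neg, ← Complex.normSq_eq_norm_sq, Complex.normSq_add_mul_I]
        nlinarith [sq_abs τ, abs_nonneg τ]
      rw [norm_mul, mul_pow]
      calc _ ≤ 4 * (1 + |τ|) ^ 2 * (C * ((d : ℝ) ^ (6 * c - 6) * x ^ (2 * max (1 - c) 0)) *
          ((1 + |τ|) ^ (6 * c - 5) * min 1 ((x / Y / (1 + |τ|)) ^ 3) ^ 2)) :=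
            mul_le_mul hz (hC h hd hκ τ) (by positivity) (by positivity)
        _ = 4 * C * ((d : ℝ) ^ (6 * c - 6) * x ^ (2 * max (1 - c) 0)) *
          (((1 + |τ|) ^ 2 * (1 + |τ|) ^ (6 * c - 5)) *
            min 1 ((x / Y / (1 + |τ|)) ^ 3) ^ 2) := by ring
        _ ≤ _ := by gcongr)
  have h2 : 1 / (2 * Real.pi) ≤ 1 := by
    rw [div_le_one (by positivity)]; linarith [Real.pi_gt_three]
  calc _ ≤ 1 * ∫ τ : ℝ, ‖-(c + τ * Complex.I) * voronoiKernel d w κ (c + τ * Complex.I)‖ ^ 2 :=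
        mul_le_mul_of_nonneg_right h2 (integral_nonneg fun τ => by positivity)
    _ ≤ _ := (one_mul _).trans_le h1
    _ = _ := by ring

end IsCutoff

end

section

open MeasureTheory Set

lemma injOn_natCast_zmod (d : ℕ) :
    Set.InjOn (fun h : ℕ => (h : ZMod d)) ((Finset.Icc 1 d : Finset ℕ) : Set ℕ) := by
  intro a ha b hb hab
  simp only [Finset.coe_Icc, Set.mem_Icc] at ha hb
  have h1 : a ≡ b [MOD d] := (ZMod.natCast_eq_natCast_iff a b d).mp hab
  refine Nat.ModEq.eq_of_abs_lt h1 ?_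
  rw [abs_lt]
  omega

lemma exists_natCast_eq_unit {d : ℕ} [NeZero d] (η : (ZMod d)ˣ) :
    ∃ h ∈ (Finset.Icc 1 d).filter (fun h => Nat.Coprime h d), ((h : ℕ) : ZMod d) = η := by
  have hd : 0 < d := Nat.pos_of_ne_zero (NeZero.ne d)
  have hcop := ZMod.val_coe_unit_coprime η
  have hlt := ZMod.val_lt (η : ZMod d)
  rcases Nat.eq_zero_or_pos (η : ZMod d).val with h0 | h0
  · refine ⟨d, ?_, ?_⟩
    · rw [h0, Nat.coprime_zero_left] at hcop
      simp [hcop]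
    · rw [ZMod.natCast_self, ← Nat.cast_zero, ← h0, ZMod.natCast_zmod_val]
  · refine ⟨(η : ZMod d).val, ?_, ZMod.natCast_zmod_val _⟩
    simp only [Finset.mem_filter, Finset.mem_Icc]
    exact ⟨⟨h0, hlt.le⟩, hcop⟩

lemma sum_coprime_eq_sum_units {d : ℕ} [NeZero d] (G : ZMod d → ℝ) :
    ∑ h ∈ (Finset.Icc 1 d).filter (fun h => Nat.Coprime h d), G ((h : ℕ) : ZMod d) =
      ∑ η : (ZMod d)ˣ, G η := by
  classical
  rw [← Finset.sum_image (f := G) (g := fun h : ℕ => (h : ZMod d))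
      ((injOn_natCast_zmod d).mono (by exact_mod_cast Finset.filter_subset _ _)),
    ← Finset.sum_image (f := G) (g := fun η : (ZMod d)ˣ => (η : ZMod d))
      (fun a _ b _ hab => Units.ext hab)]
  congr 1
  ext a
  simp only [Finset.mem_image, Finset.mem_univ, true_and]
  constructor
  · rintro ⟨h, hh, rfl⟩
    exact ⟨ZMod.unitOfCoprime h (Finset.mem_filter.mp hh).2, ZMod.coe_unitOfCoprime _ _⟩
  · rintro ⟨η, rfl⟩
    exact exists_natCast_eq_unit η

lemma voronoiTransform_zero (d : ℕ) (w : ℝ → ℝ) (κ : ℝ) : voronoiTransform d w κ 0 = 0 := by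
  rw [voronoiTransform]
  have : ∀ τ : ℝ, ((0 : ℝ) : ℂ) ^ (-((3 / 2 : ℝ) + τ * Complex.I : ℂ)) = 0 := fun τ => by
    rw [Complex.ofReal_zero, Complex.zero_cpow]
    intro h
    simpa using congrArg Complex.re h
  simp only [this, mul_zero, integral_zero]

/-- The optimal choice of the parameter in `sum_sieveWeight_mul_le`. -/
lemma add_div_add_mul_add_inv_mul_le {β x X d A C₁ C₂ C₃ C₄ I₁ I₂ I₃ I₄ : ℝ} (hβ : 0 < β)
    (hx1 : 1 ≤ x) (hX : 0 < X) (hXx : X ≤ x) (hd0 : 0 < d) (hdx : d ≤ x)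
    (hC₁ : 0 < C₁) (hC₂ : 0 < C₂) (hC₃ : 0 < C₃) (hC₄ : 0 < C₄) (hA : A = x ^ (1 / 3 : ℝ) / d)
    (b₁ : I₁ ≤ C₁ * (d ^ (6 * (1 / 2 + β) - 6) * x ^ (2 * (1 - (1 / 2 + β))) *
      X ^ (-1 + 6 * β + 1)))
    (b₂ : I₂ ≤ C₂ * (d ^ (6 * (1 + β) - 6) * 1 * X ^ (1 + 6 * β + 1)))
    (b₃ : I₃ ≤ C₃ * (d ^ (6 * (2 / 3 + β) - 6) * x ^ (2 * (1 - (2 / 3 + β))) *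
      X ^ (-1 + 6 * β + 1)))
    (b₄ : I₄ ≤ C₄ * (d ^ (6 * (1 / 3 + β) - 6) * x ^ (2 * (1 - (1 / 3 + β))) *
      X ^ (-1 + 6 * β + 1))) :
    I₁ + I₂ / d + 2 * A * I₃ + 2 * A⁻¹ * I₄ ≤ (C₁ + C₂ + 2 * C₃ + 2 * C₄) *
      (x ^ (12 * β) * (x / d ^ 3 + X ^ 2 / d)) := by
  have hx : 0 < x := by linarith
  have hA0 : 0 < A := by rw [hA]; positivity
  have hsmall : x ^ (-(2 * β)) ≤ 1 := Real.rpow_le_one_of_one_le_of_nonpos hx1 (by linarith)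
  have hXd : X ^ (6 * β) * d ^ (6 * β) ≤ x ^ (12 * β) := by
    rw [show 12 * β = 6 * β + 6 * β by ring, Real.rpow_add hx]
    gcongr
  have hpow : ∀ a : ℝ, d ^ (a + 6 * β) = d ^ a * d ^ (6 * β) := fun a =>
    Real.rpow_add hd0 _ _
  have hpx : ∀ a : ℝ, x ^ (a - 2 * β) = x ^ a * x ^ (-(2 * β)) := fun a => by
    rw [← Real.rpow_add hx, sub_eq_add_neg]
  have hd3 : d ^ (-3 : ℝ) = 1 / d ^ 3 := by
    rw [Real.rpow_neg hd0.le, one_div]; norm_cast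
  set P := x ^ (12 * β) * (x / d ^ 3) with hP
  have hmain : d ^ (-3 + 6 * β) * x ^ (1 - 2 * β) * X ^ (6 * β) ≤ P := by
    rw [hpow, hpx, Real.rpow_one, hd3]
    calc _ = (X ^ (6 * β) * d ^ (6 * β)) * (x / d ^ 3) * x ^ (-(2 * β)) := by ring
      _ ≤ x ^ (12 * β) * (x / d ^ 3) * 1 := by gcongr
      _ = _ := mul_one _
  have c₁ : C₁ * (d ^ (6 * (1 / 2 + β) - 6) * x ^ (2 * (1 - (1 / 2 + β))) *
      X ^ (-1 + 6 * β + 1)) ≤ C₁ * P := by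
    refine mul_le_mul_of_nonneg_left (le_of_eq_of_le ?_ hmain) hC₁.le
    congr 3 <;> ring
  have c₃ : A * (d ^ (6 * (2 / 3 + β) - 6) * x ^ (2 * (1 - (2 / 3 + β))) *
      X ^ (-1 + 6 * β + 1)) ≤ P := by
    refine le_of_eq_of_le ?_ hmain
    rw [hA, show 6 * (2 / 3 + β) - 6 = -3 + 6 * β + 1 by ring,
      show 2 * (1 - (2 / 3 + β)) = 1 - 2 * β - 1 / 3 by ring,
      show -1 + 6 * β + 1 = 6 * β by ring, Real.rpow_sub hx, Real.rpow_add hd0 _ 1,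
      Real.rpow_one]
    field_simp
  have c₄ : A⁻¹ * (d ^ (6 * (1 / 3 + β) - 6) * x ^ (2 * (1 - (1 / 3 + β))) *
      X ^ (-1 + 6 * β + 1)) ≤ P := by
    refine le_of_eq_of_le ?_ hmain
    rw [hA, show 6 * (1 / 3 + β) - 6 = -3 + 6 * β - 1 by ring,
      show 2 * (1 - (1 / 3 + β)) = 1 - 2 * β + 1 / 3 by ring,
      show -1 + 6 * β + 1 = 6 * β by ring, Real.rpow_add hx, Real.rpow_sub hd0 _ 1,
      Real.rpow_one]
    field_simp
  have c₂ : d ^ (6 * (1 + β) - 6) * 1 * X ^ (1 + 6 * β + 1) ≤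
      x ^ (12 * β) * X ^ 2 := by
    rw [show 6 * (1 + β) - 6 = 6 * β by ring, show 1 + 6 * β + 1 = 6 * β + 2 by ring,
      Real.rpow_add hX, Real.rpow_two]
    calc _ = (X ^ (6 * β) * d ^ (6 * β)) * X ^ 2 := by ring
      _ ≤ _ := by gcongr
  have s₃ := mul_le_mul_of_nonneg_left b₃ (by positivity : 0 ≤ 2 * A)
  have s₄ := mul_le_mul_of_nonneg_left b₄ (by positivity : 0 ≤ 2 * A⁻¹)
  have s₂ := div_le_div_of_nonneg_right (b₂.trans (mul_le_mul_of_nonneg_left c₂ hC₂.le)) hd0.le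
  have t₃ := mul_le_mul_of_nonneg_left c₃ hC₃.le
  have t₄ := mul_le_mul_of_nonneg_left c₄ hC₄.le
  set Q := x ^ (12 * β) * (X ^ 2 / d) with hQ
  have hQ0 : 0 ≤ Q := by positivity
  have hP0 : 0 ≤ P := by positivity
  have hQ' : C₂ * (x ^ (12 * β) * X ^ 2) / d = C₂ * Q := by rw [hQ]; ring
  rw [hQ'] at s₂
  rw [show x ^ (12 * β) * (x / d ^ 3 + X ^ 2 / d) = P + Q by rw [hP, hQ]; ring]
  nlinarith [mul_nonneg hC₁.le hQ0, mul_nonneg hC₂.le hP0, mul_nonneg hC₃.le hQ0,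
    mul_nonneg hC₄.le hQ0]

namespace IsCutoff

theorem exists_sum_sieveWeight_voronoiTransform_le (Cd : ℕ → ℝ) {β : ℝ} (hβ : 0 < β)
    (hβ' : β ≤ 1 / 6) : ∃ C : ℝ, 0 < C ∧ ∀ {x Y : ℝ} {w : ℝ → ℝ} {d c D : ℕ} {κ : ℝ},
      IsCutoff Cd x Y w → 1 ≤ d → (d : ℝ) ≤ x → |κ| ≤ 3 → c ≤ d → c ≤ D → 1 ≤ D → ∀ N : ℕ,
      ∑ n ∈ Finset.Icc 1 N, sieveWeight β d c n * ‖voronoiTransform d w κ (D * n : ℕ)‖ ^ 2 ≤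
        C * (x ^ (12 * β) * (x / d ^ 3 + (x / Y) ^ 2 / d)) := by
  obtain ⟨C₁, hC₁, h₁⟩ := exists_integral_norm_sq_voronoiTransform_le Cd (c := 1 / 2 + β)
    (q := -1 + 6 * β) (by linarith) (by linarith) (by linarith) (by linarith) (by linarith)
    (by linarith)
  obtain ⟨C₂, hC₂, h₂⟩ := exists_integral_norm_sq_voronoiTransform_le Cd (c := 1 + β)
    (q := 1 + 6 * β) (by linarith) (by linarith) (by linarith) (by linarith) (by linarith)
    (by linarith)
  obtain ⟨C₃, hC₃, h₃⟩ := exists_integral_norm_sq_voronoiTransform_le Cd (c := 2 / 3 + β)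
    (q := -1 + 6 * β) (by linarith) (by linarith) (by linarith) (by linarith) (by linarith)
    (by linarith)
  obtain ⟨C₄, hC₄, h₄⟩ := exists_integral_norm_sq_deriv_voronoiTransform_le Cd (c := 1 / 3 + β)
    (q := -1 + 6 * β) (by linarith) (by linarith) (by linarith) (by linarith) (by linarith)
    (by linarith)
  refine ⟨C₁ + C₂ + 2 * C₃ + 2 * C₄, by positivity,
    fun {x Y w d c D κ} h hd hdx hκ hcd hcD hD N => ?_⟩
  have hY : 0 < Y := by linarith [h.one_le]
  have hx : 0 < x := hY.trans_le h.le
  have hx1 : 1 ≤ x := h.one_le.trans h.le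
  have hX : 0 < x / Y := by positivity
  have hXx : x / Y ≤ x := div_le_self hx.le h.one_le
  have hd0 : (0 : ℝ) < d := by exact_mod_cast hd
  have hdn : d ≠ 0 := by omega
  have e₁ : 2 * (1 / 2 + β) - 1 = 2 * β := by ring
  have e₂ : 2 * (1 + β) - 1 = 1 + 2 * β := by ring
  have e₃ : 2 * (2 / 3 + β) - 1 = 1 / 3 + 2 * β := by ring
  have e₄ : 2 * (1 / 3 + β) - 1 = -(1 / 3) + 2 * β := by ring
  have i₁ := (h.integral_norm_sq_voronoiTransform (c := 1 / 2 + β) hdn hκ (by linarith)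
    (by linarith)).1
  have i₂ := (h.integral_norm_sq_voronoiTransform (c := 1 + β) hdn hκ (by linarith)
    (by linarith)).1
  have i₃ := (h.integral_norm_sq_voronoiTransform (c := 2 / 3 + β) hdn hκ (by linarith)
    (by linarith)).1
  have i₄ := (h.integral_norm_sq_deriv_voronoiTransform (c := 1 / 3 + β) hdn hκ (by linarith)
    (by linarith)).1
  have b₁ := h₁ h hdn hκ
  have b₂ := h₂ h hdn hκ
  have b₃ := h₃ h hdn hκ
  have b₄ := h₄ h hdn hκ
  rw [e₁] at i₁ b₁
  rw [e₂] at i₂ b₂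
  rw [e₃] at i₃ b₃
  rw [e₄] at i₄ b₄
  rw [max_eq_left (by linarith)] at b₁ b₃ b₄
  rw [max_eq_right (by linarith), mul_zero, Real.rpow_zero] at b₂
  have hA0 : 0 < x ^ (1 / 3 : ℝ) / d := by positivity
  refine (sum_sieveWeight_mul_le hβ hd hcd hcD hD
    (fun y hy => (h.hasDerivAt_voronoiTransform hdn hκ one_pos (by norm_num) hy).differentiableAt.hasDerivAt)
    (h.continuousOn_deriv_voronoiTransform hdn hκ) hA0 i₁ i₂ i₃ i₄ N).trans ?_
  exact add_div_add_mul_add_inv_mul_le hβ hx1 hX hXx hd0 hdx hC₁ hC₂ hC₃ hC₄ rfl b₁ b₂ b₃ b₄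

end IsCutoff

end

/-- Let `ε > 0`, `x ≥ 2`, `1 ≤ d ≤ x`, `x^{1/2} ≤ Y ≤ x` with
`x²d³/Y³ ≥ x^{1/100}`, and let `w` be a smooth cutoff adapted to `(Y,x)` with derivative
constants `Cd`.  For `gcd(h,d) = 1`, `E h` is the meromorphic continuation of
`E_{h/d}(s) = Σ_{n≥1} d₃(n) e(nh/d) n^{-s}` (with only pole at `s = 1` of order at most 3),
`R h = Res_{s=1}{ E_{h/d}(s)·∫₀^∞ w(t)t^{s-1}dt }` (expressed via an analytic `g` with
`g(s) = (s-1)³ E_{h/d}(s) ∫₀^∞ w(t)t^{s-1}dt` near `1`, as `g''(1)/2!`), and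
`Δ̃(h/d) = Σ_{n≥1} d₃(n) e(nh/d) w(n) − R h`.  Then
`Σ′_{h=1}^{d} |Δ̃(h/d)|² ≤ C(ε, Cd) · x^ε · ((xd/Y)²·d + x·d)`. -/
theorem stmt19 (Cd : ℕ → ℝ) :
    ∀ ε : ℝ, 0 < ε → ∃ C : ℝ, 0 < C ∧
      ∀ x Y : ℝ, ∀ d : ℕ, ∀ w : ℝ → ℝ, ∀ E : ℕ → ℂ → ℂ, ∀ R : ℕ → ℂ,
        2 ≤ x → 1 ≤ d → (d : ℝ) ≤ x →
        x ^ ((1 : ℝ) / 2) ≤ Y → Y ≤ x →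
        x ^ ((1 : ℝ) / 100) ≤ x ^ 2 * (d : ℝ) ^ 3 / Y ^ 3 →
        ContDiff ℝ (⊤ : ℕ∞) w →
        (∀ t : ℝ, 0 ≤ t → t ≤ Y → w t = 0) →
        (∀ t : ℝ, 2 * Y ≤ t → t ≤ x - Y → w t = 1) →
        (∀ t : ℝ, x ≤ t → w t = 0) →
        (∀ i : ℕ, ∀ t : ℝ, 0 ≤ t → |iteratedDeriv i w t| ≤ Cd i / Y ^ i) →
        (∀ h : ℕ, Nat.Coprime h d → ∀ s : ℂ, 1 < s.re →
          HasSum (fun n : ℕ => (d3 n : ℂ) * e ((n : ℝ) * h / d) / (n : ℂ) ^ s) (E h s)) →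
        (∀ h ∈ (Finset.Icc 1 d).filter (fun h => Nat.Coprime h d),
          ∃ g : ℂ → ℂ, AnalyticAt ℂ g 1 ∧
            (∀ᶠ s in nhdsWithin (1 : ℂ) {(1 : ℂ)}ᶜ,
              g s = (s - 1) ^ 3 * E h s *
                ∫ t in Set.Ioi (0 : ℝ), (w t : ℂ) * (t : ℂ) ^ (s - 1)) ∧
            R h = iteratedDeriv 2 g 1 / 2) →
        ∑ h ∈ (Finset.Icc 1 d).filter (fun h => Nat.Coprime h d),
            ‖(∑' n : ℕ, (d3 n : ℂ) * e ((n : ℝ) * h / d) * (w n : ℂ)) - R h‖ ^ 2 ≤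
          C * x ^ ε * ((x * d / Y) ^ 2 * d + x * d) := by
  intro ε hε
  have hβ : 0 < min (ε / 18) (1 / 6) := lt_min (by positivity) (by norm_num)
  have hβε : 18 * min (ε / 18) (1 / 6) ≤ ε := by linarith [min_le_left (ε / 18) (1 / 6)]
  have hβ' := min_le_right (ε / 18) (1 / 6 : ℝ)
  set β := min (ε / 18) (1 / 6)
  obtain ⟨C₁, hC₁, h₁⟩ := exists_sum_norm_sq_le_of_hasSum hβ
  obtain ⟨C₂, hC₂, h₂⟩ := IsCutoff.exists_sum_sieveWeight_voronoiTransform_le Cd hβ hβ'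
  obtain ⟨C₃, hC₃, h₃⟩ := exists_card_divisors_le hβ
  refine ⟨C₁ * C₂ * C₃ ^ 6, by positivity, ?_⟩
  intro x Y d w E R hx hd hdx hxY hYx _ hw hleft hmid hright hbound hE hR
  have hY : 1 ≤ Y := (Real.one_le_rpow (by linarith) (by norm_num)).trans hxY
  have hcut : IsCutoff Cd x Y w := ⟨hY, hYx, hw, hleft, hmid, hright, hbound⟩
  have hx0 : 0 < x := by linarith
  have hd0 : (0 : ℝ) < d := by exact_mod_cast hd
  have : NeZero d := ⟨by omega⟩
  set T : ZMod d → ℕ × ℕ × ℕ → ℂ := fun a p => ∑ σ : ℤˣ × ℤˣ × ℤˣ,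
    tripleSum a (((σ.1 : ℤ) : ZMod d) * p.1) (((σ.2.1 : ℤ) : ZMod d) * p.2.1)
      (((σ.2.2 : ℤ) : ZMod d) * p.2.2) *
      voronoiTransform d w (signSum σ) (p.1 * p.2.1 * p.2.2 : ℕ)
  have herr : ∀ h ∈ (Finset.Icc 1 d).filter (fun h => Nat.Coprime h d),
      HasSum (T (h : ZMod d))
        ((∑' n : ℕ, (d3 n : ℂ) * e ((n : ℝ) * h / d) * (w n : ℂ)) - R h) := by
    intro h hh
    obtain ⟨g, hg, hgE, hRg⟩ := hR h hh
    rw [hRg]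
    exact hcut.hasSum_error hg (hE h (Finset.mem_filter.mp hh).2) hgE
  have hsum : ∀ η : (ZMod d)ˣ, HasSum (T η) (∑' p, T η p) := fun η => by
    obtain ⟨h, hh, hη⟩ := exists_natCast_eq_unit η
    rw [← hη]
    exact (herr h hh).summable.hasSum
  rw [Finset.sum_congr rfl fun h hh => by rw [← (herr h hh).tsum_eq],
    sum_coprime_eq_sum_units (fun a => ‖∑' p, T a p‖ ^ 2)]
  have hmain := h₁ d (fun σ n => voronoiTransform d w (signSum σ) n) (fun η => ∑' p, T η p)
    (C₂ * (x ^ (12 * β) * (x / d ^ 3 + (x / Y) ^ 2 / d)))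
    (fun σ => by simpa using voronoiTransform_zero d w (signSum σ)) hsum
    (fun σ p hp N => by
      obtain ⟨hp1, hp2⟩ := Finset.mem_product.mp hp
      have hp1' := Nat.pos_of_mem_divisors hp1
      have hp2' := Nat.pos_of_mem_divisors hp2
      refine h₂ hcut hd hdx (abs_signSum_le σ) (Nat.gcd_le_left _ hd) ?_
        (Nat.mul_pos (pow_pos hp1' 2) hp2') N
      refine (Nat.gcd_le_right _ (Nat.mul_pos hp1' hp2')).trans
        (Nat.mul_le_mul_right _ (Nat.le_self_pow two_ne_zero _)))
  refine hmain.trans ?_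
  have hτ : (d.divisors.card : ℝ) ^ 6 ≤ C₃ ^ 6 * x ^ (6 * β) := by
    have h4 : (d.divisors.card : ℝ) ≤ C₃ * x ^ β :=
      (h₃ d (by omega)).trans (by gcongr)
    refine (pow_le_pow_left₀ (Nat.cast_nonneg _) h4 6).trans_eq ?_
    rw [mul_pow, ← Real.rpow_mul_natCast hx0.le]
    norm_num [mul_comm]
  have hxε : x ^ (6 * β) * x ^ (12 * β) ≤ x ^ ε := by
    rw [← Real.rpow_add hx0]
    exact Real.rpow_le_rpow_of_exponent_le (by linarith) (by linarith)
  have hY0 : 0 < Y := by linarith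
  calc _ ≤ C₁ * ((C₃ ^ 6 * x ^ (6 * β)) * d ^ 4) *
        (C₂ * (x ^ (12 * β) * (x / d ^ 3 + (x / Y) ^ 2 / d))) := by
        refine mul_le_mul_of_nonneg_right (mul_le_mul_of_nonneg_left
          (mul_le_mul_of_nonneg_right hτ (by positivity)) hC₁.le) (by positivity)
    _ = C₁ * C₂ * C₃ ^ 6 * (x ^ (6 * β) * x ^ (12 * β)) * ((x * d / Y) ^ 2 * d + x * d) := by
        field_simp
        ring
    _ ≤ _ := by gcongr
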